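/- Let f, g ∈ ℤ[x] be monic with f quadratic, and let γ ∈ ℚ be the critical point of f. Suppose that g ∘ f^n is irreducible over ℚ for all n ≥ 0, that the set {g(f^n(γ)) : n ≥ 1} ⊆ ℚ is infinite, that g divides f^r in ℤ[x] for some r ≥ 0, and that the set {f^n(0) : n ≥ 1} is finite and does not contain 0. Then for every a₀ ∈ ℤ, the natural density of P(g, f, a₀) exists and equals 0. -/

import Mathlib

open Polynomial Filter

/-- The `n`-th iterate of a polynomial, with `f^0 = X`. -/
noncomputable def polyIter (f : Polynomial ℤ) : ℕ → Polynomial ℤ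
  | 0 => X
  | n + 1 => f.comp (polyIter f n)

open scoped Classical in
/-- The number of elements of `S` that are at most `x`. -/
noncomputable def primeCount (S : Set ℕ) (x : ℕ) : ℕ :=
  ((Finset.range (x + 1)).filter (fun p => p ∈ S)).card

/-- A set `S` of primes has natural density zero:
`lim_{x → ∞} #{p ∈ S : p ≤ x} / #{p prime : p ≤ x}` exists and equals `0`. -/
def HasPrimeDensityZero (S : Set ℕ) : Prop :=
  Tendsto (fun x : ℕ => (primeCount S x : ℝ) / (primeCount {p | p.Prime} x : ℝ))
    atTop (nhds 0)

/-- `P(g, f, a₀)`: the set of primes dividing some nonzero term of the sequence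
`(g(f^n(a₀)))_{n ≥ 0}`. -/
def transOrbitPrimes (g f : Polynomial ℤ) (a₀ : ℤ) : Set ℕ :=
  {p | p.Prime ∧ ∃ n : ℕ, Polynomial.eval ((fun x => Polynomial.eval x f)^[n] a₀) g ≠ 0 ∧
    (p : ℤ) ∣ Polynomial.eval ((fun x => Polynomial.eval x f)^[n] a₀) g}

section RiemannSum
open MeasureTheory Module
open scoped Pointwise

theorem riemann_lattice {E ι : Type*} [NormedAddCommGroup E] [NormedSpace ℝ E]
    [FiniteDimensional ℝ E] [MeasurableSpace E] [BorelSpace E] [Finite ι]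
    (μ : Measure E) [μ.IsAddHaarMeasure] (b : Basis ι ℝ E) (R : ℝ) (hR : 0 ≤ R) :
    ∃ C : ℝ, 0 ≤ C ∧ ∀ (h : E → ℝ) (κ : NNReal), LipschitzWith κ h →
      (∀ x, h x ≠ 0 → ‖x‖ ≤ R) → ∀ X : ℝ, 1 ≤ X →
      |(∑' v : Submodule.span ℤ (Set.range b), h (X⁻¹ • (v : E))) -
        X ^ (finrank ℝ E) * ((∫ x, h x ∂μ) / μ.real (ZSpan.fundamentalDomain b))|
        ≤ C * κ * X ^ (finrank ℝ E) / X := by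
  classical
  have : ProperSpace E := FiniteDimensional.proper_real E
  have : VAddInvariantMeasure (Submodule.span ℤ (Set.range b)) E μ :=
    inferInstanceAs (VAddInvariantMeasure (Submodule.span ℤ (Set.range b)).toAddSubgroup E μ)
  set F := ZSpan.fundamentalDomain b with hF
  set d := finrank ℝ E with hd
  obtain ⟨D, hD0, hD⟩ := (ZSpan.fundamentalDomain_isBounded b).exists_pos_norm_le
  have hFm : MeasurableSet F := ZSpan.fundamentalDomain_measurableSet b
  have hFd : IsAddFundamentalDomain (Submodule.span ℤ (Set.range b)) F μ :=
    ZSpan.isAddFundamentalDomain b μ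
  have hFfin : μ F ≠ ⊤ := (ZSpan.fundamentalDomain_isBounded b).measure_lt_top.ne
  have hFpos : 0 < μ.real F := by
    rw [Measure.real, ENNReal.toReal_pos_iff]
    exact ⟨pos_iff_ne_zero.2 (ZSpan.measure_fundamentalDomain_ne_zero b), lt_top_iff_ne_top.2 hFfin⟩
  set B := μ.real (Metric.closedBall (0:E) (R + 2 * D)) with hB
  refine ⟨D * B / μ.real F, by positivity, fun h κ hh hs X hX => ?_⟩
  have hX0 : 0 < X := by linarith
  set hX' : E → ℝ := fun y => h (X⁻¹ • y) with hhX
  have hcont : Continuous hX' := hh.continuous.comp (continuous_const_smul _)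
  have hsupp : ∀ y, hX' y ≠ 0 → ‖y‖ ≤ R * X := by
    intro y hy
    have := hs _ hy
    rw [norm_smul, norm_inv, Real.norm_of_nonneg hX0.le] at this
    rwa [inv_mul_le_iff₀ hX0, mul_comm] at this
  have hcs : HasCompactSupport hX' := by
    apply HasCompactSupport.of_support_subset_isCompact (isCompact_closedBall (0:E) (R * X))
    intro y hy
    simpa using hsupp y hy
  have hint : Integrable hX' μ := hcont.integrable_of_hasCompactSupport hcs
  have hscale : ∫ y, hX' y ∂μ = X ^ d * ∫ x, h x ∂μ := by
    rw [hhX, Measure.integral_comp_smul, smul_eq_mul, inv_pow, inv_inv, abs_of_pos (by positivity)]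
  -- finite set
  have hfin : {v : Submodule.span ℤ (Set.range b) | ‖(v:E)‖ ≤ R * X + D}.Finite := by
    have := ZSpan.setFinite_inter b (s := Metric.closedBall (0:E) (R * X + D))
      Metric.isBounded_closedBall
    refine Set.Finite.of_finite_image (f := fun v => (v:E)) (this.subset ?_)
      (Subtype.val_injective.injOn)
    rintro _ ⟨v, hv, rfl⟩
    exact ⟨by simpa using hv, v.2⟩
  set S := hfin.toFinset with hS
  have hsum1 : (∑' v : Submodule.span ℤ (Set.range b), h (X⁻¹ • (v : E))) =
      ∑ v ∈ S, hX' (v:E) := by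
    rw [tsum_eq_sum]
    intro v hv
    by_contra hne
    apply hv
    have := hsupp _ hne
    simp only [hS, Set.Finite.mem_toFinset, Set.mem_ofPred_eq]
    linarith
  have hI : ∫ y, hX' y ∂μ = ∑ v ∈ S, ∫ x in F, hX' ((v:E) + x) ∂μ := by
    have h1 := hFd.integral_eq_tsum'' hX' hint
    rw [h1, tsum_eq_sum (s := S)]
    · rfl
    · intro v hv
      apply setIntegral_eq_zero_of_forall_eq_zero
      intro x hx
      by_contra hne
      apply hv
      have h2 := hsupp _ hne
      have h3 := hD x hx
      simp only [hS, Set.Finite.mem_toFinset, Set.mem_ofPred_eq]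
      have h4 : ‖(v:E)‖ ≤ ‖(v:E) + x‖ + ‖x‖ := by
        simpa using norm_sub_le ((v:E) + x) x
      have h5 : ‖(v:E) + x‖ ≤ R * X := h2
      linarith
  have hcard : (S.card : ℝ) * μ.real F ≤ X ^ d * B := by
    have h1 : ∑ v ∈ S, μ ((v : Submodule.span ℤ (Set.range b)) +ᵥ F) ≤
        μ (Metric.closedBall (0:E) (X * (R + 2 * D))) := by
      rw [← measure_biUnion_finset₀ (fun v _ w _ hvw => hFd.aedisjoint hvw)
        (fun v _ => (hFm.const_vadd v).nullMeasurableSet)]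
      apply measure_mono
      intro y hy
      simp only [Set.mem_iUnion] at hy
      obtain ⟨v, hv, x, hx, rfl⟩ := hy
      simp only [hS, Set.Finite.mem_toFinset, Set.mem_ofPred_eq] at hv
      have h3 := hD x hx
      have h4 : ‖(v:E) + x‖ ≤ ‖(v:E)‖ + ‖x‖ := norm_add_le _ _
      have h6 : ‖v +ᵥ x‖ = ‖(v:E) + x‖ := rfl
      simp only [mem_closedBall_zero_iff]
      nlinarith
    simp only [measure_vadd, Finset.sum_const, nsmul_eq_mul] at h1
    rw [Measure.addHaar_closedBall_mul _ _ hX0.le (by positivity)] at h1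
    have h2 := ENNReal.toReal_mono (ENNReal.mul_ne_top ENNReal.ofReal_ne_top
      measure_closedBall_lt_top.ne) h1
    rw [ENNReal.toReal_mul, ENNReal.toReal_mul, ENNReal.toReal_ofReal (by positivity)] at h2
    simpa [Measure.real, hd, hB] using h2
  have hterm : ∀ v ∈ S, |hX' (v:E) * μ.real F - ∫ x in F, hX' ((v:E) + x) ∂μ| ≤
      κ * (D / X) * μ.real F := by
    intro v _
    have h1 : hX' (v:E) * μ.real F = ∫ x in F, hX' (v:E) ∂μ := by
      rw [setIntegral_const, smul_eq_mul, mul_comm]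
    have hi2 : IntegrableOn (fun x => hX' ((v:E) + x)) F μ :=
      (hint.comp_add_left (v:E)).integrableOn
    rw [h1, ← integral_sub (integrableOn_const (C := hX' (v:E)) hFfin (by simp)) hi2]
    rw [← Real.norm_eq_abs]
    apply norm_setIntegral_le_of_norm_le_const (lt_top_iff_ne_top.2 hFfin)
    intro x hx
    have := hh.dist_le_mul (X⁻¹ • (v:E)) (X⁻¹ • ((v:E) + x))
    rw [← dist_eq_norm]
    refine this.trans ?_
    rw [dist_eq_norm, ← smul_sub, sub_add_cancel_left, smul_neg, norm_neg, norm_smul, norm_inv,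
      Real.norm_of_nonneg hX0.le, inv_mul_eq_div]
    gcongr
    exact hD x hx
  have hmain : |(∑ v ∈ S, hX' (v:E)) * μ.real F - X ^ d * ∫ x, h x ∂μ| ≤
      S.card * (κ * (D / X) * μ.real F) := by
    rw [← hscale, hI, Finset.sum_mul, ← Finset.sum_sub_distrib]
    refine (Finset.abs_sum_le_sum_abs _ _).trans ?_
    refine (Finset.sum_le_sum hterm).trans ?_
    simp
  rw [hsum1]
  have e1 : (∑ v ∈ S, hX' (v:E)) - X ^ d * ((∫ x, h x ∂μ) / μ.real F) =
    ((∑ v ∈ S, hX' (v:E)) * μ.real F - X ^ d * ∫ x, h x ∂μ) / μ.real F := by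
    field_simp
  rw [e1, abs_div, abs_of_pos hFpos, div_le_iff₀ hFpos]
  refine hmain.trans ?_
  have : (S.card : ℝ) * (κ * (D / X) * μ.real F) = (κ * D / X) * (S.card * μ.real F) := by ring
  rw [this]
  refine (mul_le_mul_of_nonneg_left hcard (by positivity)).trans (le_of_eq ?_)
  field_simp

end RiemannSum

section LipNorm
open scoped Classical
open NumberField NumberField.mixedEmbedding NumberField.InfinitePlace NumberField.Units
  NumberField.Units.dirichletUnitTheorem Module

variable {K : Type*} [Field K] [NumberField K]

theorem normAtPlace_contDiffAt (w : InfinitePlace K) (x : mixedSpace K)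
    (hx : normAtPlace w x ≠ 0) : ContDiffAt ℝ 1 (fun y : mixedSpace K => normAtPlace w y) x := by
  classical
  by_cases hw : IsReal w
  · have h1 : (fun y : mixedSpace K => normAtPlace w y) = fun y => ‖y.1 ⟨w, hw⟩‖ := by
      funext y; exact normAtPlace_apply_of_isReal hw y
    rw [h1]
    have h2 : x.1 ⟨w, hw⟩ ≠ 0 := by
      rw [normAtPlace_apply_of_isReal hw] at hx
      simpa using hx
    refine ContDiffAt.norm ℝ ?_ h2
    fun_prop
  · rw [not_isReal_iff_isComplex] at hw
    have h1 : (fun y : mixedSpace K => normAtPlace w y) = fun y => ‖y.2 ⟨w, hw⟩‖ := by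
      funext y; exact normAtPlace_apply_of_isComplex hw y
    rw [h1]
    have h2 : x.2 ⟨w, hw⟩ ≠ 0 := by
      rw [normAtPlace_apply_of_isComplex hw] at hx
      simpa using hx
    refine ContDiffAt.norm ℝ ?_ h2
    fun_prop

theorem mixedNorm_contDiffAt (x : mixedSpace K)
    (hx : mixedEmbedding.norm x ≠ 0) :
    ContDiffAt ℝ 1 (fun y : mixedSpace K => mixedEmbedding.norm y) x := by
  have h1 : (fun y : mixedSpace K => mixedEmbedding.norm y) =
    fun y => ∏ w : InfinitePlace K, (normAtPlace w y) ^ (mult w) := by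
    funext y; exact mixedEmbedding.norm_apply y
  rw [h1]
  apply contDiffAt_prod
  intro w _
  exact (normAtPlace_contDiffAt w x (mixedEmbedding.norm_ne_zero_iff.mp hx w)).pow _

theorem logMap_contDiffAt (x : mixedSpace K)
    (hx : mixedEmbedding.norm x ≠ 0) :
    ContDiffAt ℝ 1 (fun y : mixedSpace K => logMap y) x := by
  rw [contDiffAt_pi]
  intro w
  simp only [logMap_apply]
  have h1 := (normAtPlace_contDiffAt w.1 x (mixedEmbedding.norm_ne_zero_iff.mp hx w)).log
    (mixedEmbedding.norm_ne_zero_iff.mp hx w)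
  have h2 := (mixedNorm_contDiffAt x hx).log hx
  exact contDiffAt_const.mul (h1.sub (h2.mul contDiffAt_const))

theorem bounded_of_logMap (a b R : ℝ) (ha : 0 < a) :
    ∃ M : ℝ, ∀ x : mixedSpace K, a ≤ mixedEmbedding.norm x → mixedEmbedding.norm x ≤ b →
      ‖logMap x‖ ≤ R → ‖x‖ ≤ M := by
  classical
  set L := max |Real.log a| |Real.log b| with hL
  have hd : (0:ℝ) < (finrank ℚ K : ℝ) := by exact_mod_cast finrank_pos
  set n : ℝ := (Fintype.card (InfinitePlace K) : ℝ) with hn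
  have hn0 : 0 ≤ n := by positivity
  refine ⟨Real.exp (n * (|R| + 2 * L) + L + (|R| + L)), fun x h1 h2 h3 => ?_⟩
  have hN : 0 < mixedEmbedding.norm x := lt_of_lt_of_le ha h1
  have hlogN : |Real.log (mixedEmbedding.norm x)| ≤ L := by
    rw [abs_le]
    constructor
    · have : Real.log a ≤ Real.log (mixedEmbedding.norm x) := Real.log_le_log ha h1
      have := neg_abs_le (Real.log a)
      have := le_max_left |Real.log a| |Real.log b|
      linarith
    · have : Real.log (mixedEmbedding.norm x) ≤ Real.log b := Real.log_le_log hN h2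
      have := le_abs_self (Real.log b)
      have := le_max_right |Real.log a| |Real.log b|
      linarith
  have hL0 : 0 ≤ L := (abs_nonneg _).trans hlogN
  have hR0 : 0 ≤ |R| := abs_nonneg R
  have hpos : ∀ w, 0 < normAtPlace w x := fun w =>
    lt_of_le_of_ne (normAtPlace_nonneg _ _) (mixedEmbedding.norm_ne_zero_iff.mp hN.ne' w).symm
  have hmult : ∀ w : InfinitePlace K, (1:ℝ) ≤ mult w := fun w => by exact_mod_cast one_le_mult
  -- bound for w ≠ w₀
  have hA : ∀ w : InfinitePlace K, w ≠ w₀ →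
      |(mult w : ℝ) * Real.log (normAtPlace w x)| ≤ |R| + 2 * L := by
    intro w hw
    have e1 : |logMap x ⟨w, hw⟩| ≤ |R| :=
      ((norm_le_pi_norm (logMap x) ⟨w, hw⟩).trans h3).trans (le_abs_self R)
    rw [logMap_apply] at e1
    have e2 : |(mult w : ℝ) * (Real.log (mixedEmbedding.norm x) * (finrank ℚ K : ℝ)⁻¹)| ≤ 2 * L := by
      rw [abs_mul, abs_mul, abs_of_pos (inv_pos.2 hd)]
      have hm2 : |(mult w : ℝ)| ≤ 2 := by
        rw [abs_of_nonneg (by positivity)]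
        unfold mult
        split_ifs <;> norm_num
      have hd1 : (finrank ℚ K : ℝ)⁻¹ ≤ 1 := by
        apply inv_le_one_of_one_le₀
        exact_mod_cast (finrank_pos : 0 < finrank ℚ K)
      have : |Real.log (mixedEmbedding.norm x)| * (finrank ℚ K : ℝ)⁻¹ ≤ L := by
        calc _ ≤ L * 1 := by gcongr
          _ = L := mul_one _
      gcongr
    calc |(mult w : ℝ) * Real.log (normAtPlace w x)|
        = |(mult w : ℝ) * (Real.log (normAtPlace w x) -
            Real.log (mixedEmbedding.norm x) * (finrank ℚ K : ℝ)⁻¹) +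
            (mult w : ℝ) * (Real.log (mixedEmbedding.norm x) * (finrank ℚ K : ℝ)⁻¹)| := by ring_nf
      _ ≤ _ := (abs_add_le _ _).trans (add_le_add e1 e2)
  have hsum : ∑ w : InfinitePlace K, (mult w : ℝ) * Real.log (normAtPlace w x) =
      Real.log (mixedEmbedding.norm x) := by
    rw [mixedEmbedding.norm_apply, Real.log_prod]
    · simp
    · intro w _
      exact pow_ne_zero _ (hpos w).ne'
  have hB : ∀ w : InfinitePlace K,
      (mult w : ℝ) * Real.log (normAtPlace w x) ≤ n * (|R| + 2 * L) + L + (|R| + L) := by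
    intro w
    by_cases hw : w = w₀
    · rw [← Finset.add_sum_erase _ _ (Finset.mem_univ w)] at hsum
      have e3 : |∑ v ∈ Finset.univ.erase w, (mult v : ℝ) * Real.log (normAtPlace v x)| ≤
          n * (|R| + 2 * L) := by
        refine (Finset.abs_sum_le_sum_abs _ _).trans ?_
        refine (Finset.sum_le_card_nsmul _ _ (|R| + 2 * L) ?_).trans ?_
        · intro v hv
          exact hA v (by rw [← hw]; exact (Finset.mem_erase.1 hv).1)
        · rw [nsmul_eq_mul]
          gcongr
          rw [hn]
          exact_mod_cast Finset.card_le_univ _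
      have e4 := (abs_le.1 e3).1
      have e5 := (abs_le.1 hlogN).2
      linarith
    · have e6 := (abs_le.1 (hA w hw)).2
      have : 1 ≤ n := by
        rw [hn]; exact_mod_cast (Fintype.card_pos : 0 < Fintype.card (InfinitePlace K))
      nlinarith
  have hC : ∀ w : InfinitePlace K, normAtPlace w x ≤ Real.exp (n * (|R| + 2 * L) + L + (|R| + L)) := by
    intro w
    rw [← Real.log_le_iff_le_exp (hpos w)]
    by_cases h0 : 0 ≤ Real.log (normAtPlace w x)
    · have := hB w
      have := hmult w
      nlinarith
    · have : 0 ≤ n * (|R| + 2 * L) + L + (|R| + L) := by positivity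
      linarith
  rw [norm_eq_sup'_normAtPlace]
  exact Finset.sup'_le _ _ fun w _ => hC w

theorem lip_bump (χ : ℝ → ℝ) (ω : logSpace K → ℝ) (hχ : ContDiff ℝ 1 χ) (hω : ContDiff ℝ 1 ω)
    (a b R : ℝ) (ha : 0 < a) (hχs : ∀ t, χ t ≠ 0 → a ≤ t ∧ t ≤ b)
    (hωs : ∀ t, ω t ≠ 0 → ‖t‖ ≤ R) :
    ∃ κ : NNReal, LipschitzWith κ
      (fun x : mixedSpace K => χ (mixedEmbedding.norm x) * ω (logMap x)) := by
  classical
  obtain ⟨M, hM⟩ := bounded_of_logMap (K := K) a b R ha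
  have hcs : HasCompactSupport
      (fun x : mixedSpace K => χ (mixedEmbedding.norm x) * ω (logMap x)) := by
    have : ProperSpace (mixedSpace K) := FiniteDimensional.proper_real _
    apply HasCompactSupport.of_support_subset_isCompact (isCompact_closedBall (0:mixedSpace K) M)
    intro x hx
    have hx' : χ (mixedEmbedding.norm x) * ω (logMap x) ≠ 0 := hx
    have h1 := hχs _ (left_ne_zero_of_mul hx')
    have h2 := hωs _ (right_ne_zero_of_mul hx')
    simpa using hM x h1.1 h1.2 h2
  have hcd : ContDiff ℝ 1
      (fun x : mixedSpace K => χ (mixedEmbedding.norm x) * ω (logMap x)) := by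
    rw [contDiff_iff_contDiffAt]
    intro x
    by_cases hx : mixedEmbedding.norm x = 0
    · have h1 : ∀ᶠ y in nhds x, mixedEmbedding.norm y < a :=
        (mixedEmbedding.continuous_norm K).continuousAt.eventually_lt_const (by rw [hx]; exact ha)
      have h2 : (fun x : mixedSpace K => χ (mixedEmbedding.norm x) * ω (logMap x)) =ᶠ[nhds x]
          fun _ => 0 := by
        filter_upwards [h1] with y hy
        have : χ (mixedEmbedding.norm y) = 0 := by
          by_contra hne
          exact absurd (hχs _ hne).1 (not_le.2 hy)
        simp [this]
      exact contDiffAt_const.congr_of_eventuallyEq h2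
    · have h1 := hχ.contDiffAt.comp x (mixedNorm_contDiffAt x hx)
      have h2 := hω.contDiffAt.comp x (logMap_contDiffAt x hx)
      exact h1.mul h2
  exact ContDiff.lipschitzWith_of_hasCompactSupport hcs hcd (by norm_num)

theorem smooth_cutoff (a b : ℝ) (ha : 0 < a) (hab : a < b) :
    ∃ χ : ℝ → ℝ, ContDiff ℝ 1 χ ∧ (∀ t, 0 ≤ χ t ∧ χ t ≤ 1) ∧ (∀ t, a ≤ t → t ≤ b → χ t = 1) ∧
      ∀ t, χ t ≠ 0 → a / 2 ≤ t ∧ t ≤ 2 * b := by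
  let f : ContDiffBump ((a + b) / 2) := ⟨(b - a) / 2, (b - a) / 2 + a / 2, by linarith, by linarith⟩
  refine ⟨f, f.contDiff, fun t => ⟨f.nonneg, f.le_one⟩, fun t h1 h2 => ?_, fun t ht => ?_⟩
  · apply f.one_of_mem_closedBall
    rw [Metric.mem_closedBall, Real.dist_eq, abs_le]
    constructor <;> simp only [f] <;> linarith
  · have : t ∈ Function.support f := ht
    rw [f.support_eq, Metric.mem_ball, Real.dist_eq, abs_lt] at this
    simp only [f] at this
    constructor <;> linarith [this.1, this.2]

/-- Uniform Lipschitz control of the weights `W(N x) ω(log x)`. -/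
theorem lip_weight (ω : logSpace K → ℝ) (hω : ContDiff ℝ 1 ω) (R : ℝ) (hR : 0 < R)
    (hωs : ∀ t, ω t ≠ 0 → ‖t‖ ≤ R) :
    ∃ C M : ℝ, 0 ≤ C ∧ 0 ≤ M ∧ ∀ (W : ℝ → ℝ) (κ : NNReal), LipschitzWith κ W →
      (∀ t, 0 ≤ W t ∧ W t ≤ 1) → (∀ t, W t ≠ 0 → 1/4 ≤ t ∧ t ≤ 2) →
      (∃ κ' : NNReal, (κ' : ℝ) ≤ C * (1 + κ) ∧ LipschitzWith κ'
        (fun x : mixedSpace K => W (mixedEmbedding.norm x) * ω (logMap x))) ∧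
      ∀ x : mixedSpace K, W (mixedEmbedding.norm x) * ω (logMap x) ≠ 0 → ‖x‖ ≤ M := by
  classical
  obtain ⟨M, hM⟩ := bounded_of_logMap (K := K) (1/4) 2 R (by norm_num)
  obtain ⟨χ₁, h11, h12, h13, h14⟩ := smooth_cutoff (1/4) 2 (by norm_num) (by norm_num)
  obtain ⟨χ₂, h21, h22, h23, h24⟩ := smooth_cutoff (1/8) 4 (by norm_num) (by norm_num)
  let ω' : ContDiffBump (0 : logSpace K) := ⟨R, R + 1, hR, by linarith⟩
  obtain ⟨κ₁, hκ₁⟩ := lip_bump (K := K) χ₁ ω h11 hω (1/4/2) (2*2) R (by norm_num) h14 hωs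
  obtain ⟨κ₂, hκ₂⟩ := lip_bump (K := K) (fun t => t * χ₂ t) ω' (contDiff_id.mul h21) ω'.contDiff
    (1/8/2) (2*4) (R+1) (by norm_num) (fun t ht => h24 t (right_ne_zero_of_mul ht))
    (fun t ht => by
      have : t ∈ Function.support ω' := ht
      rw [ω'.support_eq, mem_ball_zero_iff] at this
      exact this.le)
  -- boundedness of ω
  obtain ⟨m, hm0, hm⟩ : ∃ m : ℝ, 0 ≤ m ∧ ∀ t, |ω t| ≤ m := by
    have hc : HasCompactSupport ω := by
      apply HasCompactSupport.of_support_subset_isCompact (isCompact_closedBall (0:logSpace K) R)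
      intro x hx
      simpa using hωs x hx
    obtain ⟨m, hm⟩ := hω.continuous.bounded_above_of_compact_support hc
    exact ⟨m, (norm_nonneg _).trans (hm 0), hm⟩
  refine ⟨κ₁ + m * κ₂, max M 0, by positivity, le_max_right _ _, fun W κ hW hW01 hWs => ⟨?_, ?_⟩⟩
  · set Ψ : mixedSpace K → ℝ := fun x => χ₁ (mixedEmbedding.norm x) * ω (logMap x) with hΨ
    set N' : mixedSpace K → ℝ := fun x => mixedEmbedding.norm x * χ₂ (mixedEmbedding.norm x) *
      ω' (logMap x) with hN'
    have hΨm : ∀ x, |Ψ x| ≤ m := by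
      intro x
      simp only [hΨ, abs_mul]
      have h1 := h12 (mixedEmbedding.norm x)
      rw [abs_of_nonneg h1.1]
      calc _ ≤ 1 * m := by gcongr; exact h1.2; exact hm _
        _ = m := one_mul _
    have hEq : (fun x : mixedSpace K => W (mixedEmbedding.norm x) * ω (logMap x)) =
        fun x => W (N' x) * Ψ x := by
      funext x
      by_cases hΨ0 : Ψ x = 0
      · rw [hΨ0, mul_zero]
        by_contra hne
        have h1 := hWs _ (left_ne_zero_of_mul hne)
        have h2 := right_ne_zero_of_mul hne
        simp only [hΨ] at hΨ0
        rw [h13 _ h1.1 h1.2, one_mul] at hΨ0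
        exact h2 hΨ0
      · have h1 := h14 _ (left_ne_zero_of_mul hΨ0)
        have h2 := hωs _ (right_ne_zero_of_mul hΨ0)
        have h3 : ω' (logMap x) = 1 := ω'.one_of_mem_closedBall (by simpa using h2)
        have h4 : N' x = mixedEmbedding.norm x := by
          simp only [hN', h3, mul_one]
          rw [h23 _ (by linarith [h1.1]) (by linarith [h1.2]), mul_one]
        rw [h4]
        by_cases hW0 : W (mixedEmbedding.norm x) = 0
        · simp [hW0]
        · have h5 := hWs _ hW0
          simp only [hΨ]
          rw [h13 _ h5.1 h5.2, one_mul]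
    refine ⟨κ₁ + m.toNNReal * (κ * κ₂), ?_, ?_⟩
    · push_cast
      have : (0:ℝ) ≤ κ₁ * κ := by positivity
      have : (0:ℝ) ≤ m * κ₂ := by positivity
      rw [Real.coe_toNNReal m hm0]
      nlinarith
    · rw [hEq]
      apply LipschitzWith.of_dist_le_mul
      intro x y
      rw [Real.dist_eq]
      have e1 := hκ₁.dist_le_mul x y
      have e2 := (hW.comp hκ₂).dist_le_mul x y
      rw [Real.dist_eq] at e1 e2
      simp only [Function.comp] at e2
      have e3 : W (N' x) * Ψ x - W (N' y) * Ψ y =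
        W (N' x) * (Ψ x - Ψ y) + Ψ y * (W (N' x) - W (N' y)) := by ring
      rw [e3]
      refine (abs_add_le _ _).trans ?_
      rw [abs_mul, abs_mul]
      have e4 := hW01 (N' x)
      rw [abs_of_nonneg e4.1]
      push_cast
      rw [Real.coe_toNNReal m hm0]
      rw [add_mul]
      apply add_le_add
      · calc _ ≤ 1 * (κ₁ * dist x y) := by gcongr; exact e4.2
          _ = _ := one_mul _
      · rw [mul_assoc]
        gcongr
        · exact hΨm y
        · simpa using e2
  · intro x hx
    have h1 := hWs _ (left_ne_zero_of_mul hx)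
    have h2 := hωs _ (right_ne_zero_of_mul hx)
    exact (hM x h1.1 h1.2 h2).trans (le_max_left _ _)

end LipNorm

section Unfold
open scoped Classical
open NumberField NumberField.mixedEmbedding NumberField.InfinitePlace NumberField.Units
  NumberField.Units.dirichletUnitTheorem Module NumberField.mixedEmbedding.fundamentalCone
open scoped nonZeroDivisors

/-- smooth tent -/
noncomputable def etaFun (t : ℝ) : ℝ := Real.smoothTransition (t + 1) - Real.smoothTransition t

theorem etaFun_contDiff : ContDiff ℝ 1 etaFun :=
  (Real.smoothTransition.contDiff.comp (contDiff_id.add contDiff_const)).sub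
    Real.smoothTransition.contDiff

theorem etaFun_supp (t : ℝ) (ht : etaFun t ≠ 0) : -1 < t ∧ t < 1 := by
  constructor
  · by_contra h
    push Not at h
    exact ht (by rw [etaFun, Real.smoothTransition.zero_of_nonpos (by linarith),
      Real.smoothTransition.zero_of_nonpos (by linarith), sub_zero])
  · by_contra h
    push Not at h
    exact ht (by rw [etaFun, Real.smoothTransition.one_of_one_le (by linarith),
      Real.smoothTransition.one_of_one_le (by linarith), sub_self])

theorem etaFun_sum (t : ℝ) : ∃ s : Finset ℤ, (∀ k : ℤ, etaFun (k + t) ≠ 0 → k ∈ s) ∧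
    ∑ k ∈ s, etaFun (k + t) = 1 := by
  refine ⟨{-⌊t⌋ - 1, -⌊t⌋}, fun k hk => ?_, ?_⟩
  · have h := etaFun_supp _ hk
    have h1 := Int.floor_le t
    have h2 := Int.lt_floor_add_one t
    have h3 : ((k + ⌊t⌋ : ℤ) : ℝ) < ((1 : ℤ) : ℝ) := by push_cast; linarith [h.2]
    have h4 : ((-2 : ℤ) : ℝ) < ((k + ⌊t⌋ : ℤ) : ℝ) := by push_cast; linarith [h.1]
    rw [Int.cast_lt] at h3 h4
    simp only [Finset.mem_insert, Finset.mem_singleton]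
    omega
  · rw [Finset.sum_pair (by omega)]
    have h1 := Int.floor_le t
    have h2 := Int.lt_floor_add_one t
    simp only [etaFun]
    push_cast
    rw [Real.smoothTransition.zero_of_nonpos (x := -(⌊t⌋:ℝ) - 1 + t) (by linarith),
      Real.smoothTransition.one_of_one_le (x := -(⌊t⌋:ℝ) + t + 1) (by linarith)]
    have : -(⌊t⌋:ℝ) - 1 + t + 1 = -(⌊t⌋:ℝ) + t := by ring
    rw [this]
    ring

variable (K : Type*) [Field K] [NumberField K]

noncomputable def omegaFun (t : logSpace K) : ℝ :=
  ∏ i, etaFun (((basisUnitLattice K).ofZLatticeBasis ℝ (unitLattice K)).repr t i)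

theorem omegaFun_contDiff : ContDiff ℝ 1 (omegaFun K) := by
  unfold omegaFun
  apply contDiff_prod
  intro i _
  apply etaFun_contDiff.comp
  exact (LinearMap.toContinuousLinearMap
    (((basisUnitLattice K).ofZLatticeBasis ℝ (unitLattice K)).coord i)).contDiff

theorem omegaFun_supp : ∃ R : ℝ, 0 < R ∧ ∀ t, omegaFun K t ≠ 0 → ‖t‖ ≤ R := by
  set B := (basisUnitLattice K).ofZLatticeBasis ℝ (unitLattice K) with hB
  refine ⟨(∑ i, ‖B i‖) + 1, by positivity, fun t ht => ?_⟩
  have h1 : ∀ i, |B.repr t i| ≤ 1 := by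
    intro i
    have := etaFun_supp _ (Finset.prod_ne_zero_iff.1 ht i (Finset.mem_univ i))
    rw [abs_le]
    exact ⟨this.1.le, this.2.le⟩
  rw [← B.sum_repr t]
  refine (norm_sum_le _ _).trans ?_
  refine le_trans (Finset.sum_le_sum fun i _ => ?_) (le_add_of_nonneg_right zero_le_one)
  rw [_root_.norm_smul]
  calc _ ≤ 1 * ‖B i‖ := by gcongr; exact h1 i
    _ = _ := one_mul _

theorem omegaFun_hasSum (t : logSpace K) :
    HasSum (fun l : unitLattice K => omegaFun K ((l : logSpace K) + t)) 1 := by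
  set B := (basisUnitLattice K).ofZLatticeBasis ℝ (unitLattice K) with hB
  let e := (basisUnitLattice K).equivFun
  rw [← e.symm.toEquiv.hasSum_iff]
  have hrep : ∀ (k : Fin (rank K) → ℤ) i, B.repr ((e.symm k : unitLattice K) : logSpace K) i = k i := by
    intro k i
    rw [hB, Basis.ofZLatticeBasis_repr_apply]
    have : (basisUnitLattice K).repr (e.symm k) i = k i := by
      have := (basisUnitLattice K).equivFun_apply (e.symm k)
      rw [← this]
      exact congrFun (e.apply_symm_apply k) i
    rw [this]
  have hfun : ∀ k : Fin (rank K) → ℤ,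
      omegaFun K (((e.symm k : unitLattice K) : logSpace K) + t) =
        ∏ i, etaFun (k i + B.repr t i) := by
    intro k
    simp only [omegaFun, ← hB, map_add, Finsupp.add_apply, hrep]
  choose s hs1 hs2 using fun i => etaFun_sum (B.repr t i)
  have h1 : ∑ k ∈ Fintype.piFinset s, ∏ i, etaFun (k i + B.repr t i) = 1 := by
    rw [← Finset.prod_univ_sum s (fun i (k : ℤ) => etaFun (k + B.repr t i))]
    simp [hs2]
  rw [← h1]
  have h2 : ((fun l : unitLattice K => omegaFun K ((l : logSpace K) + t)) ∘ ⇑e.symm.toEquiv) =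
    fun k : Fin (rank K) → ℤ => ∏ i, etaFun (k i + B.repr t i) := by
    funext k
    exact hfun k
  rw [h2]
  apply hasSum_sum_of_ne_finset_zero
  intro k hk
  by_contra hne
  apply hk
  rw [Fintype.mem_piFinset]
  intro i
  exact hs1 i _ (Finset.prod_ne_zero_iff.1 hne i (Finset.mem_univ i))


theorem exists_unit_of_lattice (l : unitLattice K) :
    ∃ u : (𝓞 K)ˣ, logEmbedding K (Additive.ofMul u) = (l : logSpace K) := by
  obtain ⟨_, ⟨u, _, rfl⟩⟩ := l
  exact ⟨u.toMul, rfl⟩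

theorem unit_smul_mem_idealLattice (J : (Ideal (𝓞 K))⁰) (u : (𝓞 K)ˣ) (x : mixedSpace K)
    (hx : x ∈ mixedEmbedding.idealLattice K (FractionalIdeal.mk0 K J)) :
    u • x ∈ mixedEmbedding.idealLattice K (FractionalIdeal.mk0 K J) := by
  rw [mem_idealLattice] at hx ⊢
  obtain ⟨y, hy, rfl⟩ := hx
  simp only [FractionalIdeal.coe_mk0, SetLike.mem_coe, FractionalIdeal.mem_coeIdeal] at hy ⊢
  obtain ⟨z, hz, rfl⟩ := hy
  refine ⟨algebraMap (𝓞 K) K (u * z), ⟨u * z, Ideal.mul_mem_left _ _ hz, rfl⟩, ?_⟩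
  rw [unitSMul_smul, map_mul, map_mul]

theorem norm_ne_zero_of_mem (J : (Ideal (𝓞 K))⁰) (x : mixedSpace K)
    (hx : x ∈ mixedEmbedding.idealLattice K (FractionalIdeal.mk0 K J)) (h0 : x ≠ 0) :
    mixedEmbedding.norm x ≠ 0 := by
  rw [mem_idealLattice] at hx
  obtain ⟨y, hy, rfl⟩ := hx
  rw [mixedEmbedding.norm_eq_norm]
  have hy0 : y ≠ 0 := by
    rintro rfl
    simp at h0
  simpa [Algebra.norm_eq_zero_iff] using hy0

theorem unfold_sum (J : (Ideal (𝓞 K))⁰) (W : ℝ → ℝ) (hW0 : W 0 = 0) (c : ℝ) (hc : 0 < c)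
    (hs : Summable fun v : mixedEmbedding.idealLattice K (FractionalIdeal.mk0 K J) =>
      W (mixedEmbedding.norm (c • (v : mixedSpace K))) * omegaFun K (logMap (c • (v : mixedSpace K)))) :
    HasSum (fun β : idealSet K J => W (c ^ finrank ℚ K * mixedEmbedding.norm (β : mixedSpace K)))
      (∑' v : mixedEmbedding.idealLattice K (FractionalIdeal.mk0 K J),
      W (mixedEmbedding.norm (c • (v : mixedSpace K))) * omegaFun K (logMap (c • (v : mixedSpace K)))) := by
  set L := mixedEmbedding.idealLattice K (FractionalIdeal.mk0 K J) with hL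
  set h : mixedSpace K → ℝ := fun v => W (mixedEmbedding.norm (c • (v : mixedSpace K))) *
    omegaFun K (logMap (c • (v : mixedSpace K))) with hh
  choose U hU using exists_unit_of_lattice K
  let φ : idealSet K J × unitLattice K → L := fun p =>
    ⟨U p.2 • (p.1 : mixedSpace K), unit_smul_mem_idealLattice K J _ _ p.1.2.2⟩
  have hφinj : Function.Injective φ := by
    rintro ⟨β, l⟩ ⟨β', l'⟩ heq
    have heq' : U l • (β : mixedSpace K) = U l' • (β' : mixedSpace K) := congrArg Subtype.val heq
    have h1 : ((U l')⁻¹ * U l) • (β : mixedSpace K) = β' := by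
      rw [mul_smul, heq', inv_smul_smul]
    have h2 : (U l')⁻¹ * U l ∈ torsion K := by
      rw [← unit_smul_mem_iff_mem_torsion β.2.1, h1]
      exact β'.2.1
    rw [← logEmbedding_eq_zero_iff] at h2
    have h3 : (l : logSpace K) = l' := by
      rw [ofMul_mul, map_add, ofMul_inv, map_neg, hU, hU] at h2
      exact (neg_add_eq_zero.1 h2).symm
    have h4 : l = l' := Subtype.ext h3
    subst h4
    rw [inv_mul_cancel, one_smul] at h1
    rw [Prod.mk.injEq]
    exact ⟨Subtype.ext h1, rfl⟩
  have hφran : ∀ v : L, v ∉ Set.range φ → h v = 0 := by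
    intro v hv
    by_contra hne
    apply hv
    have hv0 : (v : mixedSpace K) ≠ 0 := by
      intro h0
      apply hne
      simp [hh, h0, hW0]
    obtain ⟨u, hu⟩ := exists_unit_smul_mem (norm_ne_zero_of_mem K J v v.2 hv0)
    have hl : logEmbedding K (Additive.ofMul u⁻¹) ∈ unitLattice K := ⟨Additive.ofMul u⁻¹, trivial, rfl⟩
    set l : unitLattice K := ⟨_, hl⟩ with hldef
    have ht : (U l)⁻¹ * u⁻¹ ∈ torsion K := by
      rw [← logEmbedding_eq_zero_iff, ofMul_mul, map_add, ofMul_inv, map_neg, hU]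
      simp [hldef]
    have hm : (U l)⁻¹ • (v : mixedSpace K) ∈ fundamentalCone K := by
      have := torsion_smul_mem_of_mem hu ht
      rwa [mul_smul, inv_smul_smul] at this
    refine ⟨⟨⟨(U l)⁻¹ • (v : mixedSpace K), hm, unit_smul_mem_idealLattice K J _ _ v.2⟩, l⟩, ?_⟩
    apply Subtype.ext
    exact smul_inv_smul (U l) (v : mixedSpace K)
  have h1 : HasSum (fun v : L => h v) (∑' v : L, h v) := hs.hasSum
  have h2 : HasSum ((fun v : L => h v) ∘ φ) (∑' v : L, h v) :=
    (hφinj.hasSum_iff (f := fun v : L => h v) (fun v hv => hφran v hv)).2 h1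
  refine h2.prod_fiberwise (fun β => ?_)
  have h3 := (omegaFun_hasSum K (logMap (β : mixedSpace K))).mul_left
    (W (c ^ finrank ℚ K * mixedEmbedding.norm (β : mixedSpace K)))
  rw [mul_one] at h3
  have hβ : mixedEmbedding.norm (β : mixedSpace K) ≠ 0 := (norm_pos_of_mem β.2.1).ne'
  have h5 : ∀ l : unitLattice K, ((fun v : L => h v) ∘ φ) (β, l) =
      W (c ^ finrank ℚ K * mixedEmbedding.norm (β : mixedSpace K)) *
        omegaFun K ((l : logSpace K) + logMap (β : mixedSpace K)) := by
    intro l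
    show W (mixedEmbedding.norm (c • (U l • (β : mixedSpace K)))) *
      omegaFun K (logMap (c • (U l • (β : mixedSpace K)))) = _
    have h6 : mixedEmbedding.norm (U l • (β : mixedSpace K)) ≠ 0 := by rwa [norm_unit_smul]
    rw [mixedEmbedding.norm_smul, norm_unit_smul, abs_of_pos hc, logMap_real_smul h6 hc.ne',
      logMap_unit_smul _ hβ, hU]
  simpa only [h5] using h3

end Unfold

section Dyad
open scoped Classical Topology

/-- trapezoid weight -/
noncomputable def trap (a b ε t : ℝ) : ℝ := max 0 (min 1 (min ((t - a) / ε) ((b - t) / ε)))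

theorem trap_lip (a b ε : ℝ) (hε : 0 < ε) :
    LipschitzWith (Real.toNNReal (1 / ε)) (trap a b ε) := by
  have h1 : LipschitzWith (Real.toNNReal (1 / ε)) fun t => (t - a) / ε := by
    refine LipschitzWith.of_dist_le_mul fun x y => ?_
    rw [Real.coe_toNNReal _ (by positivity), Real.dist_eq, Real.dist_eq, ← sub_div,
      sub_sub_sub_cancel_right, abs_div, abs_of_pos hε]
    exact le_of_eq (by ring)
  have h2 : LipschitzWith (Real.toNNReal (1 / ε)) fun t => (b - t) / ε := by
    refine LipschitzWith.of_dist_le_mul fun x y => ?_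
    rw [Real.coe_toNNReal _ (by positivity), Real.dist_eq, Real.dist_eq, ← sub_div,
      sub_sub_sub_cancel_left, abs_div, abs_of_pos hε, abs_sub_comm]
    exact le_of_eq (by ring)
  have h3 := h1.min h2
  rw [max_self] at h3
  exact (h3.const_min 1).const_max 0

theorem trap_bd (a b ε t : ℝ) : 0 ≤ trap a b ε t ∧ trap a b ε t ≤ 1 :=
  ⟨le_max_left _ _, max_le zero_le_one (min_le_left _ _)⟩

theorem trap_supp (a b ε t : ℝ) (hε : 0 < ε) (h : trap a b ε t ≠ 0) : a < t ∧ t < b := by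
  by_contra hc
  apply h
  rw [trap, max_eq_left]
  rcases not_and_or.1 hc with hc | hc
  · exact (min_le_right _ _).trans ((min_le_left _ _).trans
      (div_nonpos_of_nonpos_of_nonneg (by linarith) hε.le))
  · exact (min_le_right _ _).trans ((min_le_right _ _).trans
      (div_nonpos_of_nonpos_of_nonneg (by linarith) hε.le))

theorem trap_one (a b ε t : ℝ) (hε : 0 < ε) (h1 : a + ε ≤ t) (h2 : t ≤ b - ε) :
    trap a b ε t = 1 := by
  have h3 : 1 ≤ (t - a) / ε := by rw [le_div_iff₀ hε]; linarith
  have h4 : 1 ≤ (b - t) / ε := by rw [le_div_iff₀ hε]; linarith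
  rw [trap, min_eq_left (le_min h3 h4), max_eq_right zero_le_one]

theorem tsum_ind {ι : Type*} (N : ι → ℝ) (hfin : ∀ s, {i | N i ≤ s}.Finite) (a b : ℝ) (hab : a ≤ b) :
    (∑' i, if a < N i ∧ N i ≤ b then (1:ℝ) else 0) =
      (Nat.card {i // N i ≤ b} : ℝ) - Nat.card {i // N i ≤ a} := by
  have hb : Nat.card {i // N i ≤ b} = (hfin b).toFinset.card := by
    rw [← Set.ncard_eq_toFinset_card _ (hfin b)]; rfl
  have ha : Nat.card {i // N i ≤ a} = ((hfin b).toFinset.filter (fun i => N i ≤ a)).card := by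
    rw [← Set.ncard_coe_finset]
    have : (((hfin b).toFinset.filter (fun i => N i ≤ a) : Finset ι) : Set ι) = {i | N i ≤ a} := by
      ext i
      simp
      intro h
      linarith
    rw [this]; rfl
  rw [tsum_eq_sum (s := (hfin b).toFinset), ha, hb,
    ← Finset.card_filter_add_card_filter_not (s := (hfin b).toFinset) (fun i => N i ≤ a)]
  · push_cast
    rw [add_sub_cancel_left, Finset.card_filter, Nat.cast_sum]
    refine Finset.sum_congr rfl fun i hi => ?_
    have : N i ≤ b := by simpa using hi
    simp [this]
  · intro i hi
    have : ¬ N i ≤ b := by simpa using hi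
    simp [this]

theorem sharp_count {ι : Type*} (N : ι → ℝ) (d : ℕ) (hd : 0 < d) (v : ℝ) (hv : 0 < v)
    (hlim : Tendsto (fun s : ℝ => (Nat.card {i // N i ≤ s} : ℝ) / s) atTop (𝓝 v))
    (C : ℝ) (hC : 0 ≤ C)
    (hW : ∀ (W : ℝ → ℝ) (κ : NNReal), LipschitzWith κ W →
      (∀ t, 0 ≤ W t ∧ W t ≤ 1) → (∀ t, W t ≠ 0 → 1/4 ≤ t ∧ t ≤ 2) →
      ∃ I : ℝ, ∀ X : ℝ, 1 ≤ X →
        |(∑' i, W ((X⁻¹) ^ d * N i)) - X ^ d * I| ≤ C * (1 + κ) * X ^ d / X) :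
    ∃ D : ℝ, 0 ≤ D ∧ ∀ s : ℝ, 1 ≤ s →
      |(Nat.card {i // N i ≤ s} : ℝ) - v * s| ≤ D * s ^ (1 - 1 / (2 * d) : ℝ) := by
  set A : ℝ → ℝ := fun s => (Nat.card {i // N i ≤ s} : ℝ) with hA
  have hfin : ∀ s, {i | N i ≤ s}.Finite := by
    intro s
    have h1 := hlim.eventually (lt_mem_nhds hv)
    obtain ⟨t, ht1, ht2⟩ := (h1.and (eventually_ge_atTop s)).exists
    have h2 : Nat.card {i // N i ≤ t} ≠ 0 := by
      intro h
      rw [h] at ht1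
      simp at ht1
    have h3 : Finite {i // N i ≤ t} := Nat.finite_of_card_ne_zero h2
    have h4 : {i | N i ≤ t}.Finite := h3
    exact h4.subset fun i (hi : N i ≤ s) => hi.trans ht2
  set δ : ℝ := 1 / d with hδ
  have hδ0 : 0 < δ := by positivity
  have hδ1 : δ ≤ 1 := by
    rw [hδ, div_le_one (by positivity)]
    exact_mod_cast hd
  have hθ : (1 - 1 / (2 * d) : ℝ) = 1 - δ / 2 := by rw [hδ]; field_simp
  rw [hθ]
  -- restate in terms of y
  have hW' : ∀ a b ε : ℝ, 1/4 ≤ a → b ≤ 2 → 0 < ε → ∃ I : ℝ, ∀ y : ℝ, 1 ≤ y →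
      |(∑' i, trap a b ε (N i / y)) - y * I| ≤ C * (1 + 1 / ε) * y ^ (1 - δ) := by
    intro a b ε ha hb hε
    obtain ⟨I, hI⟩ := hW (trap a b ε) _ (trap_lip a b ε hε) (trap_bd a b ε) (fun t ht =>
      ⟨ha.trans (trap_supp a b ε t hε ht).1.le, (trap_supp a b ε t hε ht).2.le.trans hb⟩)
    refine ⟨I, fun y hy => ?_⟩
    have hy0 : 0 < y := by linarith
    have h := hI (y ^ δ) (Real.one_le_rpow hy hδ0.le)
    have h1 : (y ^ δ) ^ d = y := by
      rw [hδ, one_div, Real.rpow_inv_natCast_pow hy0.le hd.ne']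
    rw [inv_pow, h1, Real.coe_toNNReal _ (by positivity)] at h
    simp_rw [inv_mul_eq_div] at h
    refine h.trans (le_of_eq ?_)
    rw [Real.rpow_sub hy0, Real.rpow_one, mul_div_assoc]
  have hsum : ∀ (F : ι → ℝ) (b : ℝ), (∀ i, F i ≠ 0 → N i ≤ b) → Summable F := by
    intro F b h
    exact summable_of_hasFiniteSupport ((hfin b).subset h)
  have hup : ∀ a b ε y : ℝ, 0 < ε → a ≤ b → 0 < y →
      (∑' i, trap a b ε (N i / y)) ≤ A (b * y) - A (a * y) := by
    intro a b ε y hε hab hy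
    rw [hA, ← tsum_ind N hfin _ _ (by gcongr)]
    refine Summable.tsum_le_tsum (fun i => ?_) (hsum _ (b * y) fun i hi => ?_)
      (hsum _ (b * y) fun i hi => ?_)
    · split_ifs with h
      · exact (trap_bd _ _ _ _).2
      · by_contra hc
        push Not at hc
        have := trap_supp _ _ _ _ hε hc.ne'
        rw [lt_div_iff₀ hy, div_lt_iff₀ hy] at this
        exact h ⟨this.1, this.2.le⟩
    · have := (trap_supp _ _ _ _ hε hi).2
      rw [div_lt_iff₀ hy] at this
      exact this.le
    · by_contra hc
      exact hi (if_neg fun h => hc h.2)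
  have hlo : ∀ a b ε y : ℝ, 0 < ε → a + ε ≤ b - ε → 0 < y →
      A ((b - ε) * y) - A ((a + ε) * y) ≤ (∑' i, trap a b ε (N i / y)) := by
    intro a b ε y hε hab hy
    rw [hA, ← tsum_ind N hfin _ _ (by gcongr)]
    refine Summable.tsum_le_tsum (fun i => ?_) (hsum _ ((b - ε) * y) fun i hi => ?_)
      (hsum _ (b * y) fun i hi => ?_)
    · split_ifs with h
      · rw [trap_one _ _ _ _ hε]
        · rw [le_div_iff₀ hy]; exact h.1.le
        · rw [div_le_iff₀ hy]; exact h.2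
      · exact (trap_bd _ _ _ _).1
    · by_contra hc
      exact hi (if_neg fun h => hc h.2)
    · have := (trap_supp _ _ _ _ hε hi).2
      rw [div_lt_iff₀ hy] at this
      exact this.le
  have hAlim : ∀ b : ℝ, 0 < b → Tendsto (fun y => A (b * y) / y) atTop (𝓝 (b * v)) := by
    intro b hb
    have h1 := (hlim.comp (tendsto_id.const_mul_atTop hb)).const_mul b
    refine h1.congr fun y => ?_
    simp only [Function.comp, id, hA]
    field_simp
  have hIlim : ∀ (a b ε I : ℝ), (∀ y : ℝ, 1 ≤ y →
      |(∑' i, trap a b ε (N i / y)) - y * I| ≤ C * (1 + 1 / ε) * y ^ (1 - δ)) →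
      Tendsto (fun y => (∑' i, trap a b ε (N i / y)) / y) atTop (𝓝 I) := by
    intro a b ε I h
    have h0 : Tendsto (fun y : ℝ => C * (1 + 1 / ε) * y ^ (-δ)) atTop (𝓝 0) := by
      have := (tendsto_rpow_neg_atTop hδ0).const_mul (C * (1 + 1 / ε))
      rwa [mul_zero] at this
    rw [tendsto_iff_norm_sub_tendsto_zero]
    refine squeeze_zero' (Eventually.of_forall fun y => norm_nonneg _) ?_ h0
    filter_upwards [eventually_ge_atTop 1] with y hy
    have hy0 : 0 < y := by linarith
    have h1 := h y hy
    rw [Real.norm_eq_abs]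
    have h2 : (∑' i, trap a b ε (N i / y)) / y - I = ((∑' i, trap a b ε (N i / y)) - y * I) / y := by
      field_simp
    rw [h2, abs_div, abs_of_pos hy0, div_le_iff₀ hy0]
    refine h1.trans (le_of_eq ?_)
    rw [mul_assoc _ (y ^ (-δ)) y, ← Real.rpow_add_one hy0.ne', neg_add_eq_sub]
  have hstep : ∀ y : ℝ, 1 ≤ y → |(A y - v * y) - (A (y / 2) - v * (y / 2))| ≤
      (9 * C + v) * y ^ (1 - δ / 2) := by
    intro y hy
    have hy0 : 0 < y := by linarith
    set ε : ℝ := y ^ (-(δ / 2)) / 8 with hε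
    have hyd : y ^ (-(δ / 2)) ≤ 1 := Real.rpow_le_one_of_one_le_of_nonpos hy (by linarith)
    have hyd0 : 0 < y ^ (-(δ / 2)) := by positivity
    have hε0 : 0 < ε := by positivity
    have hε8 : ε ≤ 1 / 8 := by rw [hε]; linarith
    have herr : C * (1 + 1 / ε) * y ^ (1 - δ) ≤ 9 * C * y ^ (1 - δ / 2) := by
      have h1 : 1 / ε = 8 * y ^ (δ / 2) := by
        rw [hε, Real.rpow_neg hy0.le]; field_simp
      have h2 : 1 ≤ y ^ (δ / 2) := Real.one_le_rpow hy (by linarith)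
      have h3 : y ^ (1 - δ / 2) = y ^ (δ / 2) * y ^ (1 - δ) := by
        rw [← Real.rpow_add hy0]; congr 1; ring
      rw [h1, h3]
      have : 1 + 8 * y ^ (δ / 2) ≤ 9 * y ^ (δ / 2) := by linarith
      calc C * (1 + 8 * y ^ (δ / 2)) * y ^ (1 - δ) ≤ C * (9 * y ^ (δ / 2)) * y ^ (1 - δ) := by gcongr
        _ = _ := by ring
    have hεy : ε * y = y ^ (1 - δ / 2) / 8 := by
      rw [hε, div_mul_eq_mul_div, ← Real.rpow_add_one hy0.ne', neg_add_eq_sub]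
    have hpos : 0 ≤ v * (y ^ (1 - δ / 2)) := by positivity
    rw [abs_le]
    constructor
    · obtain ⟨I, hI⟩ := hW' (1/2) 1 ε (by norm_num) (by norm_num) hε0
      have hI2 : v * (1/2 - 2 * ε) ≤ I := by
        refine le_of_tendsto_of_tendsto ((hAlim (1 - ε) (by linarith)).sub
          (hAlim (1/2 + ε) (by linarith))) (hIlim _ _ _ _ hI) ?_ |>.trans' (by linarith)
        filter_upwards [eventually_gt_atTop 0] with z hz
        rw [← sub_div]
        gcongr
        exact hlo (1/2) 1 ε z hε0 (by linarith) hz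
      have h1 := hup (1/2) 1 ε y hε0 (by norm_num) hy0
      have h2 := (abs_le.1 (hI y hy)).1
      have h3 : y * (v * (1/2 - 2 * ε)) ≤ y * I := by gcongr
      have h4 : y * (v * (1/2 - 2 * ε)) = v * y / 2 - 2 * v * (ε * y) := by ring
      rw [h4, hεy] at h3
      rw [one_mul, show (1/2 : ℝ) * y = y / 2 by ring] at h1
      nlinarith
    · obtain ⟨I, hI⟩ := hW' (1/2 - ε) (1 + ε) ε (by linarith) (by linarith) hε0
      have hI2 : I ≤ v * (1/2 + 2 * ε) := by
        refine le_of_tendsto_of_tendsto (hIlim _ _ _ _ hI) ((hAlim (1 + ε) (by linarith)).sub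
          (hAlim (1/2 - ε) (by linarith))) ?_ |>.trans (by linarith)
        filter_upwards [eventually_gt_atTop 0] with z hz
        rw [← sub_div]
        gcongr
        exact hup _ _ ε z hε0 (by linarith) hz
      have h1 := hlo (1/2 - ε) (1 + ε) ε y hε0 (by linarith) hy0
      have h2 := (abs_le.1 (hI y hy)).2
      have h3 : y * I ≤ y * (v * (1/2 + 2 * ε)) := by gcongr
      have h4 : y * (v * (1/2 + 2 * ε)) = v * y / 2 + 2 * v * (ε * y) := by ring
      rw [h4, hεy] at h3
      rw [add_sub_cancel_right, one_mul, sub_add_cancel, show (1/2 : ℝ) * y = y / 2 by ring] at h1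
      nlinarith
  -- dyadic induction
  set θ := 1 - δ / 2 with hθdef
  have hθ0 : 0 < θ := by linarith
  set q : ℝ := (1/2 : ℝ) ^ θ with hq
  have hq1 : q < 1 := Real.rpow_lt_one (by norm_num) (by norm_num) hθ0
  set D : ℝ := max (A 2 + 2 * v) ((9 * C + v) / (1 - q)) with hD
  have hA0 : ∀ s, 0 ≤ A s := fun s => Nat.cast_nonneg _
  have hAmono : Monotone A := by
    intro s t hst
    have : {i | N i ≤ s} ⊆ {i | N i ≤ t} := fun i (hi : N i ≤ s) => hi.trans hst
    exact Nat.cast_le.2 (Set.ncard_le_ncard this (hfin t))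
  have hD0 : 0 ≤ D := le_max_of_le_left (by have := hA0 2; linarith)
  have hD2 : 9 * C + v ≤ D * (1 - q) := by
    rw [← div_le_iff₀ (by linarith)]
    exact le_max_right _ _
  have key : ∀ n : ℕ, ∀ s : ℝ, 1 ≤ s → s < 2 ^ n → |A s - v * s| ≤ D * s ^ θ := by
    intro n
    induction n with
    | zero => intro s h1 h2; simp at h2; linarith
    | succ n ih =>
      intro s h1 h2
      by_cases hs : s < 2
      · have h3 : |A s - v * s| ≤ A 2 + 2 * v := by
          have := hAmono hs.le
          have := hA0 s
          have := hA0 2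
          rw [abs_le]; constructor <;> nlinarith
        have h9 : A 2 + 2 * v ≤ D := le_max_left _ _
        refine h3.trans (h9.trans ?_)
        have := Real.one_le_rpow h1 hθ0.le
        nlinarith
      · push Not at hs
        have h3 := ih (s / 2) (by linarith) (by rw [pow_succ] at h2; linarith)
        have h4 := hstep s h1
        have h5 : (s / 2) ^ θ = q * s ^ θ := by
          rw [hq, ← Real.mul_rpow (by norm_num) (by linarith)]; congr 1; ring
        rw [h5] at h3
        have h6 := abs_add_le ((A s - v * s) - (A (s / 2) - v * (s / 2))) (A (s / 2) - v * (s / 2))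
        rw [sub_add_cancel] at h6
        have h7 : 0 < s ^ θ := Real.rpow_pos_of_pos (by linarith) _
        nlinarith
  refine ⟨D, hD0, fun s hs => ?_⟩
  obtain ⟨n, hn⟩ := pow_unbounded_of_one_lt s (one_lt_two : (1:ℝ) < 2)
  exact key n s hs hn

end Dyad

section Count
open scoped Classical
open NumberField NumberField.mixedEmbedding NumberField.InfinitePlace NumberField.Units
  NumberField.Units.dirichletUnitTheorem Module NumberField.mixedEmbedding.fundamentalCone
open scoped nonZeroDivisors Topology
open MeasureTheory

variable (K : Type*) [Field K] [NumberField K]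

theorem smooth_count (J : (Ideal (𝓞 K))⁰) : ∃ C : ℝ, 0 ≤ C ∧
    ∀ (W : ℝ → ℝ) (κ : NNReal), LipschitzWith κ W →
      (∀ t, 0 ≤ W t ∧ W t ≤ 1) → (∀ t, W t ≠ 0 → 1/4 ≤ t ∧ t ≤ 2) →
      ∃ I : ℝ, ∀ X : ℝ, 1 ≤ X →
        |(∑' β : idealSet K J, W ((X⁻¹) ^ finrank ℚ K * mixedEmbedding.norm (β : mixedSpace K)))
          - X ^ finrank ℚ K * I| ≤ C * (1 + κ) * X ^ finrank ℚ K / X := by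
  obtain ⟨R, hR, hRs⟩ := omegaFun_supp K
  obtain ⟨C, M, hC, hM, hCM⟩ := lip_weight (K := K) (omegaFun K) (omegaFun_contDiff K) R hR hRs
  set b := fractionalIdealLatticeBasis K (FractionalIdeal.mk0 K J) with hb
  obtain ⟨C', hC', h'⟩ := riemann_lattice (volume : Measure (mixedSpace K)) b M hM
  refine ⟨C' * C, by positivity, fun W κ hκ hW1 hW2 => ?_⟩
  obtain ⟨⟨κ', hκ'1, hκ'2⟩, hsupp⟩ := hCM W κ hκ hW1 hW2
  have h1 := h' _ κ' hκ'2 hsupp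
  refine ⟨(∫ x : mixedSpace K, W (mixedEmbedding.norm x) * omegaFun K (logMap x)) /
    volume.real (ZSpan.fundamentalDomain b), fun X hX => ?_⟩
  · have h2 := h1 X hX
    rw [mixedEmbedding.finrank] at h2
    have hX0 : 0 < X := by linarith
    have hspan : Submodule.span ℤ (Set.range b) =
      mixedEmbedding.idealLattice K (FractionalIdeal.mk0 K J) := span_idealLatticeBasis K _
    rw [hspan] at h2
    have hW0 : W 0 = 0 := by
      by_contra h
      have := (hW2 0 h).1
      norm_num at this
    have hs : Summable fun v : mixedEmbedding.idealLattice K (FractionalIdeal.mk0 K J) =>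
      W (mixedEmbedding.norm (X⁻¹ • (v : mixedSpace K))) *
        omegaFun K (logMap (X⁻¹ • (v : mixedSpace K))) := by
      apply summable_of_hasFiniteSupport
      have hf := ZSpan.setFinite_inter b (s := Metric.closedBall 0 (X * M)) Metric.isBounded_closedBall
      rw [hspan] at hf
      refine Set.Finite.of_finite_image (f := Subtype.val) (hf.subset ?_) Subtype.val_injective.injOn
      rintro _ ⟨v, hv, rfl⟩
      refine ⟨?_, v.2⟩
      have h3 := hsupp _ hv
      rw [_root_.norm_smul, norm_inv, Real.norm_of_nonneg hX0.le, inv_mul_le_iff₀ hX0] at h3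
      simpa using h3
    rw [(unfold_sum K J W hW0 X⁻¹ (by positivity) hs).tsum_eq]
    refine h2.trans ?_
    rw [mul_assoc C' C]
    gcongr

theorem class_count (C : ClassGroup (𝓞 K)) : ∃ v D : ℝ, 0 < v ∧ 0 ≤ D ∧ ∀ s : ℝ, 1 ≤ s →
    |(Nat.card {I : (Ideal (𝓞 K))⁰ // Ideal.absNorm (I : Ideal (𝓞 K)) ≤ s ∧ ClassGroup.mk0 I = C} : ℝ)
      - v * s| ≤ D * s ^ (1 - 1 / (2 * finrank ℚ K) : ℝ) := by
  obtain ⟨J, hJ⟩ := ClassGroup.mk0_surjective C⁻¹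
  have hcard : ∀ s : ℝ, Nat.card {I : (Ideal (𝓞 K))⁰ //
      Ideal.absNorm (I : Ideal (𝓞 K)) ≤ s ∧ ClassGroup.mk0 I = C}
      = Nat.card {I : (Ideal (𝓞 K))⁰ // (J : Ideal (𝓞 K)) ∣ I ∧
        Submodule.IsPrincipal (I : Ideal (𝓞 K)) ∧
        Ideal.absNorm (I : Ideal (𝓞 K)) ≤ s * Ideal.absNorm (J : Ideal (𝓞 K))} := by
    intro s
    simp_rw [← nonZeroDivisors_dvd_iff_dvd_coe]
    refine Nat.card_congr ?_
    refine ((Equiv.dvd J).subtypeEquiv fun I ↦ ?_).trans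
      (Equiv.subtypeSubtypeEquivSubtypeInter (fun I : (Ideal (𝓞 K))⁰ ↦ J ∣ I) _)
    rw [← ClassGroup.mk0_eq_one_iff (SetLike.coe_mem _)]
    simp_rw [Equiv.dvd_apply, Submonoid.coe_mul, ← Submonoid.mul_def, _root_.map_mul, hJ,
      inv_mul_eq_one, Nat.cast_mul, mul_comm s, eq_comm, and_comm, and_congr_left_iff]
    exact fun _ ↦
      (mul_le_mul_iff_of_pos_left (Nat.cast_pos.mpr (Ideal.absNorm_pos_of_nonZeroDivisors J))).symm
  set NJ : ℝ := (Ideal.absNorm (J : Ideal (𝓞 K)) : ℝ) with hNJ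
  have hNJ1 : 1 ≤ NJ := by
    rw [hNJ]
    exact_mod_cast Ideal.absNorm_pos_of_nonZeroDivisors J
  have hw : (0:ℝ) < torsionOrder K := by exact_mod_cast (torsionOrder_pos K)
  set d := finrank ℚ K with hd
  have hd0 : 0 < d := finrank_pos
  have hcard2 : ∀ s : ℝ, (Nat.card {a : idealSet K J // mixedEmbedding.norm (a : mixedSpace K) ≤ s * NJ} : ℝ)
      = torsionOrder K * Nat.card {I : (Ideal (𝓞 K))⁰ //
      Ideal.absNorm (I : Ideal (𝓞 K)) ≤ s ∧ ClassGroup.mk0 I = C} := by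
    intro s
    rw [hcard s, ← card_isPrincipal_dvd_norm_le, Nat.cast_mul, mul_comm]
  have hlim := NumberField.Ideal.tendsto_norm_le_and_mk_eq_div_atTop K C
  set v0 : ℝ := (2 ^ nrRealPlaces K * (2 * Real.pi) ^ nrComplexPlaces K * regulator K) /
            (torsionOrder K * Real.sqrt |discr K|) with hv0
  have hv0pos : 0 < v0 := by
    have := regulator_pos K
    have h2 : 0 < Real.sqrt |(discr K : ℝ)| :=
      Real.sqrt_pos.2 (abs_pos.2 (by exact_mod_cast discr_ne_zero K))
    positivity
  set v : ℝ := torsionOrder K * v0 / NJ with hv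
  have hlim2 : Tendsto (fun s : ℝ => (Nat.card {a : idealSet K J //
      mixedEmbedding.norm (a : mixedSpace K) ≤ s} : ℝ) / s) atTop (𝓝 v) := by
    have h1 := ((hlim.comp (tendsto_id.atTop_div_const (show 0 < NJ by linarith))).const_mul
      (torsionOrder K : ℝ)).div_const NJ
    refine h1.congr fun s => ?_
    have h2 := hcard2 (s / NJ)
    rw [div_mul_cancel₀ _ (by linarith)] at h2
    simp only [Function.comp, id]
    rw [h2]
    generalize (Nat.card {I : (Ideal (𝓞 K))⁰ //
      Ideal.absNorm (I : Ideal (𝓞 K)) ≤ s / NJ ∧ ClassGroup.mk0 I = C} : ℝ) = t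
    field_simp
  obtain ⟨C1, hC1, hW⟩ := smooth_count K J
  obtain ⟨D, hD, hfin⟩ := sharp_count (fun a : idealSet K J => mixedEmbedding.norm (a : mixedSpace K))
    d hd0 v (by positivity) hlim2 C1 hC1 hW
  set θ : ℝ := (1 - 1 / (2 * d) : ℝ) with hθ
  refine ⟨v0, D * NJ ^ θ / torsionOrder K, hv0pos, by positivity, fun s hs => ?_⟩
  have h1 := hfin (s * NJ) (by nlinarith)
  rw [hcard2 s, Real.mul_rpow (by linarith) (by linarith)] at h1
  have h2 : v * (s * NJ) = torsionOrder K * (v0 * s) := by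
    rw [hv]; field_simp
  rw [h2, ← mul_sub, abs_mul, abs_of_pos hw] at h1
  rw [div_mul_eq_mul_div (D * NJ ^ θ), le_div_iff₀ hw]
  linarith

theorem ideal_count : ∃ v D θ : ℝ, 0 < v ∧ 0 ≤ D ∧ 0 < θ ∧ θ < 1 ∧ ∀ s : ℝ, 1 ≤ s →
    |(Nat.card {I : (Ideal (𝓞 K))⁰ // Ideal.absNorm (I : Ideal (𝓞 K)) ≤ s} : ℝ)
      - v * s| ≤ D * s ^ θ := by
  choose v D hv hD h using class_count K
  have hd0 : (1:ℝ) ≤ finrank ℚ K := by exact_mod_cast (finrank_pos : 0 < finrank ℚ K)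
  refine ⟨∑ C, v C, ∑ C, D C, (1 - 1 / (2 * finrank ℚ K) : ℝ),
    Finset.sum_pos (fun C _ => hv C) Finset.univ_nonempty, Finset.sum_nonneg fun C _ => hD C,
    ?_, ?_, fun s hs => ?_⟩
  · have : 1 / (2 * finrank ℚ K : ℝ) ≤ 1 / 2 :=
      one_div_le_one_div_of_le (by norm_num) (by linarith)
    linarith
  · have : 0 < 1 / (2 * finrank ℚ K : ℝ) := by positivity
    linarith
  · have hsum : (Nat.card {I : (Ideal (𝓞 K))⁰ // Ideal.absNorm (I : Ideal (𝓞 K)) ≤ s} : ℝ) =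
        ∑ C, (Nat.card {I : (Ideal (𝓞 K))⁰ // Ideal.absNorm (I : Ideal (𝓞 K)) ≤ s ∧
          ClassGroup.mk0 I = C} : ℝ) := by
      have : Fintype {I : (Ideal (𝓞 K))⁰ // Ideal.absNorm (I : Ideal (𝓞 K)) ≤ s} := by
        simp_rw [← Nat.le_floor_iff (zero_le_one.trans hs)]
        refine @Fintype.ofFinite _ (Ideal.finite_setOfPred_absNorm_le₀ ⌊s⌋₊)
      let e := fun C : ClassGroup (𝓞 K) ↦ Equiv.subtypeSubtypeEquivSubtypeInter
        (fun I : (Ideal (𝓞 K))⁰ ↦ Ideal.absNorm I.1 ≤ s) (fun I ↦ ClassGroup.mk0 I = C)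
      simp_rw [← Nat.card_congr (e _), Nat.card_eq_fintype_card, Fintype.subtype_card]
      rw [Fintype.card, Finset.card_eq_sum_card_fiberwise (f := fun I ↦ ClassGroup.mk0 I.1)
        (t := Finset.univ) (fun _ _ ↦ Finset.mem_univ _), Nat.cast_sum]
    rw [hsum, Finset.sum_mul, ← Finset.sum_sub_distrib, Finset.sum_mul]
    exact (Finset.abs_sum_le_sum_abs _ _).trans (Finset.sum_le_sum fun C _ => h C s hs)

end Count

section Act
open Finset

/-- the Dirichlet action -/
noncomputable def dact (f : ArithmeticFunction ℝ) (F : ℝ → ℝ) (x : ℝ) : ℝ :=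
  ∑ n ∈ Ioc 0 ⌊x⌋₊, f n * F (x / n)

theorem sum_antidiag (φ : ℕ → ℕ → ℝ) (N : ℕ) :
    ∑ n ∈ Ioc 0 N, ∑ p ∈ n.divisorsAntidiagonal, φ p.1 p.2 =
      ∑ d ∈ Ioc 0 N, ∑ e ∈ Ioc 0 (N / d), φ d e := by
  rw [Finset.sum_sigma', Finset.sum_sigma']
  refine Finset.sum_nbij' (fun q => ⟨q.2.1, q.2.2⟩) (fun q => ⟨q.1 * q.2, (q.1, q.2)⟩) ?_ ?_ ?_ ?_ ?_
  · rintro ⟨n, d, e⟩ h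
    simp only [Finset.mem_sigma, mem_Ioc, Nat.mem_divisorsAntidiagonal] at h ⊢
    obtain ⟨⟨h1, h2⟩, rfl, h3⟩ := h
    have hd : 0 < d := Nat.pos_of_ne_zero (by rintro rfl; simp at h3)
    have he : 0 < e := Nat.pos_of_ne_zero (by rintro rfl; simp at h3)
    refine ⟨⟨hd, le_trans (Nat.le_mul_of_pos_right d he) h2⟩, he, ?_⟩
    rw [Nat.le_div_iff_mul_le hd, mul_comm]
    exact h2
  · rintro ⟨d, e⟩ h
    simp only [Finset.mem_sigma, mem_Ioc, Nat.mem_divisorsAntidiagonal] at h ⊢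
    obtain ⟨⟨h1, h2⟩, h3, h4⟩ := h
    rw [Nat.le_div_iff_mul_le h1, mul_comm] at h4
    exact ⟨⟨Nat.mul_pos h1 h3, h4⟩, trivial, (Nat.mul_pos h1 h3).ne'⟩
  · rintro ⟨n, d, e⟩ h
    simp only [Finset.mem_sigma, mem_Ioc, Nat.mem_divisorsAntidiagonal] at h ⊢
    obtain ⟨_, rfl, _⟩ := h
    rfl
  · rintro ⟨d, e⟩ h
    rfl
  · rintro ⟨n, d, e⟩ h
    rfl

theorem dact_mul (f g : ArithmeticFunction ℝ) (F : ℝ → ℝ) (x : ℝ) :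
    dact (f * g) F x = dact f (dact g F) x := by
  unfold dact
  have h1 := sum_antidiag (fun d e => f d * (g e * F (x / d / e))) ⌊x⌋₊
  simp_rw [Nat.floor_div_natCast, Finset.mul_sum]
  rw [← h1]
  refine Finset.sum_congr rfl fun n hn => ?_
  rw [ArithmeticFunction.mul_apply, Finset.sum_mul]
  refine Finset.sum_congr rfl fun p hp => ?_
  rw [Nat.mem_divisorsAntidiagonal] at hp
  rw [← hp.1, div_div, Nat.cast_mul, mul_assoc]

theorem dact_one (F : ℝ → ℝ) (x : ℝ) (hx : 1 ≤ x) : dact 1 F x = F x := by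
  unfold dact
  rw [Finset.sum_eq_single 1]
  · simp
  · intro n _ hn
    rw [ArithmeticFunction.one_apply_ne hn, zero_mul]
  · intro h
    exfalso
    apply h
    rw [mem_Ioc, Nat.le_floor_iff (by linarith)]
    exact ⟨one_pos, by simpa using hx⟩

theorem dact_congr (f : ArithmeticFunction ℝ) (F G : ℝ → ℝ) (x : ℝ)
    (h : ∀ y, 1 ≤ y → F y = G y) : dact f F x = dact f G x := by
  refine Finset.sum_congr rfl fun n hn => ?_
  rw [mem_Ioc] at hn
  rw [h]
  rw [le_div_iff₀ (by exact_mod_cast hn.1), one_mul]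
  exact (Nat.le_floor_iff' (by omega)).1 hn.2

theorem dact_add (f : ArithmeticFunction ℝ) (F G : ℝ → ℝ) (x : ℝ) :
    dact f (fun y => F y + G y) x = dact f F x + dact f G x := by
  unfold dact
  rw [← Finset.sum_add_distrib]
  exact Finset.sum_congr rfl fun n _ => by ring

theorem dact_smul (f : ArithmeticFunction ℝ) (F : ℝ → ℝ) (c x : ℝ) :
    dact f (fun y => c * F y) x = c * dact f F x := by
  unfold dact
  rw [Finset.mul_sum]
  exact Finset.sum_congr rfl fun n _ => by ring

theorem log_dact (f : ArithmeticFunction ℝ) (F : ℝ → ℝ) (x : ℝ) :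
    Real.log x * dact f F x =
      dact (f.pmul ArithmeticFunction.log) F x + dact f (fun y => Real.log y * F y) x := by
  unfold dact
  rw [← Finset.sum_add_distrib, Finset.mul_sum]
  refine Finset.sum_congr rfl fun n hn => ?_
  rw [mem_Ioc] at hn
  have hx : x ≠ 0 := by
    rintro rfl
    simp at hn
    omega
  beta_reduce
  rw [ArithmeticFunction.pmul_apply, ArithmeticFunction.log_apply,
    Real.log_div hx (by exact_mod_cast hn.1.ne')]
  ring

/-- Tatuzawa–Iseki -/
theorem tatuzawa (a μ Λ : ArithmeticFunction ℝ) (h1 : μ * a = 1)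
    (h2 : Λ * a = a.pmul ArithmeticFunction.log) (F : ℝ → ℝ) (x : ℝ) (hx : 1 ≤ x) :
    dact μ (fun y => Real.log y * dact a F y) x = Real.log x * F x + dact Λ F x := by
  have h3 : μ * (a.pmul ArithmeticFunction.log) = Λ := by
    rw [← h2, mul_comm Λ a, ← mul_assoc, h1, one_mul]
  simp_rw [log_dact a F]
  rw [dact_add, ← dact_mul, h3, ← dact_mul, h1, dact_one _ _ hx, add_comm]

theorem dact_abs_le (f g : ArithmeticFunction ℝ) (F G : ℝ → ℝ) (x : ℝ)
    (hfg : ∀ n, |f n| ≤ g n) (hFG : ∀ y, 1 ≤ y → |F y| ≤ G y) : |dact f F x| ≤ dact g G x := by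
  refine (Finset.abs_sum_le_sum_abs _ _).trans (Finset.sum_le_sum fun n hn => ?_)
  rw [abs_mul]
  rw [mem_Ioc] at hn
  have : 1 ≤ x / n := by
    rw [le_div_iff₀ (by exact_mod_cast hn.1), one_mul]
    exact (Nat.le_floor_iff' (by omega)).1 hn.2
  exact mul_le_mul (hfg n) (hFG _ this) (abs_nonneg _) ((abs_nonneg _).trans (hfg n))

theorem dact_mono (f : ArithmeticFunction ℝ) (F G : ℝ → ℝ) (x : ℝ)
    (hf : ∀ n, 0 ≤ f n) (hFG : ∀ y, 1 ≤ y → F y ≤ G y) : dact f F x ≤ dact f G x := by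
  refine Finset.sum_le_sum fun n hn => ?_
  rw [mem_Ioc] at hn
  have : 1 ≤ x / n := by
    rw [le_div_iff₀ (by exact_mod_cast hn.1), one_mul]
    exact (Nat.le_floor_iff' (by omega)).1 hn.2
  exact mul_le_mul_of_nonneg_left (hFG _ this) (hf n)

end Act

section Est
open Finset
open scoped Topology

theorem abel_nonneg (b w : ℕ → ℝ) (hb : ∀ N, 0 ≤ ∑ n ∈ Ioc 0 N, b n)
    (hw : ∀ n, 1 ≤ n → w (n + 1) ≤ w n) (hw0 : ∀ n, 1 ≤ n → 0 ≤ w n) (N : ℕ) :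
    0 ≤ ∑ n ∈ Ioc 0 N, b n * w n := by
  have h : ∀ N, 1 ≤ N → w N * ∑ n ∈ Ioc 0 N, b n ≤ ∑ n ∈ Ioc 0 N, b n * w n := by
    intro N hN
    induction N, hN using Nat.le_induction with
    | base => simp [mul_comm]
    | succ N hN ih =>
      rw [Finset.sum_Ioc_succ_top (by omega), Finset.sum_Ioc_succ_top (by omega)]
      have := mul_le_mul_of_nonneg_right (hw N hN) (hb N)
      linarith
  rcases Nat.eq_zero_or_pos N with rfl | hN
  · simp
  · exact (mul_nonneg (hw0 N hN) (hb N)).trans (h N hN)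

theorem bern (s : ℝ) (hs0 : 0 < s) (hs1 : s ≤ 1) (N : ℕ) :
    (N : ℝ) ^ s + s * ((N : ℝ) + 1) ^ (s - 1) ≤ ((N : ℝ) + 1) ^ s := by
  have hN : (0:ℝ) < N + 1 := by positivity
  have h1 : (N : ℝ) = (N + 1) * (1 + -(1 / ((N:ℝ) + 1))) := by field_simp; ring
  have h3 : 1 / ((N:ℝ) + 1) ≤ 1 := by rw [div_le_one hN]; linarith [(Nat.cast_nonneg N : (0:ℝ) ≤ N)]
  have h2 := rpow_one_add_le_one_add_mul_self (s := -(1 / ((N:ℝ) + 1))) (by linarith)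
    hs0.le hs1
  conv_lhs => rw [h1]
  rw [Real.mul_rpow hN.le (by linarith), ← h1, Real.rpow_sub_one hN.ne']
  have h4 : 0 < ((N:ℝ) + 1) ^ s := by positivity
  have h5 : s * (((N:ℝ) + 1) ^ s / (N + 1)) = ((N:ℝ) + 1) ^ s * (s * (1 / ((N:ℝ) + 1))) := by ring
  rw [h5]
  nlinarith

theorem bern2 (s : ℝ) (hs0 : 0 < s) (hs1 : s ≤ 1) (N : ℕ) (hN1 : 1 ≤ N) :
    s * ((N : ℝ) + 1) ^ (-s - 1) ≤ (N : ℝ) ^ (-s) - ((N : ℝ) + 1) ^ (-s) := by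
  have hN : (0:ℝ) < N + 1 := by positivity
  have hN0 : (0:ℝ) < N := by exact_mod_cast hN1
  have h := bern s hs0 hs1 N
  set A := (N:ℝ) ^ s with hA
  set B := ((N:ℝ) + 1) ^ s with hB
  have hA0 : 0 < A := by positivity
  have hB0 : 0 < B := by positivity
  rw [Real.rpow_sub_one hN.ne', Real.rpow_neg hN.le, Real.rpow_neg hN0.le]
  rw [Real.rpow_sub_one hN.ne'] at h
  have hAB : A ≤ B := Real.rpow_le_rpow hN0.le (by linarith) hs0.le
  set t := s / ((N:ℝ) + 1) with ht
  have ht0 : 0 < t := by positivity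
  have h1 : A ≤ B * (1 - t) := by
    have : s * (B / ((N:ℝ) + 1)) = B * t := by rw [ht]; ring
    linarith
  have h2 : s * (B⁻¹ / ((N:ℝ) + 1)) = B⁻¹ * t := by rw [ht]; ring
  rw [h2]
  have h3 : B⁻¹ * t + B⁻¹ ≤ A⁻¹ := by
    rw [show B⁻¹ * t + B⁻¹ = (1 + t) / B by field_simp; ring, ← one_div, div_le_div_iff₀ hB0 hA0]
    nlinarith [mul_le_mul_of_nonneg_left h1 (by linarith : 0 ≤ 1 + t), mul_pos hB0 (mul_pos ht0 ht0)]
  linarith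

theorem sum_rpow_le (σ : ℝ) (h0 : 0 ≤ σ) (h1 : σ < 1) (N : ℕ) :
    ∑ n ∈ Ioc 0 N, (n : ℝ) ^ (-σ) ≤ (N : ℝ) ^ (1 - σ) / (1 - σ) := by
  induction N with
  | zero => simp [Real.zero_rpow (by linarith : (1 - σ) ≠ 0)]
  | succ N ih =>
    rw [Finset.sum_Ioc_succ_top (by omega)]
    have h := bern (1 - σ) (by linarith) (by linarith) N
    rw [show (1 - σ - 1) = -σ by ring] at h
    rw [le_div_iff₀ (by linarith)] at ih ⊢
    push_cast
    linarith

theorem dact_rpow_le (a : ArithmeticFunction ℝ) (B σ : ℝ) (hB : 0 ≤ B) (h0 : 0 ≤ σ) (h1 : σ < 1)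
    (ha : ∀ N : ℕ, ∑ n ∈ Ioc 0 N, a n ≤ B * N) (x : ℝ) (hx : 1 ≤ x) :
    dact a (fun y => y ^ σ) x ≤ B / (1 - σ) * x := by
  have hx0 : 0 < x := by linarith
  have h2 := abel_nonneg (fun n => B - a n) (fun n => (n : ℝ) ^ (-σ)) (fun N => by
    rw [Finset.sum_sub_distrib]
    simp only [sum_const, Nat.card_Ioc, tsub_zero, nsmul_eq_mul]
    linarith [ha N]) (fun n hn => by
      apply Real.rpow_le_rpow_of_nonpos (by exact_mod_cast hn) (by simp) (by linarith))
    (fun n _ => by positivity) ⌊x⌋₊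
  simp only [sub_mul, Finset.sum_sub_distrib, ← Finset.mul_sum] at h2
  have h3 : dact a (fun y => y ^ σ) x = x ^ σ * ∑ n ∈ Ioc 0 ⌊x⌋₊, a n * (n:ℝ) ^ (-σ) := by
    rw [dact, Finset.mul_sum]
    refine Finset.sum_congr rfl fun n _ => ?_
    rw [Real.div_rpow hx0.le (by positivity), Real.rpow_neg (by positivity)]
    ring
  rw [h3]
  have h4 := sum_rpow_le σ h0 h1 ⌊x⌋₊
  have h5 : (⌊x⌋₊ : ℝ) ^ (1 - σ) ≤ x ^ (1 - σ) :=
    Real.rpow_le_rpow (by positivity) (Nat.floor_le hx0.le) (by linarith)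
  have h6 : x = x ^ σ * x ^ (1 - σ) := by rw [← Real.rpow_add hx0]; simp
  have h7 : 0 < 1 - σ := by linarith
  calc x ^ σ * ∑ n ∈ Ioc 0 ⌊x⌋₊, a n * (n:ℝ) ^ (-σ)
      ≤ x ^ σ * (B * ∑ n ∈ Ioc 0 ⌊x⌋₊, (n:ℝ) ^ (-σ)) := by gcongr; linarith
    _ ≤ x ^ σ * (B * (x ^ (1 - σ) / (1 - σ))) := by gcongr; exact h4.trans (by gcongr)
    _ = B / (1 - σ) * (x ^ σ * x ^ (1 - σ)) := by ring
    _ = _ := by rw [← h6]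

theorem harm_eq (N : ℕ) : ((harmonic N : ℚ) : ℝ) = ∑ n ∈ Ioc 0 N, (1:ℝ) / n := by
  induction N with
  | zero => simp
  | succ N ih => rw [harmonic_succ, Finset.sum_Ioc_succ_top (by omega), ← ih]; push_cast; rw [one_div]

theorem log_step (N : ℕ) (hN : 1 ≤ N) : Real.log (N + 1) - Real.log N ≤ 1 / N := by
  have hN0 : (0:ℝ) < N := by exact_mod_cast hN
  rw [← Real.log_div (by positivity) hN0.ne']
  have := Real.log_le_sub_one_of_pos (show (0:ℝ) < (N + 1) / N by positivity)
  refine this.trans (le_of_eq ?_)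
  field_simp
  ring

theorem log_step2 (N : ℕ) (hN : 1 ≤ N) : 1 / ((N : ℝ) + 1) ≤ Real.log (N + 1) - Real.log N := by
  have hN0 : (0:ℝ) < N := by exact_mod_cast hN
  rw [← Real.log_div (by positivity) hN0.ne', ← neg_le_neg_iff, ← Real.log_inv, inv_div]
  have := Real.log_le_sub_one_of_pos (show (0:ℝ) < N / (N + 1) by positivity)
  refine this.trans (le_of_eq ?_)
  field_simp
  ring

theorem sum_log_bound (e : ℕ → ℝ) (E θ : ℝ) (hE : 0 ≤ E) (hθ : 0 < θ)
    (he : ∀ N : ℕ, 1 ≤ N → |∑ n ∈ Ioc 0 N, e n| ≤ E * (N : ℝ) ^ θ) (N : ℕ) (hN : 1 ≤ N) :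
    |∑ n ∈ Ioc 0 N, e n * Real.log n| ≤ E * (N : ℝ) ^ θ * (1 + 2 * Real.log N) := by
  have key : ∀ N : ℕ, |(∑ n ∈ Ioc 0 (N + 1), e n * Real.log n) -
      (∑ n ∈ Ioc 0 (N + 1), e n) * Real.log ((N : ℝ) + 1)| ≤
        E * ((N : ℝ) + 1) ^ θ * ∑ n ∈ Ioc 0 N, (1:ℝ) / n := by
    intro N
    induction N with
    | zero => simp
    | succ N ih =>
      have h1 := he (N + 1) (by omega)
      have h2 := log_step (N + 1) (by omega)
      have h20 : 0 ≤ Real.log ((N + 1 : ℕ) + 1) - Real.log ((N + 1 : ℕ)) :=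
        sub_nonneg.2 (Real.log_le_log (by positivity) (by linarith))
      have q1 := Finset.sum_Ioc_succ_top (by omega : 0 ≤ N + 1) (fun n => e n * Real.log n)
      have q2 := Finset.sum_Ioc_succ_top (by omega : 0 ≤ N + 1) e
      have q3 := Finset.sum_Ioc_succ_top (by omega : 0 ≤ N) (fun n : ℕ => (1:ℝ) / n)
      rw [q1, q2, q3]
      set S := ∑ n ∈ Ioc 0 (N + 1), e n
      set T := ∑ n ∈ Ioc 0 (N + 1), e n * Real.log n
      set H := ∑ n ∈ Ioc 0 N, (1:ℝ) / n
      have hH : 0 ≤ H := Finset.sum_nonneg fun n _ => by positivity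
      push_cast at h1 h2 h20 ⊢
      have h3 : T + e (N + 1 + 1) * Real.log (N + 1 + 1) - (S + e (N + 1 + 1)) * Real.log (N + 1 + 1)
        = (T - S * Real.log (N + 1)) - S * (Real.log (N + 1 + 1) - Real.log (N + 1)) := by ring
      rw [h3]
      refine (abs_sub _ _).trans ?_
      rw [abs_mul, abs_of_nonneg h20]
      have h4 : ((N:ℝ) + 1) ^ θ ≤ ((N:ℝ) + 1 + 1) ^ θ :=
        Real.rpow_le_rpow (by positivity) (by linarith) hθ.le
      calc _ ≤ E * ((N:ℝ) + 1) ^ θ * H + E * ((N:ℝ) + 1) ^ θ * (1 / ((N:ℝ) + 1)) := by gcongr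
        _ = E * ((N:ℝ) + 1) ^ θ * (H + 1 / ((N:ℝ) + 1)) := by ring
        _ ≤ _ := by gcongr
  obtain ⟨M, rfl⟩ : ∃ M, N = M + 1 := ⟨N - 1, by omega⟩
  have h1 := key M
  have h2 := harmonic_le_one_add_log M
  rw [harm_eq] at h2
  have h3 : Real.log M ≤ Real.log ((M:ℝ) + 1) := by
    rcases Nat.eq_zero_or_pos M with rfl | hM
    · simp
    · exact Real.log_le_log (by exact_mod_cast hM) (by linarith)
  have h4 := he (M + 1) (by omega)
  push_cast at h4 ⊢
  have h0 : 0 ≤ Real.log ((M:ℝ) + 1) := Real.log_nonneg (by simp)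
  have h5 := abs_add_le ((∑ n ∈ Ioc 0 (M + 1), e n * Real.log n) -
      (∑ n ∈ Ioc 0 (M + 1), e n) * Real.log ((M : ℝ) + 1)) ((∑ n ∈ Ioc 0 (M + 1), e n) * Real.log ((M : ℝ) + 1))
  rw [sub_add_cancel, abs_mul, abs_of_nonneg h0] at h5
  calc _ ≤ _ := h5
    _ ≤ E * ((M : ℝ) + 1) ^ θ * (1 + Real.log ((M:ℝ)+1)) + E * ((M : ℝ) + 1) ^ θ * Real.log ((M:ℝ)+1) := by
      refine add_le_add (h1.trans ?_) (by gcongr)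
      gcongr
      linarith
    _ = _ := by ring

theorem sum_inv_bound (e : ℕ → ℝ) (E θ : ℝ) (hE : 0 ≤ E) (hθ : 0 < θ) (hθ1 : θ < 1)
    (he : ∀ N : ℕ, 1 ≤ N → |∑ n ∈ Ioc 0 N, e n| ≤ E * (N : ℝ) ^ θ) :
    ∃ c E' : ℝ, 0 ≤ E' ∧ ∀ N : ℕ, 1 ≤ N →
      |(∑ n ∈ Ioc 0 N, e n / n) - c| ≤ E' * (N : ℝ) ^ (θ - 1) := by
  set s := 1 - θ with hs
  have hs0 : 0 < s := by linarith
  set S : ℕ → ℝ := fun N => ∑ n ∈ Ioc 0 N, e n with hS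
  set U : ℕ → ℝ := fun N => ∑ n ∈ Ioc 0 N, e n / n with hU
  set V : ℕ → ℝ := fun N => U (N + 1) - S (N + 1) / ((N : ℝ) + 2) with hV
  set w : ℕ → ℝ := fun N => E / s * ((N : ℝ) + 1) ^ (-s) with hw
  have hstep : ∀ N, |V (N + 1) - V N| ≤ w N - w (N + 1) := by
    intro N
    have h1 : V (N + 1) - V N = S (N + 2) * (1 / ((N:ℝ) + 2) - 1 / ((N:ℝ) + 3)) := by
      have hU2 : U (N + 1 + 1) = U (N + 1) + e (N + 2) / ((N:ℝ) + 2) := by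
        simp only [hU]
        rw [Finset.sum_Ioc_succ_top (by omega : 0 ≤ N + 1)]
        push_cast
        rw [show (N:ℝ) + 1 + 1 = N + 2 by ring]
      have hS2 : S (N + 1 + 1) = S (N + 1) + e (N + 2) := by
        simp only [hS]
        rw [Finset.sum_Ioc_succ_top (by omega : 0 ≤ N + 1)]
      simp only [hV]
      rw [hU2, show S (N + 2) = S (N + 1 + 1) from rfl, hS2]
      push_cast
      rw [show (N:ℝ) + 1 + 2 = N + 3 by ring]
      ring
    have h2 := he (N + 2) (by omega)
    have h3 := bern2 s hs0 (by linarith) (N + 1) (by omega)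
    push_cast at h2 h3
    rw [show (N:ℝ) + 1 + 1 = N + 2 by ring] at h3
    have h4 : 1 / ((N:ℝ) + 2) - 1 / ((N:ℝ) + 3) = 1 / (((N:ℝ) + 2) * ((N:ℝ) + 3)) := by
      field_simp; ring
    have h5 : 1 / (((N:ℝ) + 2) * ((N:ℝ) + 3)) ≤ 1 / (((N:ℝ) + 2) * ((N:ℝ) + 2)) := by
      gcongr; norm_num
    have hN2 : (0:ℝ) < N + 2 := by positivity
    rw [h1, abs_mul, h4, abs_of_pos (by positivity : 0 < 1 / (((N:ℝ) + 2) * ((N:ℝ) + 3)))]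
    calc _ ≤ E * ((N:ℝ) + 2) ^ θ * (1 / (((N:ℝ) + 2) * ((N:ℝ) + 2))) := by gcongr
      _ = E * ((N:ℝ) + 2) ^ (-s - 1) := by
        rw [show -s - 1 = θ - 1 - 1 by rw [hs]; ring, Real.rpow_sub_one hN2.ne', Real.rpow_sub_one hN2.ne']
        field_simp
      _ = E / s * (s * ((N:ℝ) + 2) ^ (-s - 1)) := by field_simp
      _ ≤ E / s * (((N:ℝ) + 1) ^ (-s) - ((N:ℝ) + 2) ^ (-s)) := by gcongr
      _ = _ := by
        simp only [hw]; push_cast; rw [show (N:ℝ) + 1 + 1 = N + 2 by ring]; ring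
  have hw0 : ∀ N, 0 ≤ w N := fun N => by simp only [hw]; positivity
  have hdist : ∀ n m, n ≤ m → |V m - V n| ≤ w n - w m := by
    intro n m hnm
    induction m, hnm using Nat.le_induction with
    | base => simp
    | succ m _ ih =>
      have := abs_sub_le (V (m + 1)) (V m) (V n)
      linarith [hstep m]
  have hwlim : Tendsto w atTop (𝓝 0) := by
    have h1 : Tendsto (fun N : ℕ => ((N:ℝ) + 1)) atTop atTop :=
      tendsto_atTop_add_const_right _ _ tendsto_natCast_atTop_atTop
    have := ((tendsto_rpow_neg_atTop hs0).comp h1).const_mul (E / s)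
    rwa [mul_zero] at this
  have hc : CauchySeq V := cauchySeq_of_le_tendsto_0' w (fun n m hnm => by
    rw [dist_comm, Real.dist_eq]
    linarith [hdist n m hnm, hw0 m]) hwlim
  obtain ⟨c, hc⟩ := cauchySeq_tendsto_of_complete hc
  have hVc : ∀ n, |V n - c| ≤ w n := by
    intro n
    have h1 : Tendsto (fun m => |V m - V n|) atTop (𝓝 |c - V n|) := (hc.sub_const _).abs
    rw [abs_sub_comm]
    refine le_of_tendsto h1 ?_
    filter_upwards [eventually_ge_atTop n] with m hm
    linarith [hdist n m hm, hw0 m]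
  refine ⟨c, E / s + E, by positivity, fun N hN => ?_⟩
  obtain ⟨M, rfl⟩ : ∃ M, N = M + 1 := ⟨N - 1, by omega⟩
  have h1 := hVc M
  have h2 := he (M + 1) hN
  have hM : (0:ℝ) < (M:ℝ) + 1 := by positivity
  have h3 : |S (M + 1) / ((M:ℝ) + 2)| ≤ E * ((M:ℝ) + 1) ^ (θ - 1) := by
    rw [abs_div, abs_of_pos (by positivity : (0:ℝ) < M + 2), Real.rpow_sub_one hM.ne', ← mul_div_assoc]
    push_cast at h2
    gcongr
    linarith
  have h4 := abs_add_le (V M - c) (S (M + 1) / ((M:ℝ) + 2))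
  have h5 : V M - c + S (M + 1) / ((M:ℝ) + 2) = U (M + 1) - c := by simp only [hV]; ring
  rw [h5] at h4
  have h6 : w M = E / s * ((M:ℝ) + 1) ^ (θ - 1) := by
    simp only [hw]; congr 2; rw [hs]; ring
  push_cast
  rw [add_mul]
  linarith

theorem log_fact_bound (N : ℕ) (hN : 1 ≤ N) :
    |(∑ n ∈ Ioc 0 N, Real.log n) - (N * Real.log N - N)| ≤ 1 + Real.log N := by
  have h : 0 ≤ (∑ n ∈ Ioc 0 N, Real.log n) - (N * Real.log N - N) ∧
    (∑ n ∈ Ioc 0 N, Real.log n) - (N * Real.log N - N) ≤ 1 + Real.log N := by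
    induction N, hN using Nat.le_induction with
    | base => simp
    | succ N hN ih =>
      have h1 := log_step N hN
      have h2 := log_step2 N hN
      have hN0 : (0:ℝ) < N := by exact_mod_cast hN
      rw [le_div_iff₀ hN0] at h1
      rw [div_le_iff₀ (by positivity)] at h2
      rw [Finset.sum_Ioc_succ_top (by omega)]
      push_cast
      constructor <;> nlinarith [ih.1, ih.2]
  rw [abs_of_nonneg h.1]
  exact h.2

theorem harm_bound (N : ℕ) (hN : 1 ≤ N) :
    |(∑ n ∈ Ioc 0 N, (1:ℝ) / n) - Real.log N - Real.eulerMascheroniConstant| ≤ 1 / N := by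
  have h1 := Real.eulerMascheroniSeq_lt_eulerMascheroniConstant N
  have h2 := Real.eulerMascheroniConstant_lt_eulerMascheroniSeq' N
  rw [Real.eulerMascheroniSeq, harm_eq] at h1
  rw [Real.eulerMascheroniSeq', if_neg (by omega), harm_eq] at h2
  have h3 := log_step N hN
  have : (0:ℝ) ≤ 1 / N := by positivity
  rw [abs_le]
  constructor <;> linarith

end Est

section Selberg
open Finset
open scoped Topology

theorem floor_facts (x : ℝ) (hx : 1 ≤ x) : 1 ≤ ⌊x⌋₊ ∧ (⌊x⌋₊ : ℝ) ≤ x ∧ x < ⌊x⌋₊ + 1 ∧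
    Real.log x - Real.log ⌊x⌋₊ ≤ 1 / ⌊x⌋₊ ∧ 0 ≤ Real.log x - Real.log ⌊x⌋₊ := by
  have h1 : 1 ≤ ⌊x⌋₊ := (Nat.one_le_floor_iff _).2 hx
  have h1' : (0:ℝ) < ⌊x⌋₊ := by exact_mod_cast h1
  have h2 : (⌊x⌋₊ : ℝ) ≤ x := Nat.floor_le (by linarith)
  have h3 := Nat.lt_floor_add_one x
  refine ⟨h1, h2, h3, ?_, sub_nonneg.2 (Real.log_le_log h1' h2)⟩
  have h4 := log_step _ h1
  have h5 := Real.log_le_log (by linarith) h3.le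
  linarith

theorem G_bound (a : ArithmeticFunction ℝ) (c E θ : ℝ) (hc : 0 < c) (hE : 0 ≤ E) (hθ : 0 < θ)
    (hθ1 : θ < 1)
    (hcount : ∀ x : ℝ, 1 ≤ x → |(∑ n ∈ Ioc 0 ⌊x⌋₊, a n) - c * x| ≤ E * x ^ θ) :
    ∃ D M : ℝ, 0 ≤ M ∧ ∀ x : ℝ, 1 ≤ x →
      |dact (a.pmul ArithmeticFunction.log) (fun _ => 1) x - dact a (fun y => y) x +
        D * dact a (fun _ => 1) x| ≤ M * x ^ θ * (1 + Real.log x) := by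
  set e : ℕ → ℝ := fun n => a n - c with he
  have heS : ∀ N : ℕ, 1 ≤ N → |∑ n ∈ Ioc 0 N, e n| ≤ E * (N : ℝ) ^ θ := by
    intro N hN
    have h := hcount N (by exact_mod_cast hN)
    rw [Nat.floor_natCast] at h
    simp only [he, Finset.sum_sub_distrib, sum_const, Nat.card_Ioc, tsub_zero, nsmul_eq_mul]
    rwa [mul_comm (N:ℝ) c]
  obtain ⟨c1, E', hE', hinv⟩ := sum_inv_bound e E θ hE hθ hθ1 heS
  set g := Real.eulerMascheroniConstant with hg
  set D : ℝ := (c + c * g + c1) / c with hD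
  refine ⟨D, 2 * E + 8 * c + 2 * E' + |D| * E, by positivity, fun x hx => ?_⟩
  obtain ⟨hN1, hNx, hxN, hlog1, hlog0⟩ := floor_facts x hx
  set N := ⌊x⌋₊ with hN
  have hx0 : 0 < x := by linarith
  have hN0 : (0:ℝ) < N := by exact_mod_cast hN1
  have hN1' : (1:ℝ) ≤ N := by exact_mod_cast hN1
  have hlx : 0 ≤ Real.log x := Real.log_nonneg hx
  have hlN : 0 ≤ Real.log N := Real.log_nonneg hN1'
  have hxθ : 1 ≤ x ^ θ := Real.one_le_rpow hx hθ.le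
  have hNθ : (N:ℝ) ^ θ ≤ x ^ θ := Real.rpow_le_rpow hN0.le hNx hθ.le
  -- T
  have hT : dact (a.pmul ArithmeticFunction.log) (fun _ => 1) x =
      c * (∑ n ∈ Ioc 0 N, Real.log n) + ∑ n ∈ Ioc 0 N, e n * Real.log n := by
    rw [dact, Finset.mul_sum, ← Finset.sum_add_distrib]
    refine Finset.sum_congr rfl fun n _ => ?_
    rw [ArithmeticFunction.pmul_apply, ArithmeticFunction.log_apply]
    simp only [he]; ring
  have hP : dact a (fun y => y) x =
      c * x * (∑ n ∈ Ioc 0 N, (1:ℝ) / n) + x * ∑ n ∈ Ioc 0 N, e n / n := by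
    rw [dact, Finset.mul_sum, Finset.mul_sum, ← Finset.sum_add_distrib]
    refine Finset.sum_congr rfl fun n _ => ?_
    simp only [he]; ring
  have hA : dact a (fun _ => 1) x = ∑ n ∈ Ioc 0 N, a n := by simp [dact, hN]
  have b1 := sum_log_bound e E θ hE hθ heS N hN1
  have b2 := hinv N hN1
  have b3 := log_fact_bound N hN1
  have b4 := harm_bound N hN1
  have b5 := hcount x hx
  rw [← hN] at b5
  rw [← hg] at b4
  rw [hT, hP, hA]
  set L := ∑ n ∈ Ioc 0 N, Real.log n
  set H := ∑ n ∈ Ioc 0 N, (1:ℝ) / n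
  set A := ∑ n ∈ Ioc 0 N, a n
  set e1 := ∑ n ∈ Ioc 0 N, e n * Real.log n
  set e2 := ∑ n ∈ Ioc 0 N, e n / n
  have hsplit : c * L + e1 - (c * x * H + x * e2) + D * A =
      e1 + c * (L - (x * Real.log x - x)) - c * (x * (H - Real.log x - g)) - x * (e2 - c1)
        + D * (A - c * x) := by
    rw [hD]; field_simp; ring
  rw [hsplit]
  -- bounds
  have hxlog : |x * Real.log x - x - (N * Real.log N - N)| ≤ 1 + Real.log x := by
    have q1 : x * Real.log x - x - (N * Real.log N - N) =
      (x - N) * Real.log x + N * (Real.log x - Real.log N) - (x - N) := by ring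
    have q2 : N * (Real.log x - Real.log N) ≤ 1 := by
      rw [le_div_iff₀ hN0] at hlog1; linarith
    have q3 : 0 ≤ N * (Real.log x - Real.log N) := by positivity
    have q4 : 0 ≤ (x - N) * Real.log x := mul_nonneg (by linarith) hlx
    have q5 : (x - N) * Real.log x ≤ 1 * Real.log x := by gcongr; linarith
    rw [q1, abs_le]; constructor <;> linarith
  have B1 : |e1| ≤ 2 * E * x ^ θ * (1 + Real.log x) := by
    calc |e1| ≤ E * (N:ℝ) ^ θ * (1 + 2 * Real.log N) := b1
      _ ≤ E * x ^ θ * (2 * (1 + Real.log x)) := by gcongr; linarith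
      _ = _ := by ring
  have B2 : |c * (L - (x * Real.log x - x))| ≤ 2 * c * x ^ θ * (1 + Real.log x) := by
    rw [abs_mul, abs_of_pos hc]
    have q : |L - (x * Real.log x - x)| ≤ 2 * (1 + Real.log x) := by
      have := abs_sub_le L (N * Real.log N - N) (x * Real.log x - x)
      rw [abs_sub_comm (N * Real.log N - N : ℝ)] at this
      linarith
    calc c * |L - (x * Real.log x - x)| ≤ c * (2 * (1 + Real.log x)) := by gcongr
      _ = 2 * c * 1 * (1 + Real.log x) := by ring
      _ ≤ _ := by gcongr
  have hxN2 : x / N ≤ 2 := by rw [div_le_iff₀ hN0]; linarith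
  have B3 : |c * (x * (H - Real.log x - g))| ≤ 4 * c * x ^ θ * (1 + Real.log x) := by
    rw [abs_mul, abs_mul, abs_of_pos hc, abs_of_pos hx0]
    have q : |H - Real.log x - g| ≤ 2 / N := by
      have h1 := abs_le.1 b4
      rw [abs_le, show (2:ℝ) / N = 1 / N + 1 / N by ring]
      constructor <;> linarith
    calc c * (x * |H - Real.log x - g|) ≤ c * (x * (2 / N)) := by gcongr
      _ = 2 * c * (x / N) := by ring
      _ ≤ 2 * c * 2 := by gcongr
      _ = 4 * c * 1 * (1 + 0) := by ring
      _ ≤ _ := by gcongr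
  have B4 : |x * (e2 - c1)| ≤ 2 * E' * x ^ θ * (1 + Real.log x) := by
    rw [abs_mul, abs_of_pos hx0]
    calc x * |e2 - c1| ≤ x * (E' * (N:ℝ) ^ (θ - 1)) := by gcongr
      _ = E' * (x / N) * (N:ℝ) ^ θ := by rw [Real.rpow_sub_one hN0.ne']; ring
      _ ≤ E' * 2 * x ^ θ := by gcongr
      _ = 2 * E' * x ^ θ * (1 + 0) := by ring
      _ ≤ _ := by gcongr
  have B5 : |D * (A - c * x)| ≤ |D| * E * x ^ θ * (1 + Real.log x) := by
    rw [abs_mul]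
    calc |D| * |A - c * x| ≤ |D| * (E * x ^ θ) := by gcongr
      _ = |D| * E * x ^ θ * (1 + 0) := by ring
      _ ≤ _ := by gcongr
  have t1 := abs_add_le (e1 + c * (L - (x * Real.log x - x)) - c * (x * (H - Real.log x - g)) - x * (e2 - c1))
    (D * (A - c * x))
  have t2 := abs_sub (e1 + c * (L - (x * Real.log x - x)) - c * (x * (H - Real.log x - g))) (x * (e2 - c1))
  have t3 := abs_sub (e1 + c * (L - (x * Real.log x - x))) (c * (x * (H - Real.log x - g)))
  have t4 := abs_add_le e1 (c * (L - (x * Real.log x - x)))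
  have hpos : 0 ≤ x ^ θ * (1 + Real.log x) := by positivity
  have hexp : (2 * E + 8 * c + 2 * E' + |D| * E) * x ^ θ * (1 + Real.log x) =
    2 * E * x ^ θ * (1 + Real.log x) + 2 * c * x ^ θ * (1 + Real.log x) +
    4 * c * x ^ θ * (1 + Real.log x) + 2 * E' * x ^ θ * (1 + Real.log x) +
    |D| * E * x ^ θ * (1 + Real.log x) + 2 * c * (x ^ θ * (1 + Real.log x)) := by ring
  rw [hexp]
  have : 0 ≤ 2 * c * (x ^ θ * (1 + Real.log x)) := by positivity
  linarith

theorem log_rpow_bound (θ : ℝ) (hθ : 0 < θ) (hθ1 : θ < 1) : ∃ C : ℝ, 0 ≤ C ∧ ∀ y : ℝ, 1 ≤ y →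
    Real.log y * (y ^ θ * (1 + Real.log y)) ≤ C * y ^ ((1 + θ) / 2) := by
  set ε := (1 - θ) / 4 with hε
  have hε0 : 0 < ε := by rw [hε]; linarith
  refine ⟨1 / ε * (1 + 1 / ε), by positivity, fun y hy => ?_⟩
  have hy0 : 0 < y := by linarith
  have h1 : Real.log y ≤ y ^ ε / ε := Real.log_le_rpow_div hy0.le hε0
  have h2 : 1 ≤ y ^ ε := Real.one_le_rpow hy hε0.le
  have h0 : 0 ≤ Real.log y := Real.log_nonneg hy
  have h3 : 1 + Real.log y ≤ y ^ ε * (1 + 1 / ε) := by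
    have : y ^ ε * (1 + 1 / ε) = y ^ ε + y ^ ε / ε := by ring
    linarith
  calc Real.log y * (y ^ θ * (1 + Real.log y)) ≤ (y ^ ε / ε) * (y ^ θ * (y ^ ε * (1 + 1 / ε))) := by
        gcongr
    _ = 1 / ε * (1 + 1 / ε) * (y ^ θ * y ^ ε * y ^ ε) := by ring
    _ = _ := by
      rw [← Real.rpow_add hy0, ← Real.rpow_add hy0]
      congr 2
      rw [hε]; ring

theorem selberg_bound (a μ Λ : ArithmeticFunction ℝ) (h1 : μ * a = 1)
    (h2 : Λ * a = a.pmul ArithmeticFunction.log) (hμ : ∀ n, |μ n| ≤ a n) (hΛ : ∀ n, 0 ≤ Λ n)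
    (c E θ B : ℝ) (hc : 0 < c) (hE : 0 ≤ E) (hθ : 0 < θ) (hθ1 : θ < 1) (hB : 0 ≤ B)
    (hcount : ∀ x : ℝ, 1 ≤ x → |(∑ n ∈ Ioc 0 ⌊x⌋₊, a n) - c * x| ≤ E * x ^ θ)
    (hψ : ∀ N : ℕ, ∑ n ∈ Ioc 0 N, Λ n ≤ B * N) :
    ∃ C : ℝ, ∀ x : ℝ, 1 ≤ x →
      (∑ n ∈ Ioc 0 ⌊x⌋₊, Λ n) * Real.log x ≤ 2 * x * Real.log x + C * x := by
  obtain ⟨D, M, hM, hG⟩ := G_bound a c E θ hc hE hθ hθ1 hcount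
  have ha0 : ∀ n, 0 ≤ a n := fun n => (abs_nonneg _).trans (hμ n)
  have hAN : ∀ N : ℕ, ∑ n ∈ Ioc 0 N, a n ≤ (c + E) * N := by
    intro N
    rcases Nat.eq_zero_or_pos N with rfl | hN
    · simp
    have hN' : (1:ℝ) ≤ N := by exact_mod_cast hN
    have := (abs_le.1 (hcount N hN')).2
    rw [Nat.floor_natCast] at this
    have h3 : (N:ℝ) ^ θ ≤ N := by
      have := Real.rpow_le_rpow_of_exponent_le hN' hθ1.le
      rwa [Real.rpow_one] at this
    nlinarith
  set ψ : ℝ → ℝ := dact Λ (fun _ => 1) with hψdef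
  have hψe : ∀ x, ψ x = ∑ n ∈ Ioc 0 ⌊x⌋₊, Λ n := fun x => by simp [hψdef, dact]
  have hψ0 : ∀ x, 0 ≤ ψ x := fun x => by rw [hψe]; exact Finset.sum_nonneg fun n _ => hΛ n
  set F : ℝ → ℝ := fun y => ψ y - y + D with hF
  have haF : ∀ x, dact a F x = dact (a.pmul ArithmeticFunction.log) (fun _ => 1) x -
      dact a (fun y => y) x + D * dact a (fun _ => 1) x := by
    intro x
    rw [← h2, mul_comm Λ a, dact_mul, ← dact_smul, sub_eq_add_neg,
      ← neg_one_mul, ← dact_smul, ← dact_add, ← dact_add]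
    congr 1
    funext y
    simp only [hF, hψdef]
    ring
  obtain ⟨C1, hC1, hlr⟩ := log_rpow_bound θ hθ hθ1
  set σ := (1 + θ) / 2 with hσ
  have hσ1 : σ < 1 := by rw [hσ]; linarith
  have hσ0 : 0 ≤ σ := by rw [hσ]; linarith
  have hLHS : ∀ x : ℝ, 1 ≤ x → |dact μ (fun y => Real.log y * dact a F y) x| ≤
      M * C1 * ((c + E) / (1 - σ)) * x := by
    intro x hx
    have h3 := dact_abs_le μ a (fun y => Real.log y * dact a F y) (fun y => (M * C1) * y ^ σ) x hμ
      (fun y hy => by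
        have h0 : 0 ≤ Real.log y := Real.log_nonneg hy
        rw [abs_mul, abs_of_nonneg h0, haF]
        calc _ ≤ Real.log y * (M * y ^ θ * (1 + Real.log y)) := by gcongr; exact hG y hy
          _ = M * (Real.log y * (y ^ θ * (1 + Real.log y))) := by ring
          _ ≤ M * (C1 * y ^ σ) := mul_le_mul_of_nonneg_left (hlr y hy) hM
          _ = _ := by ring)
    refine h3.trans ?_
    rw [dact_smul, mul_assoc (M * C1)]
    gcongr
    exact dact_rpow_le a (c + E) σ (by positivity) hσ0 hσ1 hAN x hx
  -- Mertens
  have hMert : ∀ x : ℝ, 1 ≤ x → dact Λ (fun y => y) x ≤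
      x * Real.log x + (E * (1 / (1 - θ)) + E * (B / (1 - θ))) / c * x := by
    intro x hx
    have hx0 : 0 < x := by linarith
    have hlx := Real.log_nonneg hx
    have h3 : dact (a.pmul ArithmeticFunction.log) (fun _ => 1) x ≤ (c * x + E * x ^ θ) * Real.log x := by
      rw [dact]
      calc _ ≤ ∑ n ∈ Ioc 0 ⌊x⌋₊, a n * Real.log x := by
            refine Finset.sum_le_sum fun n hn => ?_
            rw [mem_Ioc] at hn
            rw [ArithmeticFunction.pmul_apply, ArithmeticFunction.log_apply, mul_one]
            refine mul_le_mul_of_nonneg_left ?_ (ha0 n)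
            exact Real.log_le_log (by exact_mod_cast hn.1) ((Nat.le_floor_iff' (by omega)).1 hn.2)
        _ = (∑ n ∈ Ioc 0 ⌊x⌋₊, a n) * Real.log x := by rw [Finset.sum_mul]
        _ ≤ _ := by
          gcongr
          linarith [(abs_le.1 (hcount x hx)).2]
    rw [← h2, dact_mul] at h3
    have h4 : c * dact Λ (fun y => y) x - E * dact Λ (fun y => y ^ θ) x ≤ dact Λ (dact a fun _ => 1) x := by
      rw [← dact_smul, sub_eq_add_neg, ← neg_one_mul, ← mul_assoc, ← dact_smul, ← dact_add]
      refine dact_mono _ _ _ _ hΛ fun y hy => ?_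
      have := (abs_le.1 (hcount y hy)).1
      have hA : dact a (fun _ => 1) y = ∑ n ∈ Ioc 0 ⌊y⌋₊, a n := by simp [dact]
      rw [hA]
      linarith
    have h5 := dact_rpow_le Λ B θ hB hθ.le hθ1 hψ x hx
    have h6 : x ^ θ * Real.log x ≤ 1 / (1 - θ) * x := by
      have := Real.log_le_rpow_div hx0.le (show 0 < 1 - θ by linarith)
      calc x ^ θ * Real.log x ≤ x ^ θ * (x ^ (1 - θ) / (1 - θ)) := by gcongr
        _ = 1 / (1 - θ) * (x ^ θ * x ^ (1 - θ)) := by ring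
        _ = _ := by rw [← Real.rpow_add hx0]; simp
    have h7 : c * dact Λ (fun y => y) x ≤ c * (x * Real.log x) + (E * (1 / (1 - θ)) + E * (B / (1 - θ))) * x := by
      have q1 := mul_le_mul_of_nonneg_left h5 hE
      have q2 := mul_le_mul_of_nonneg_left h6 hE
      linarith
    rw [← mul_le_mul_iff_right₀ hc]
    refine h7.trans (le_of_eq ?_)
    field_simp
  refine ⟨M * C1 * ((c + E) / (1 - σ)) + (E * (1 / (1 - θ)) + E * (B / (1 - θ))) / c + |D| * B + |D|,
    fun x hx => ?_⟩
  have hx0 : 0 < x := by linarith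
  have hlx := Real.log_nonneg hx
  have e1 := tatuzawa a μ Λ h1 h2 F x hx
  have e2 := (abs_le.1 (hLHS x hx)).2
  rw [e1] at e2
  have e3 : -(dact Λ (fun y => y) x) - |D| * ψ x ≤ dact Λ F x := by
    rw [hψdef, sub_eq_add_neg, ← neg_one_mul, ← neg_mul, ← dact_smul, ← dact_smul, ← dact_add]
    refine dact_mono _ _ _ _ hΛ fun y hy => ?_
    simp only [hF]
    have := hψ0 y
    have := neg_abs_le D
    linarith
  have e4 := hMert x hx
  have e5 : ψ x ≤ B * x := by
    rw [hψe]
    refine (hψ _).trans ?_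
    gcongr
    exact Nat.floor_le hx0.le
  have e6 : |D| * ψ x ≤ |D| * (B * x) := by gcongr
  have e7 : Real.log x * F x = ψ x * Real.log x - x * Real.log x + D * Real.log x := by
    simp only [hF]; ring
  have e8 : - (|D| * x) ≤ D * Real.log x := by
    have q1 : Real.log x ≤ x := (Real.log_le_sub_one_of_pos hx0).trans (by linarith)
    have q2 := neg_abs_le D
    have q3 := abs_nonneg D
    nlinarith
  rw [← hψe]
  linarith

end Selberg

section PrimeBound
open Ideal NumberField
open scoped Classical nonZeroDivisors

variable (K : Type*) [Field K] [NumberField K]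

/-- Ideals of norm `n`. -/
noncomputable def idFib (n : ℕ) : Finset (Ideal (𝓞 K)) :=
  (Ideal.finite_setOfPred_absNorm_le (S := 𝓞 K) n).toFinset.filter fun I => absNorm I = n

variable {K}
theorem mem_idFib {n : ℕ} {I : Ideal (𝓞 K)} : I ∈ idFib K n ↔ absNorm I = n := by
  simp only [idFib, Finset.mem_filter, Set.Finite.mem_toFinset, Set.mem_ofPred_eq]
  exact ⟨fun h => h.2, fun h => ⟨h.le, h⟩⟩

variable (K) in
/-- Push-forward of a function on ideals to an arithmetic function. -/
noncomputable def pushA (h : Ideal (𝓞 K) → ℝ) : ArithmeticFunction ℝ :=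
  ⟨fun n => if n = 0 then 0 else ∑ I ∈ idFib K n, h I, by simp⟩

theorem pushA_apply (h : Ideal (𝓞 K) → ℝ) {n : ℕ} (hn : n ≠ 0) :
    pushA K h n = ∑ I ∈ idFib K n, h I := by
  simp [pushA, hn]

/-- Divisors of an ideal. -/
noncomputable def idDiv (M : Ideal (𝓞 K)) : Finset (Ideal (𝓞 K)) :=
  (Ideal.finite_setOfPred_absNorm_le (S := 𝓞 K) (absNorm M)).toFinset.filter fun I => I ∣ M

theorem mem_idDiv {M : Ideal (𝓞 K)} (hM : M ≠ ⊥) {I : Ideal (𝓞 K)} : I ∈ idDiv M ↔ I ∣ M := by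
  simp only [idDiv, Finset.mem_filter, Set.Finite.mem_toFinset, Set.mem_ofPred_eq]
  refine ⟨fun h => h.2, fun h => ⟨?_, h⟩⟩
  refine Nat.le_of_dvd (Nat.pos_of_ne_zero ?_) (map_dvd absNorm h)
  rwa [Ne, absNorm_eq_zero_iff]

theorem pushA_mul_one (h : Ideal (𝓞 K) → ℝ) {n : ℕ} (hn : n ≠ 0) :
    (pushA K h * pushA K (fun _ => 1)) n = ∑ M ∈ idFib K n, ∑ I ∈ idDiv M, h I := by
  rw [ArithmeticFunction.mul_apply]
  have e1 : ∀ x ∈ n.divisorsAntidiagonal, pushA K h x.1 * pushA K (fun _ => 1) x.2 =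
      ∑ y ∈ idFib K x.1 ×ˢ idFib K x.2, h y.1 := by
    intro x hx
    have hx' := Nat.mem_divisorsAntidiagonal.1 hx
    have h1 : x.1 ≠ 0 := by rintro h; simp [h] at hx'; omega
    have h2 : x.2 ≠ 0 := by rintro h; simp [h] at hx'; omega
    rw [pushA_apply _ h1, pushA_apply _ h2, Finset.sum_mul_sum, Finset.sum_product]
    simp
  rw [Finset.sum_congr rfl e1, Finset.sum_sigma', Finset.sum_sigma']
  have hne : ∀ M : Ideal (𝓞 K), absNorm M = n → M ≠ ⊥ := by
    rintro M hM rfl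
    simp at hM; omega
  refine Finset.sum_bij (fun z _ => ⟨z.2.1 * z.2.2, z.2.1⟩) ?_ ?_ ?_ ?_
  · rintro ⟨⟨d, e⟩, ⟨I, J⟩⟩ hz
    simp only [Finset.mem_sigma, Nat.mem_divisorsAntidiagonal, Finset.mem_product, mem_idFib] at hz ⊢
    have hN : absNorm (I * J) = n := by rw [map_mul, hz.2.1, hz.2.2, hz.1.1]
    exact ⟨hN, (mem_idDiv (hne _ hN)).2 (dvd_mul_right _ _)⟩
  · rintro ⟨⟨d, e⟩, ⟨I, J⟩⟩ hz ⟨⟨d', e'⟩, ⟨I', J'⟩⟩ hz' heq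
    simp only [Finset.mem_sigma, Nat.mem_divisorsAntidiagonal, Finset.mem_product, mem_idFib] at hz hz'
    simp only [Sigma.mk.injEq, heq_eq_eq] at heq
    obtain ⟨h1, rfl⟩ := heq
    have hI : I ≠ ⊥ := by
      rintro rfl
      have := hz.2.1
      simp at this
      subst this
      simp at hz
      omega
    have : J = J' := mul_left_cancel₀ hI h1
    subst this
    have a1 := hz.2.1
    have a2 := hz.2.2
    have a3 := hz'.2.1
    have a4 := hz'.2.2
    subst a1 a2 a3 a4
    rfl
  · rintro ⟨M, I⟩ hz
    simp only [Finset.mem_sigma, mem_idFib] at hz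
    have hM := hne _ hz.1
    obtain ⟨J, rfl⟩ := (mem_idDiv hM).1 hz.2
    refine ⟨⟨(absNorm I, absNorm J), (I, J)⟩, ?_, rfl⟩
    simp only [Finset.mem_sigma, Nat.mem_divisorsAntidiagonal, Finset.mem_product, mem_idFib]
    refine ⟨⟨?_, hn⟩, by simp, by simp⟩
    rw [← map_mul]; exact hz.1
  · rintro ⟨⟨d, e⟩, ⟨I, J⟩⟩ hz
    rfl

/-- Moebius function on ideals. -/
noncomputable def muK (I : Ideal (𝓞 K)) : ℝ :=
  if Squarefree I then (-1) ^ Multiset.card (UniqueFactorizationMonoid.normalizedFactors I) else 0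

theorem muK_abs (I : Ideal (𝓞 K)) : |muK I| ≤ 1 := by
  unfold muK
  split_ifs <;> simp

theorem muK_prime_mul {P I : Ideal (𝓞 K)} (hP : Prime P) (hsq : Squarefree (P * I)) :
    muK (P * I) = - muK I := by
  have h0 : P * I ≠ 0 := hsq.ne_zero
  have hI : I ≠ 0 := right_ne_zero_of_mul h0
  have hI2 : Squarefree I := hsq.squarefree_of_dvd (dvd_mul_left _ _)
  unfold muK
  rw [if_pos hsq, if_pos hI2, UniqueFactorizationMonoid.normalizedFactors_mul hP.ne_zero hI,
    UniqueFactorizationMonoid.normalizedFactors_irreducible hP.irreducible]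
  simp [pow_add]

theorem muK_sum {M : Ideal (𝓞 K)} (hM : M ≠ ⊥) (hM1 : M ≠ 1) : ∑ I ∈ idDiv M, muK I = 0 := by
  obtain ⟨P, hP, hPM⟩ := WfDvdMonoid.exists_irreducible_factor
    (by rwa [Ideal.isUnit_iff, ← Ideal.one_eq_top]) hM
  have hP := hP.prime
  have e1 : ∑ I ∈ idDiv M, muK I = ∑ I ∈ (idDiv M).filter Squarefree, muK I := by
    rw [Finset.sum_filter]
    refine Finset.sum_congr rfl fun I _ => ?_
    unfold muK
    split_ifs <;> rfl
  have hadd : ∀ I : Ideal (𝓞 K), ¬ P ∣ I → Squarefree I → Squarefree (P * I) := by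
    intro I h1 h2
    refine (squarefree_mul_iff).2 ⟨?_, hP.irreducible.squarefree, h2⟩
    exact (hP.irreducible.isRelPrime_iff_not_dvd).2 h1
  have hdv : ∀ I : Ideal (𝓞 K), ¬ P ∣ I → I ∣ M → P * I ∣ M := by
    intro I h1 h2
    exact ((hP.irreducible.isRelPrime_iff_not_dvd).2 h1).mul_dvd hPM h2
  rw [e1]
  have key : ∑ I ∈ ((idDiv M).filter Squarefree).filter (fun I => P ∣ I), muK I =
      ∑ I ∈ ((idDiv M).filter Squarefree).filter (fun I => ¬ P ∣ I), - muK I := by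
    symm
    refine Finset.sum_bij (fun I _ => P * I) ?_ ?_ ?_ ?_
    · intro I hI
      simp only [Finset.mem_filter, mem_idDiv hM] at hI ⊢
      exact ⟨⟨hdv I hI.2 hI.1.1, hadd I hI.2 hI.1.2⟩, dvd_mul_right _ _⟩
    · intro I _ J _ h
      exact mul_left_cancel₀ hP.ne_zero h
    · intro J hJ
      simp only [Finset.mem_filter, mem_idDiv hM] at hJ
      obtain ⟨I, rfl⟩ := hJ.2
      refine ⟨I, ?_, rfl⟩
      simp only [Finset.mem_filter, mem_idDiv hM]
      refine ⟨⟨(dvd_mul_left _ _).trans hJ.1.1, hJ.1.2.squarefree_of_dvd (dvd_mul_left _ _)⟩, ?_⟩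
      intro h
      exact hP.not_isUnit (hJ.1.2 P (mul_dvd_mul_left P h))
    · intro I hI
      simp only [Finset.mem_filter, mem_idDiv hM] at hI
      rw [muK_prime_mul hP (hadd I hI.2 hI.1.2)]
  rw [← Finset.sum_filter_add_sum_filter_not _ (fun I => P ∣ I), key]
  simp

/-- von Mangoldt function on ideals. -/
noncomputable def lamK (I : Ideal (𝓞 K)) : ℝ :=
  if h : ∃ P : Ideal (𝓞 K), Prime P ∧ ∃ k : ℕ, 1 ≤ k ∧ I = P ^ k then
    Real.log (absNorm (Classical.choose h)) else 0

theorem prime_pow_inj {P Q : Ideal (𝓞 K)} (hP : Prime P) (hQ : Prime Q) {k l : ℕ} (hk : 1 ≤ k)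
    (h : P ^ k = Q ^ l) : P = Q := by
  have h1 : P ∣ Q ^ l := h ▸ dvd_pow_self P (by omega)
  exact associated_iff_eq.1 ((hP.dvd_prime_iff_associated hQ).1 (hP.dvd_of_dvd_pow h1))

theorem lamK_pow {P : Ideal (𝓞 K)} (hP : Prime P) {k : ℕ} (hk : 1 ≤ k) :
    lamK (P ^ k) = Real.log (absNorm P) := by
  have h : ∃ Q : Ideal (𝓞 K), Prime Q ∧ ∃ l : ℕ, 1 ≤ l ∧ P ^ k = Q ^ l := ⟨P, hP, k, hk, rfl⟩
  unfold lamK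
  rw [dif_pos h]
  obtain ⟨h1, l, h2, h3⟩ := Classical.choose_spec h
  rw [← prime_pow_inj hP h1 hk h3]

theorem lamK_nonneg (I : Ideal (𝓞 K)) : 0 ≤ lamK I := by
  unfold lamK
  split_ifs
  · exact Real.log_natCast_nonneg _
  · rfl

theorem lamK_of_not {I : Ideal (𝓞 K)}
    (h : ¬ ∃ P : Ideal (𝓞 K), Prime P ∧ ∃ k : ℕ, 1 ≤ k ∧ I = P ^ k) : lamK I = 0 := by
  unfold lamK
  rw [dif_neg h]

theorem lamK_sum {M : Ideal (𝓞 K)} (hM : M ≠ ⊥) :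
    ∑ I ∈ idDiv M, lamK I = Real.log (absNorm M) := by
  induction M using UniqueFactorizationMonoid.induction_on_prime with
  | h₁ => exact absurd rfl hM
  | h₂ M hu =>
    rw [Ideal.isUnit_iff] at hu
    subst hu
    simp only [absNorm_top, Nat.cast_one, Real.log_one]
    refine Finset.sum_eq_zero fun I hI => lamK_of_not ?_
    rintro ⟨P, hP, k, hk, rfl⟩
    rw [mem_idDiv hM, ← Ideal.one_eq_top] at hI
    exact hP.not_isUnit (isUnit_of_dvd_one ((dvd_pow_self P (by omega)).trans hI))
  | h₃ M P hM0 hP ih =>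
    have ih := ih hM0
    rw [map_mul, Nat.cast_mul, Real.log_mul
      (by rw [Nat.cast_ne_zero, Ne, absNorm_eq_zero_iff]; exact hP.ne_zero)
      (by rw [Nat.cast_ne_zero, Ne, absNorm_eq_zero_iff]; exact hM0), ← ih]
    have hfm : FiniteMultiplicity P M := FiniteMultiplicity.of_prime_left hP hM0
    set v := multiplicity P M with hv
    have h1 : P ^ v ∣ M := pow_multiplicity_dvd P M
    have h2 : ¬ P ^ (v + 1) ∣ M := hfm.not_pow_dvd_of_multiplicity_lt (by omega)
    have h3 : ¬ P ^ (v + 1) ∈ idDiv M := by rwa [mem_idDiv hM0]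
    rw [← lamK_pow hP (Nat.le_add_left 1 v), ← Finset.sum_insert h3]
    symm
    refine Finset.sum_subset ?_ ?_
    · intro I hI
      rw [Finset.mem_insert, mem_idDiv hM0] at hI
      rw [mem_idDiv hM]
      rcases hI with rfl | hI
      · rw [pow_succ']; exact mul_dvd_mul_left _ h1
      · exact hI.mul_left _
    · intro I hI hI2
      rw [Finset.mem_insert, mem_idDiv hM0, not_or] at hI2
      rw [mem_idDiv hM] at hI
      refine lamK_of_not ?_
      rintro ⟨Q, hQ, k, hk, rfl⟩
      by_cases hQP : Q = P
      · subst hQP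
        obtain ⟨k, rfl⟩ : ∃ j, k = j + 1 := ⟨k - 1, by omega⟩
        rw [pow_succ'] at hI
        have h4 := (mul_dvd_mul_iff_left hQ.ne_zero).1 hI
        have h5 : k ≤ v := by
          by_contra hcon
          exact h2 ((pow_dvd_pow Q (by omega)).trans h4)
        have h6 : k ≠ v := by rintro rfl; exact hI2.1 rfl
        exact hI2.2 ((pow_dvd_pow Q (by omega)).trans h1)
      · apply hI2.2
        refine IsRelPrime.dvd_of_dvd_mul_left ?_ hI
        refine IsRelPrime.pow_left ?_
        rw [hQ.irreducible.isRelPrime_iff_not_dvd]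
        intro h
        exact hQP (associated_iff_eq.1 ((hQ.dvd_prime_iff_associated hP).1 h))

end PrimeBound

section PrimeBound2
open Ideal NumberField
open scoped Classical nonZeroDivisors

variable {K : Type*} [Field K] [NumberField K]

theorem prime_norm_pow {P : Ideal (𝓞 K)} (hP : Prime P) : ∃ p f : ℕ, p.Prime ∧ 1 ≤ f ∧
    absNorm P = p ^ f ∧ P ∣ span {(p : 𝓞 K)} := by
  have hPp : P.IsPrime := Ideal.isPrime_of_prime hP
  have hN0 : absNorm P ≠ 0 := by rw [Ne, absNorm_eq_zero_iff]; exact hP.ne_zero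
  have hN1 : absNorm P ≠ 1 := by
    rw [Ne, absNorm_eq_one_iff]; exact hPp.ne_top
  have h1 : ((absNorm P : ℕ) : 𝓞 K) ∈ P := absNorm_mem P
  have h2 : ∃ p : ℕ, p.Prime ∧ (p : 𝓞 K) ∈ P := by
    have : ∀ n : ℕ, n ≠ 0 → (n : 𝓞 K) ∈ P → ∃ p : ℕ, p.Prime ∧ (p : 𝓞 K) ∈ P := by
      intro n
      induction n using Nat.recOnMul with
      | zero => simp
      | one => intro _ h; exact absurd ((Ideal.eq_top_iff_one P).2 (by simpa using h)) hPp.ne_top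
      | prime p hp => intro _ h; exact ⟨p, hp, h⟩
      | mul a b iha ihb =>
        intro h0 h
        push_cast at h
        rcases hPp.mem_or_mem h with h | h
        · exact iha (left_ne_zero_of_mul h0) h
        · exact ihb (right_ne_zero_of_mul h0) h
    exact this _ hN0 h1
  obtain ⟨p, hp, hpP⟩ := h2
  have h3 : P ∣ span {(p : 𝓞 K)} := by
    rw [Ideal.dvd_iff_le, span_singleton_le_iff_mem]; exact hpP
  have h4 := map_dvd absNorm h3
  rw [absNorm_span_natCast] at h4
  obtain ⟨f, hf, hf2⟩ := (Nat.dvd_prime_pow hp).1 h4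
  refine ⟨p, f, hp, ?_, hf2, h3⟩
  by_contra hcon
  have : f = 0 := by omega
  subst this
  exact hN1 (by simpa using hf2)

theorem pushA_lam_le (n : ℕ) : pushA K lamK n ≤
    (Module.finrank ℤ (𝓞 K) : ℝ) * ArithmeticFunction.vonMangoldt n := by
  by_cases hn : n = 0
  · subst hn; simp
  rw [pushA_apply _ hn]
  set T := (idFib K n).filter (fun I => ∃ P : Ideal (𝓞 K), Prime P ∧ ∃ k : ℕ, 1 ≤ k ∧ I = P ^ k) with hT
  have e1 : ∑ I ∈ idFib K n, lamK I = ∑ I ∈ T, lamK I := by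
    rw [hT, Finset.sum_filter]
    refine Finset.sum_congr rfl fun I _ => ?_
    split_ifs with h
    · rfl
    · exact lamK_of_not h
  rw [e1]
  by_cases hne : T.Nonempty
  swap
  · rw [Finset.not_nonempty_iff_eq_empty.1 hne]
    simp only [Finset.sum_empty]
    have := ArithmeticFunction.vonMangoldt_nonneg (n := n)
    positivity
  obtain ⟨I0, hI0⟩ := hne
  have hTm : ∀ I ∈ T, absNorm I = n ∧ ∃ P : Ideal (𝓞 K), Prime P ∧ ∃ k : ℕ, 1 ≤ k ∧ I = P ^ k := by
    intro I hI
    rw [hT, Finset.mem_filter, mem_idFib] at hI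
    exact hI
  -- n = p^m
  obtain ⟨p, m, hp, hm, hnp⟩ : ∃ p m : ℕ, p.Prime ∧ 1 ≤ m ∧ n = p ^ m := by
    obtain ⟨h1, P, hP, k, hk, rfl⟩ := hTm I0 hI0
    obtain ⟨p, f, hp, hf, h2, -⟩ := prime_norm_pow hP
    refine ⟨p, f * k, hp, Nat.mul_pos hf hk, ?_⟩
    rw [← h1, map_pow, h2, pow_mul]
  have hvm : ArithmeticFunction.vonMangoldt n = Real.log p := by
    rw [hnp, ArithmeticFunction.vonMangoldt_apply_pow (by omega),
      ArithmeticFunction.vonMangoldt_apply_prime hp]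
  have hsp : span {(p : 𝓞 K)} ≠ ⊥ := by
    rw [Ne, span_singleton_eq_bot, Nat.cast_eq_zero]; exact hp.ne_zero
  have key := lamK_sum hsp
  rw [absNorm_span_natCast] at key
  push_cast at key
  rw [Real.log_pow] at key
  rw [hvm, ← key]
  choose! Pf hPf kf hkf hIf using fun I hI => (hTm I hI).2
  have inj : Set.InjOn Pf T := by
    intro I hI J hJ h
    have a1 := (hTm I hI).1
    have a2 := (hTm J hJ).1
    have hPn : 2 ≤ absNorm (Pf I) := by
      obtain ⟨q, f, hq, hf, h2, -⟩ := prime_norm_pow (hPf I hI)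
      rw [h2]; exact hq.two_le.trans (Nat.le_self_pow (by omega) _)
    rw [hIf I hI, map_pow] at a1
    rw [hIf J hJ, map_pow, ← h, ← a1] at a2
    have := Nat.pow_right_injective hPn a2
    rw [hIf I hI, hIf J hJ, h, this]
  calc ∑ I ∈ T, lamK I = ∑ I ∈ T, lamK (Pf I) := by
        refine Finset.sum_congr rfl fun I hI => ?_
        conv_lhs => rw [hIf I hI]
        rw [lamK_pow (hPf I hI) (hkf I hI), ← lamK_pow (hPf I hI) le_rfl, pow_one]
    _ = ∑ Q ∈ T.image Pf, lamK Q := by rw [Finset.sum_image inj]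
    _ ≤ _ := by
        refine Finset.sum_le_sum_of_subset_of_nonneg ?_ fun I _ _ => lamK_nonneg I
        intro Q hQ
        obtain ⟨I, hI, rfl⟩ := Finset.mem_image.1 hQ
        rw [mem_idDiv hsp]
        obtain ⟨q, f, hq, hf, h2, h3⟩ := prime_norm_pow (hPf I hI)
        have a1 := (hTm I hI).1
        rw [hIf I hI, map_pow, h2, hnp, ← pow_mul] at a1
        have : q = p := by
          have h4 : q ∣ p ^ m := a1 ▸ dvd_pow_self q (by have := hkf I hI; positivity)
          exact (Nat.prime_dvd_prime_iff_eq hq hp).1 (hq.dvd_of_dvd_pow h4)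
        rwa [this] at h3

/-- ideals of norm between 1 and N -/
noncomputable def idLe (K : Type*) [Field K] [NumberField K] (N : ℕ) : Finset (Ideal (𝓞 K)) :=
  (Ideal.finite_setOfPred_absNorm_le (S := 𝓞 K) N).toFinset.filter fun I => I ≠ ⊥

theorem mem_idLe {N : ℕ} {I : Ideal (𝓞 K)} : I ∈ idLe K N ↔ absNorm I ≤ N ∧ I ≠ ⊥ := by
  simp only [idLe, Finset.mem_filter, Set.Finite.mem_toFinset, Set.mem_ofPred_eq]

theorem pushA_sum (h : Ideal (𝓞 K) → ℝ) (N : ℕ) :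
    ∑ n ∈ Finset.Ioc 0 N, pushA K h n = ∑ I ∈ idLe K N, h I := by
  have e1 : ∀ n ∈ Finset.Ioc 0 N, pushA K h n = ∑ I ∈ (idLe K N).filter (fun I => absNorm I = n), h I := by
    intro n hn
    rw [Finset.mem_Ioc] at hn
    rw [pushA_apply _ (by omega)]
    refine Finset.sum_congr ?_ fun _ _ => rfl
    ext I
    rw [mem_idFib, Finset.mem_filter, mem_idLe]
    refine ⟨fun h => ⟨⟨by omega, ?_⟩, h⟩, fun h => h.2⟩
    rintro rfl
    simp at h; omega
  rw [Finset.sum_congr rfl e1]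
  refine Finset.sum_fiberwise_of_maps_to ?_ _
  intro I hI
  rw [mem_idLe] at hI
  rw [Finset.mem_Ioc]
  refine ⟨Nat.pos_of_ne_zero ?_, hI.1⟩
  rw [Ne, absNorm_eq_zero_iff]; exact hI.2

theorem idLe_card (x : ℝ) (hx : 0 ≤ x) : ((idLe K ⌊x⌋₊).card : ℝ) =
    (Nat.card {I : (Ideal (𝓞 K))⁰ // absNorm (I : Ideal (𝓞 K)) ≤ x} : ℝ) := by
  congr 1
  rw [← Fintype.card_coe, ← Nat.card_eq_fintype_card]
  refine Nat.card_congr ⟨fun I => ⟨⟨I.1, mem_nonZeroDivisors_of_ne_zero (mem_idLe.1 I.2).2⟩, ?_⟩,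
    fun I => ⟨I.1.1, mem_idLe.2 ⟨Nat.le_floor I.2, nonZeroDivisors.ne_zero I.1.2⟩⟩, fun _ => rfl, fun _ => rfl⟩
  exact (Nat.le_floor_iff hx).1 (mem_idLe.1 I.2).1

theorem psiK_bound : ∃ C : ℝ, ∀ x : ℝ, 1 ≤ x →
    (∑ I ∈ idLe K ⌊x⌋₊, lamK I) * Real.log x ≤ 2 * x * Real.log x + C * x := by
  obtain ⟨v, D, θ, hv, hD, hθ, hθ1, hcount⟩ := ideal_count K
  have h1 : pushA K muK * pushA K (fun _ => 1) = 1 := by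
    ext n
    by_cases hn : n = 0
    · subst hn; simp
    rw [pushA_mul_one _ hn]
    by_cases hn1 : n = 1
    · subst hn1
      have : idFib K 1 = {⊤} := by
        ext I; rw [mem_idFib, absNorm_eq_one_iff, Finset.mem_singleton]
      rw [this, Finset.sum_singleton]
      have h2 : idDiv (⊤ : Ideal (𝓞 K)) = {⊤} := by
        ext I
        rw [mem_idDiv top_ne_bot, Finset.mem_singleton, ← Ideal.one_eq_top, ← isUnit_iff_dvd_one,
          Ideal.isUnit_iff, Ideal.one_eq_top]
      rw [h2, Finset.sum_singleton, ← Ideal.one_eq_top]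
      unfold muK
      rw [if_pos squarefree_one, UniqueFactorizationMonoid.normalizedFactors_one]
      simp
    · rw [ArithmeticFunction.one_apply_ne hn1]
      refine Finset.sum_eq_zero fun M hM => ?_
      rw [mem_idFib] at hM
      refine muK_sum ?_ ?_
      · rintro rfl; simp at hM; omega
      · rintro rfl; simp at hM; omega
  have h2 : pushA K lamK * pushA K (fun _ => 1) = (pushA K (fun _ => 1)).pmul ArithmeticFunction.log := by
    ext n
    by_cases hn : n = 0
    · subst hn; simp
    rw [pushA_mul_one _ hn, ArithmeticFunction.pmul_apply, pushA_apply _ hn, Finset.sum_mul]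
    refine Finset.sum_congr rfl fun M hM => ?_
    rw [mem_idFib] at hM
    rw [lamK_sum, hM, one_mul, ArithmeticFunction.log_apply]
    rintro rfl; simp at hM; omega
  have hμ : ∀ n, |pushA K muK n| ≤ pushA K (fun _ => 1) n := by
    intro n
    by_cases hn : n = 0
    · subst hn; simp
    rw [pushA_apply _ hn, pushA_apply _ hn]
    exact (Finset.abs_sum_le_sum_abs _ _).trans (Finset.sum_le_sum fun I _ => muK_abs I)
  have hΛ : ∀ n, 0 ≤ pushA K lamK n := by
    intro n
    by_cases hn : n = 0
    · subst hn; simp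
    rw [pushA_apply _ hn]
    exact Finset.sum_nonneg fun I _ => lamK_nonneg I
  have hlog4 : 0 ≤ Real.log 4 := Real.log_nonneg (by norm_num)
  obtain ⟨C, hC⟩ := selberg_bound (pushA K fun _ => 1) (pushA K muK) (pushA K lamK) h1 h2 hμ hΛ v D θ
    ((Module.finrank ℤ (𝓞 K) : ℝ) * (Real.log 4 + 4)) hv hD hθ hθ1 (by positivity)
    (fun x hx => by
      rw [pushA_sum]
      simp only [Finset.sum_const, nsmul_eq_mul, mul_one]
      rw [idLe_card x (by linarith)]
      exact hcount x hx)
    (fun N => by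
      have := Chebyshev.psi_le_const_mul_self (x := N) (Nat.cast_nonneg N)
      rw [mul_assoc]
      refine le_trans ?_ (mul_le_mul_of_nonneg_left this (Nat.cast_nonneg _))
      rw [Chebyshev.psi, Nat.floor_natCast, Finset.mul_sum]
      exact Finset.sum_le_sum fun n _ => pushA_lam_le n)
  exact ⟨C, fun x hx => by rw [← pushA_sum]; exact hC x hx⟩

/-- Brun–Titchmarsh-type bound for prime ideals with absolute constant. -/
theorem prime_ideal_bound (K : Type*) [Field K] [NumberField K] : ∀ᶠ x : ℝ in atTop,
    (((idLe K ⌊x⌋₊).filter Prime).card : ℝ) ≤ 7 * x / Real.log x := by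
  obtain ⟨C, hC⟩ := psiK_bound (K := K)
  obtain ⟨v, D, θ, hv, hD, hθ, hθ1, hcount⟩ := ideal_count K
  have hcK : ∀ x : ℝ, 1 ≤ x → ((idLe K ⌊x⌋₊).card : ℝ) ≤ (v + D) * x := by
    intro x hx
    rw [idLe_card x (by linarith)]
    have := (abs_le.1 (hcount x hx)).2
    have h2 : x ^ θ ≤ x := by
      conv_rhs => rw [← Real.rpow_one x]
      exact Real.rpow_le_rpow_of_exponent_le hx hθ1.le
    nlinarith
  have t1 : Tendsto Real.log atTop atTop := Real.tendsto_log_atTop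
  have t2 : Tendsto (fun x : ℝ => Real.log x / x ^ (1/2:ℝ)) atTop (nhds 0) :=
    (isLittleO_log_rpow_atTop (by norm_num)).tendsto_div_nhds_zero
  have hvD : 0 < v + D := by linarith
  filter_upwards [eventually_ge_atTop 2, t1.eventually_ge_atTop (2 * C),
    t2.eventually_le_const (u := 1 / (v + D)) (by positivity)] with x hx hlx hrx
  have hx0 : 0 < x := by linarith
  have hl : 0 < Real.log x := Real.log_pos (by linarith)
  rw [← Real.sqrt_eq_rpow] at hrx
  have hs0 : 0 < √x := Real.sqrt_pos.2 hx0
  have hs1 : 1 ≤ √x := Real.one_le_sqrt.2 (by linarith)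
  set T := (idLe K ⌊x⌋₊).filter Prime with hT
  have hsplit : (T.card : ℝ) ≤ (idLe K ⌊√x⌋₊).card + ((T.filter fun P => ⌊√x⌋₊ < absNorm P).card : ℝ) := by
    rw [← Finset.card_filter_add_card_filter_not (s := T) (fun P => ⌊√x⌋₊ < absNorm P)]
    push_cast
    rw [add_comm]
    gcongr
    intro P hP
    rw [Finset.mem_filter, hT, Finset.mem_filter, mem_idLe] at hP
    rw [mem_idLe]
    exact ⟨by omega, hP.1.1.2⟩
  have hbig : ((T.filter fun P => ⌊√x⌋₊ < absNorm P).card : ℝ) * (Real.log x / 2) ≤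
      ∑ I ∈ idLe K ⌊x⌋₊, lamK I := by
    calc _ = ∑ P ∈ T.filter (fun P => ⌊√x⌋₊ < absNorm P), Real.log x / 2 := by
          rw [Finset.sum_const, nsmul_eq_mul]
      _ ≤ ∑ P ∈ T.filter (fun P => ⌊√x⌋₊ < absNorm P), lamK P := by
          refine Finset.sum_le_sum fun P hP => ?_
          rw [Finset.mem_filter, hT, Finset.mem_filter] at hP
          rw [← pow_one P, lamK_pow hP.1.2 le_rfl, ← Real.log_sqrt hx0.le]
          refine Real.log_le_log hs0 ?_
          exact ((Nat.floor_lt hs0.le).1 hP.2).le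
      _ ≤ _ := Finset.sum_le_sum_of_subset_of_nonneg
          ((Finset.filter_subset _ _).trans (Finset.filter_subset _ _)) fun I _ _ => lamK_nonneg I
  have h1 := hC x (by linarith)
  have h2 := hcK (√x) hs1
  have h3 : Real.log x * (v + D) ≤ √x := by
    rw [div_le_div_iff₀ hs0 hvD] at hrx; linarith
  have h4 : (v + D) * √x * Real.log x ≤ x := by
    calc _ = (Real.log x * (v + D)) * √x := by ring
      _ ≤ √x * √x := by gcongr
      _ = x := Real.mul_self_sqrt hx0.le
  rw [le_div_iff₀ hl]
  set A := ((T.filter fun P => ⌊√x⌋₊ < absNorm P).card : ℝ)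
  set Ψ := ∑ I ∈ idLe K ⌊x⌋₊, lamK I
  have h5 : Ψ ≤ 2.5 * x := by
    have : Ψ * Real.log x ≤ 2.5 * x * Real.log x := by nlinarith
    exact le_of_mul_le_mul_right this hl
  have h6 : (idLe K ⌊√x⌋₊).card * Real.log x ≤ (v + D) * √x * Real.log x := by gcongr
  nlinarith

end PrimeBound2

section FrobLocal
open Ideal NumberField
open scoped Classical Pointwise

variable {K : Type*} [Field K] [NumberField K] [IsGalois ℚ K]

theorem stab_fix_root (R : Finset (𝓞 K)) (hR : ∀ σ : Gal(K/ℚ), ∀ β ∈ R, σ • β ∈ R)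
    (F : ℤ[X]) (hF : F.map (algebraMap ℤ (𝓞 K)) = ∏ β ∈ R, (X - C β))
    (p : ℕ) (hroot : ∃ n : ℤ, (p : ℤ) ∣ F.eval n) (P : Ideal (𝓞 K)) (hP : P.IsPrime)
    (hpP : (p : 𝓞 K) ∈ P) (hdist : ∀ β ∈ R, ∀ β' ∈ R, β - β' ∈ P → β = β') :
    ∃ β ∈ R, ∀ σ ∈ MulAction.stabilizer Gal(K/ℚ) P, σ • β = β := by
  obtain ⟨n, c, hn⟩ := hroot
  have h1 : ∏ β ∈ R, ((n : 𝓞 K) - β) = (p : 𝓞 K) * (c : 𝓞 K) := by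
    have := congrArg (Polynomial.eval (n : 𝓞 K)) hF
    rw [Polynomial.eval_prod] at this
    simp only [eval_sub, eval_X, eval_C] at this
    rw [← this]
    have h2 := Polynomial.eval_intCast_map (algebraMap ℤ (𝓞 K)) F n
    rw [h2, Int.cast_id, hn]
    simp
  have h2 : ∏ β ∈ R, ((n : 𝓞 K) - β) ∈ P := by rw [h1]; exact P.mul_mem_right _ hpP
  obtain ⟨β, hβ, hβP⟩ := hP.prod_mem_iff.1 h2
  refine ⟨β, hβ, fun σ hσ => ?_⟩
  have h3 : σ • ((n : 𝓞 K) - β) ∈ σ • P := Ideal.smul_mem_pointwise_smul _ _ _ hβP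
  rw [MulAction.mem_stabilizer_iff.1 hσ, smul_sub] at h3
  have h4 : σ • (n : 𝓞 K) = n := map_intCast (MulSemiringAction.toRingHom Gal(K/ℚ) (𝓞 K) σ) n
  rw [h4] at h3
  refine hdist _ (hR σ β hβ) _ hβ ?_
  have := P.sub_mem hβP h3
  simpa using this

theorem stab_cyclic (R : Finset (𝓞 K)) (hR : ∀ σ : Gal(K/ℚ), ∀ β ∈ R, σ • β ∈ R)
    (hgen : ∀ σ : Gal(K/ℚ), (∀ β ∈ R, σ • β = β) → σ = 1)
    (P : Ideal (𝓞 K)) (hP : P.IsPrime) (hP0 : P ≠ ⊥)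
    (hdist : ∀ β ∈ R, ∀ β' ∈ R, β - β' ∈ P → β = β') :
    IsCyclic (MulAction.stabilizer Gal(K/ℚ) P) := by
  have hPm : P.IsMaximal := hP.isMaximal hP0
  have hpm : (P.under ℤ).IsMaximal := inferInstance
  letI := Ideal.Quotient.field (P.under ℤ)
  letI := Ideal.Quotient.field P
  haveI : Finite (𝓞 K ⧸ P) := Ideal.finiteQuotientOfFreeOfNeBot P hP0
  refine isCyclic_of_injective (Ideal.Quotient.stabilizerHom P (P.under ℤ) Gal(K/ℚ)) ?_
  rw [injective_iff_map_eq_one]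
  rintro ⟨σ, hσ⟩ h
  have hσ1 : σ = 1 := by
    refine hgen σ fun β hβ => hdist _ (hR σ β hβ) _ hβ ?_
    have h2 := congrArg (fun (e : (𝓞 K ⧸ P) ≃ₐ[ℤ ⧸ P.under ℤ] (𝓞 K ⧸ P)) => e (Ideal.Quotient.mk P β)) h
    simp only [AlgEquiv.one_apply] at h2
    rw [← Ideal.Quotient.eq]
    rw [← h2]
    rfl
  subst hσ1
  rfl

/-- The fixed field of a cyclic subgroup. -/
abbrev fixF (τ : Gal(K/ℚ)) : IntermediateField ℚ K :=
  IntermediateField.fixedField (Subgroup.zpowers τ)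

theorem smul_algebraMap_fixF (τ : Gal(K/ℚ)) (σ : Gal(K/ℚ)) (hσ : σ ∈ Subgroup.zpowers τ)
    (x : 𝓞 (fixF τ)) : σ • (algebraMap (𝓞 (fixF τ)) (𝓞 K) x) = algebraMap (𝓞 (fixF τ)) (𝓞 K) x := by
  apply NumberField.RingOfIntegers.ext
  have h := (IntermediateField.mem_fixedField_iff (Subgroup.zpowers τ) ((x : fixF τ) : K)).1
    (x : fixF τ).2 σ hσ
  exact h

theorem fixF_norm (τ : Gal(K/ℚ)) (p : ℕ) (hp : p.Prime)
    (P : Ideal (𝓞 K)) (hP : P.IsPrime) (hpP : (p : 𝓞 K) ∈ P)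
    (hτ : Subgroup.zpowers τ = MulAction.stabilizer Gal(K/ℚ) P) :
    absNorm (P.under (𝓞 (fixF τ))) = p := by
  have hP0 : P ≠ ⊥ := by
    rintro rfl
    rw [Ideal.mem_bot, Nat.cast_eq_zero] at hpP
    exact hp.ne_zero hpP
  have hPm : P.IsMaximal := hP.isMaximal hP0
  have hpm : (P.under ℤ).IsMaximal := inferInstance
  letI := Ideal.Quotient.field (P.under ℤ)
  letI := Ideal.Quotient.field P
  haveI : Finite (𝓞 K ⧸ P) := Ideal.finiteQuotientOfFreeOfNeBot P hP0
  set q := P.under (𝓞 (fixF τ)) with hq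
  have hsurj : Function.Surjective (Int.castRingHom (𝓞 (fixF τ) ⧸ q)) := by
    intro y
    obtain ⟨x, rfl⟩ := Ideal.Quotient.mk_surjective y
    set z : 𝓞 K ⧸ P := Ideal.Quotient.mk P (algebraMap (𝓞 (fixF τ)) (𝓞 K) x) with hz
    have hfix : ∀ e : (𝓞 K ⧸ P) ≃ₐ[ℤ ⧸ P.under ℤ] (𝓞 K ⧸ P), e z = z := by
      intro e
      obtain ⟨⟨σ, hσ⟩, rfl⟩ := Ideal.Quotient.stabilizerHom_surjective Gal(K/ℚ) (P.under ℤ) P e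
      have h1 : σ ∈ Subgroup.zpowers τ := by rw [hτ]; exact hσ
      have h2 := smul_algebraMap_fixF τ σ h1 x
      rw [hz]
      conv_rhs => rw [← h2]
      rfl
    have hz2 : z ∈ Set.range (algebraMap (ℤ ⧸ P.under ℤ) (𝓞 K ⧸ P)) := by
      haveI : IsGalois (ℤ ⧸ P.under ℤ) (𝓞 K ⧸ P) := inferInstance
      exact (IsGalois.mem_range_algebraMap_iff_fixed z).2 hfix
    obtain ⟨w, hw⟩ := hz2
    obtain ⟨n, rfl⟩ := Ideal.Quotient.mk_surjective w
    refine ⟨n, ?_⟩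
    have h3 : (Ideal.Quotient.mk P (n : 𝓞 K)) = z := by
      rw [← hw]; rfl
    rw [hz, Ideal.Quotient.eq] at h3
    have : (Int.castRingHom (𝓞 (fixF τ) ⧸ q)) n = Ideal.Quotient.mk q (n : 𝓞 (fixF τ)) := by simp
    rw [this, Ideal.Quotient.eq, hq, Ideal.under, Ideal.mem_comap]
    simpa using h3
  have hpq : (p : 𝓞 (fixF τ)) ∈ q := by
    rw [hq, Ideal.under, Ideal.mem_comap]; simpa using hpP
  have hq1 : q ≠ ⊤ := by
    rw [hq, Ideal.under]
    exact Ideal.comap_ne_top _ hP.ne_top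
  have hker : (p : ℤ) ∈ RingHom.ker (Int.castRingHom (𝓞 (fixF τ) ⧸ q)) := by
    rw [RingHom.mem_ker]
    have : (Int.castRingHom (𝓞 (fixF τ) ⧸ q)) p = Ideal.Quotient.mk q (p : 𝓞 (fixF τ)) := by simp
    rw [this, Ideal.Quotient.eq_zero_iff_mem]; exact hpq
  have hcard : absNorm q = Nat.card (𝓞 (fixF τ) ⧸ q) := rfl
  haveI : Fact p.Prime := ⟨hp⟩
  haveI : Nontrivial (𝓞 (fixF τ) ⧸ q) := Ideal.Quotient.nontrivial_iff.2 hq1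
  haveI : CharP (𝓞 (fixF τ) ⧸ q) p := by
    have h0 : ((p : ℕ) : 𝓞 (fixF τ) ⧸ q) = 0 := by
      have := RingHom.mem_ker.1 hker
      simpa using this
    obtain ⟨c, hc⟩ := CharP.exists (𝓞 (fixF τ) ⧸ q)
    have h1 := (CharP.cast_eq_zero_iff (𝓞 (fixF τ) ⧸ q) c p).1 h0
    rcases (Nat.dvd_prime hp).1 h1 with h2 | h2
    · subst h2; exact absurd rfl (CharP.char_ne_one (𝓞 (fixF τ) ⧸ q) 1)
    · rwa [← h2]
  have hsurj2 : Function.Surjective (ZMod.castHom (dvd_refl p) (𝓞 (fixF τ) ⧸ q)) := by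
    intro y
    obtain ⟨n, rfl⟩ := hsurj y
    exact ⟨n, by simp⟩
  have hinj : Function.Injective (ZMod.castHom (dvd_refl p) (𝓞 (fixF τ) ⧸ q)) :=
    RingHom.injective _
  rw [hcard, ← Nat.card_congr (Equiv.ofBijective _ ⟨hinj, hsurj2⟩)]
  simp

theorem fixF_inj (τ : Gal(K/ℚ)) (P P' : Ideal (𝓞 K)) (hP : P.IsPrime) (hP' : P'.IsPrime)
    (hτ : Subgroup.zpowers τ = MulAction.stabilizer Gal(K/ℚ) P)
    (h : P.under (𝓞 (fixF τ)) = P'.under (𝓞 (fixF τ))) : P' = P := by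
  haveI : SMulCommClass (Subgroup.zpowers τ) (𝓞 (fixF τ)) (𝓞 K) := by
    constructor
    rintro ⟨σ, hσ⟩ a b
    rw [Algebra.smul_def, Algebra.smul_def, Subgroup.smul_def, Subgroup.smul_def, smul_mul']
    simp only
    rw [smul_algebraMap_fixF τ σ hσ a]
  haveI : Algebra.IsInvariant (𝓞 (fixF τ)) (𝓞 K) (Subgroup.zpowers τ) := by
    constructor
    intro b hb
    have hb2 : (b : K) ∈ fixF τ := by
      rw [IntermediateField.mem_fixedField_iff]
      intro σ hσ
      have := hb ⟨σ, hσ⟩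
      exact congrArg (fun y : 𝓞 K => (y : K)) this
    have hint : IsIntegral ℤ (⟨(b : K), hb2⟩ : fixF τ) := by
      rw [← isIntegral_algebraMap_iff (FaithfulSMul.algebraMap_injective (fixF τ) K)]
      exact b.2
    refine ⟨⟨⟨(b : K), hb2⟩, hint⟩, ?_⟩
    apply NumberField.RingOfIntegers.ext
    rfl
  obtain ⟨⟨σ, hσ⟩, h2⟩ := Algebra.IsInvariant.exists_smul_of_under_eq (𝓞 (fixF τ)) (𝓞 K)
    (Subgroup.zpowers τ) P P' h
  rw [h2]
  rw [hτ] at hσ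
  exact MulAction.mem_stabilizer_iff.1 hσ

end FrobLocal

section FrobCount
open Ideal NumberField
open scoped Classical Pointwise

theorem cyclic_gens_two {G : Type*} [Group G] [Fintype G] (hG : IsPGroup 2 G) (H : Subgroup G)
    (hH : IsCyclic H) : Nat.card H ≤ 2 * (Finset.univ.filter fun τ : G => Subgroup.zpowers τ = H).card := by
  obtain ⟨n, hn⟩ := IsPGroup.iff_card.1 (hG.to_subgroup H)
  have h1 := IsCyclic.card_orderOf_eq_totient (α := H) (d := Fintype.card H) dvd_rfl
  have h2 : Nat.card H = Fintype.card H := Nat.card_eq_fintype_card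
  have h3 : Fintype.card H ≤ 2 * (Fintype.card H).totient := by
    rw [← h2, hn]
    rcases Nat.eq_zero_or_pos n with rfl | hn0
    · simp
    · obtain ⟨m, rfl⟩ : ∃ m, n = m + 1 := ⟨n - 1, by omega⟩
      rw [Nat.totient_prime_pow_succ Nat.prime_two, pow_succ]
      simp [mul_comm]
  rw [h2]
  refine h3.trans (Nat.mul_le_mul_left 2 ?_)
  rw [← h1]
  refine Finset.card_le_card_of_injOn (fun a => (a : G)) ?_ ?_
  · intro a ha
    simp only [Finset.coe_filter, Finset.mem_univ, true_and, Set.mem_ofPred_eq] at ha ⊢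
    refine Subgroup.eq_of_le_of_card_ge ?_ ?_
    · rw [Subgroup.zpowers_le]; exact a.2
    · rw [Nat.card_zpowers, Subgroup.orderOf_coe, ha, h2]
  · intro a _ b _ h
    exact Subtype.ext h

variable {K : Type*} [Field K] [NumberField K] [IsGalois ℚ K]

/-- primes of K above p -/
noncomputable def above (K : Type*) [Field K] [NumberField K] (p : ℕ) : Finset (Ideal (𝓞 K)) :=
  (idDiv (span {(p : 𝓞 K)})).filter Prime

theorem mem_above {p : ℕ} (hp : p.Prime) {P : Ideal (𝓞 K)} :
    P ∈ above K p ↔ P.IsPrime ∧ (p : 𝓞 K) ∈ P := by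
  have hsp : span {(p : 𝓞 K)} ≠ ⊥ := by
    rw [Ne, span_singleton_eq_bot, Nat.cast_eq_zero]; exact hp.ne_zero
  rw [above, Finset.mem_filter, mem_idDiv hsp, Ideal.dvd_iff_le, span_singleton_le_iff_mem]
  refine ⟨fun h => ⟨Ideal.isPrime_of_prime h.2, h.1⟩, fun h => ⟨h.2, ?_⟩⟩
  refine Ideal.prime_of_isPrime ?_ h.1
  rintro rfl
  rw [Ideal.mem_bot, Nat.cast_eq_zero] at h
  exact hp.ne_zero h.2

theorem above_inter {p q : ℕ} (hp : p.Prime) (hq : q.Prime) {P : Ideal (𝓞 K)} (h1 : P ∈ above K p)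
    (h2 : P ∈ above K q) : p = q := by
  rw [mem_above hp] at h1
  rw [mem_above hq] at h2
  by_contra hne
  have hc : IsCoprime (p : ℤ) (q : ℤ) := by
    rw [Nat.isCoprime_iff_coprime]; exact (Nat.coprime_primes hp hq).2 hne
  obtain ⟨a, b, hab⟩ := hc
  refine h1.1.ne_top ((Ideal.eq_top_iff_one P).2 ?_)
  have := congrArg (Int.cast : ℤ → 𝓞 K) hab
  push_cast at this
  rw [← this]
  exact P.add_mem (P.mul_mem_left _ h1.2) (P.mul_mem_left _ h2.2)

theorem above_under {p : ℕ} (hp : p.Prime) {P : Ideal (𝓞 K)} (h : P ∈ above K p) :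
    P.under ℤ = span {(p : ℤ)} := by
  rw [mem_above hp] at h
  haveI := h.1
  have hm : (span {(p : ℤ)}).IsMaximal :=
    PrincipalIdealRing.isMaximal_of_irreducible (Nat.prime_iff_prime_int.1 hp).irreducible
  refine (hm.eq_of_le ?_ ?_).symm
  · exact Ideal.IsPrime.ne_top inferInstance
  · rw [span_singleton_le_iff_mem, Ideal.under, Ideal.mem_comap]
    simpa using h.2

theorem above_nonempty {p : ℕ} (hp : p.Prime) : (above K p).Nonempty := by
  have hsp : span {(p : 𝓞 K)} ≠ ⊤ := by
    intro h
    have := congrArg absNorm h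
    rw [absNorm_span_natCast, absNorm_top, Nat.pow_eq_one] at this
    rcases this with h1 | h1
    · exact hp.ne_one h1
    · have : 0 < Module.finrank ℤ (𝓞 K) := Module.finrank_pos
      omega
  obtain ⟨M, hM, hle⟩ := Ideal.exists_le_maximal _ hsp
  exact ⟨M, (mem_above hp).2 ⟨hM.isPrime, (span_singleton_le_iff_mem _).1 hle⟩⟩

theorem sum_stab {p : ℕ} (hp : p.Prime) :
    ∑ P ∈ above K p, Nat.card (MulAction.stabilizer Gal(K/ℚ) P) = Nat.card Gal(K/ℚ) := by
  have h1 : ∀ P ∈ above K p, MulAction.orbit Gal(K/ℚ) P = (above K p : Set (Ideal (𝓞 K))) := by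
    intro P hP
    ext Q
    rw [MulAction.mem_orbit_iff, Finset.mem_coe]
    have hP' := (mem_above hp).1 hP
    constructor
    · rintro ⟨σ, rfl⟩
      rw [mem_above hp]
      haveI := hP'.1
      refine ⟨inferInstance, ?_⟩
      have := Ideal.smul_mem_pointwise_smul σ _ P hP'.2
      rwa [show σ • (p : 𝓞 K) = p from map_natCast (MulSemiringAction.toRingHom Gal(K/ℚ) (𝓞 K) σ) p] at this
    · intro hQ
      have hQ' := (mem_above hp).1 hQ
      haveI := hP'.1
      haveI := hQ'.1
      obtain ⟨σ, h⟩ := Algebra.IsInvariant.exists_smul_of_under_eq ℤ (𝓞 K) Gal(K/ℚ) P Q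
        (by rw [above_under hp hP, above_under hp hQ])
      exact ⟨σ, h.symm⟩
  have h2 : ∀ P ∈ above K p, (above K p).card * Nat.card (MulAction.stabilizer Gal(K/ℚ) P) =
      Nat.card Gal(K/ℚ) := by
    intro P hP
    have := Nat.card_congr (MulAction.orbitProdStabilizerEquivGroup Gal(K/ℚ) P)
    rw [Nat.card_prod, h1 P hP] at this
    rw [← this]
    simp
  have h3 : 0 < (above K p).card := (above_nonempty hp).card_pos
  have h4 : (above K p).card * ∑ P ∈ above K p, Nat.card (MulAction.stabilizer Gal(K/ℚ) P) =
      (above K p).card * Nat.card Gal(K/ℚ) := by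
    rw [Finset.mul_sum, Finset.sum_congr rfl h2]
    simp
  exact Nat.eq_of_mul_eq_mul_left h3 h4

theorem frob_count (R : Finset (𝓞 K)) (hR : ∀ σ : Gal(K/ℚ), ∀ β ∈ R, σ • β ∈ R)
    (hgen : ∀ σ : Gal(K/ℚ), (∀ β ∈ R, σ • β = β) → σ = 1) (hG : IsPGroup 2 Gal(K/ℚ))
    (F : ℤ[X]) (hF : F.map (algebraMap ℤ (𝓞 K)) = ∏ β ∈ R, (X - C β)) (N : ℕ)
    (S : Finset ℕ)
    (hS : ∀ p ∈ S, p.Prime ∧ p ≤ N ∧ (∃ n : ℤ, (p : ℤ) ∣ F.eval n) ∧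
      ∀ P ∈ above K p, ∀ β ∈ R, ∀ β' ∈ R, β - β' ∈ P → β = β') :
    Nat.card Gal(K/ℚ) * S.card ≤ 2 * ∑ τ ∈ Finset.univ.filter (fun τ : Gal(K/ℚ) => ∃ β ∈ R, τ • β = β),
      ((idLe (fixF τ) N).filter Prime).card := by
  set U := S.biUnion (above K) with hU
  have hdisj : Set.PairwiseDisjoint (S : Set ℕ) (above K) := by
    intro p hp q hq hpq
    rw [Function.onFun, Finset.disjoint_left]
    intro P h1 h2
    exact hpq (above_inter (hS p hp).1 (hS q hq).1 h1 h2)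
  have hUm : ∀ P ∈ U, ∃ p ∈ S, P ∈ above K p := by
    intro P hP
    rw [hU, Finset.mem_biUnion] at hP
    exact hP
  have e1 : Nat.card Gal(K/ℚ) * S.card = ∑ P ∈ U, Nat.card (MulAction.stabilizer Gal(K/ℚ) P) := by
    rw [hU, Finset.sum_biUnion hdisj, Finset.sum_congr rfl (fun p hp => sum_stab (hS p hp).1)]
    simp [mul_comm]
  have e2 : ∀ P ∈ U, Nat.card (MulAction.stabilizer Gal(K/ℚ) P) ≤
      2 * (Finset.univ.filter fun τ : Gal(K/ℚ) =>
        Subgroup.zpowers τ = MulAction.stabilizer Gal(K/ℚ) P).card := by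
    intro P hP
    obtain ⟨p, hp, hPp⟩ := hUm P hP
    have h1 := (mem_above (hS p hp).1).1 hPp
    refine cyclic_gens_two hG _ (stab_cyclic R hR hgen P h1.1 ?_ ((hS p hp).2.2.2 P hPp))
    rintro rfl
    have := h1.2
    rw [Ideal.mem_bot, Nat.cast_eq_zero] at this
    exact (hS p hp).1.ne_zero this
  rw [e1]
  refine (Finset.sum_le_sum e2).trans ?_
  rw [← Finset.mul_sum]
  refine Nat.mul_le_mul_left 2 ?_
  simp only [Finset.card_filter]
  rw [Finset.sum_comm, Finset.sum_filter]
  refine Finset.sum_le_sum fun τ _ => ?_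
  simp only [← Finset.card_filter]
  split_ifs with hτ
  · refine Finset.card_le_card_of_injOn (fun P => P.under (𝓞 (fixF τ))) ?_ ?_
    · intro P hP
      simp only [Finset.coe_filter, Set.mem_ofPred_eq] at hP
      obtain ⟨p, hp, hPp⟩ := hUm P hP.1
      have h1 := (mem_above (hS p hp).1).1 hPp
      have h2 := fixF_norm τ p (hS p hp).1 P h1.1 h1.2 hP.2
      simp only [Finset.coe_filter, Set.mem_ofPred_eq, mem_idLe]
      have h3 : P.under (𝓞 (fixF τ)) ≠ ⊥ := by
        intro h
        rw [h, absNorm_bot] at h2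
        exact (hS p hp).1.ne_zero h2.symm
      haveI := h1.1
      refine ⟨⟨?_, h3⟩, Ideal.prime_of_isPrime h3 inferInstance⟩
      rw [h2]; exact (hS p hp).2.1
    · intro P hP Q hQ h
      simp only [Finset.coe_filter, Set.mem_ofPred_eq] at hP hQ
      obtain ⟨p, hp, hPp⟩ := hUm P hP.1
      obtain ⟨q, hq, hQq⟩ := hUm Q hQ.1
      exact (fixF_inj τ P Q ((mem_above (hS p hp).1).1 hPp).1 ((mem_above (hS q hq).1).1 hQq).1 hP.2 h).symm
  · rw [Nat.le_zero, Finset.card_eq_zero, Finset.filter_eq_empty_iff]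
    intro P hP hst
    obtain ⟨p, hp, hPp⟩ := hUm P hP
    have h1 := (mem_above (hS p hp).1).1 hPp
    obtain ⟨β, hβ, h2⟩ := stab_fix_root R hR F hF p (hS p hp).2.2.1 P h1.1 h1.2 ((hS p hp).2.2.2 P hPp)
    exact hτ ⟨β, hβ, h2 τ (hst ▸ Subgroup.mem_zpowers τ)⟩

/-- Main counting consequence. -/
theorem frob_density (R : Finset (𝓞 K)) (hR : ∀ σ : Gal(K/ℚ), ∀ β ∈ R, σ • β ∈ R)
    (hgen : ∀ σ : Gal(K/ℚ), (∀ β ∈ R, σ • β = β) → σ = 1) (hG : IsPGroup 2 Gal(K/ℚ))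
    (F : ℤ[X]) (hF : F.map (algebraMap ℤ (𝓞 K)) = ∏ β ∈ R, (X - C β)) :
    ∃ B : ℕ, ∀ᶠ N : ℕ in atTop, ∀ S : Finset ℕ,
      (∀ p ∈ S, p.Prime ∧ p ≤ N ∧ ∃ n : ℤ, (p : ℤ) ∣ F.eval n) →
      (S.card : ℝ) ≤ B + 14 * ((Finset.univ.filter (fun τ : Gal(K/ℚ) => ∃ β ∈ R, τ • β = β)).card : ℝ) /
        Nat.card Gal(K/ℚ) * (N / Real.log N) := by
  set Δ : 𝓞 K := ∏ z ∈ (R ×ˢ R).filter (fun z => z.1 ≠ z.2), (z.1 - z.2) with hΔ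
  have hΔ0 : Δ ≠ 0 := by
    rw [hΔ, Finset.prod_ne_zero_iff]
    intro z hz
    rw [Finset.mem_filter] at hz
    exact sub_ne_zero.2 hz.2
  set D : ℕ := absNorm (span {Δ}) with hD
  have hD0 : D ≠ 0 := by
    rw [hD, Ne, absNorm_eq_zero_iff, span_singleton_eq_bot]; exact hΔ0
  have hgood : ∀ p : ℕ, p.Prime → ¬ p ∣ D → ∀ P ∈ above K p, ∀ β ∈ R, ∀ β' ∈ R, β - β' ∈ P → β = β' := by
    intro p hp hpD P hP β hβ β' hβ' h
    by_contra hne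
    rw [mem_above hp] at hP
    apply hpD
    have h1 : Δ ∈ P := by
      have : (β - β') ∣ Δ := by
        rw [hΔ]
        exact Finset.dvd_prod_of_mem (fun z : 𝓞 K × 𝓞 K => z.1 - z.2) (a := (β, β'))
          (by rw [Finset.mem_filter, Finset.mem_product]; exact ⟨⟨hβ, hβ'⟩, hne⟩)
      exact P.mem_of_dvd this h
    have h2 : (D : 𝓞 K) ∈ P := by
      have : (D : 𝓞 K) ∈ span {Δ} := absNorm_mem _
      exact (span_singleton_le_iff_mem P).2 h1 this
    by_contra hpD
    have hc : IsCoprime (p : ℤ) (D : ℤ) := by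
      rw [Nat.isCoprime_iff_coprime]; exact (Nat.Prime.coprime_iff_not_dvd hp).2 hpD
    obtain ⟨a, b, hab⟩ := hc
    refine hP.1.ne_top ((Ideal.eq_top_iff_one P).2 ?_)
    have := congrArg (Int.cast : ℤ → 𝓞 K) hab
    push_cast at this
    rw [← this]
    exact P.add_mem (P.mul_mem_left _ hP.2) (P.mul_mem_left _ h2)
  refine ⟨D + 1, ?_⟩
  have hev : ∀ᶠ N : ℕ in atTop, ∀ τ : Gal(K/ℚ),
      (((idLe (fixF τ) N).filter Prime).card : ℝ) ≤ 7 * N / Real.log N := by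
    rw [eventually_all]
    intro τ
    have := (tendsto_natCast_atTop_atTop (R := ℝ)).eventually (prime_ideal_bound (fixF τ))
    filter_upwards [this] with N hN
    rwa [Nat.floor_natCast] at hN
  filter_upwards [hev] with N hN S hS
  set S1 := S.filter (fun p => ¬ p ∣ D)
  have h1 := frob_count R hR hgen hG F hF N S1 (fun p hp => by
    rw [Finset.mem_filter] at hp
    exact ⟨(hS p hp.1).1, (hS p hp.1).2.1, (hS p hp.1).2.2, hgood p (hS p hp.1).1 hp.2⟩)
  have h2 : (S.card : ℝ) ≤ (D + 1 : ℕ) + S1.card := by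
    rw [← Finset.card_filter_add_card_filter_not (s := S) (fun p => p ∣ D)]
    push_cast
    gcongr
    have : (S.filter (fun p => p ∣ D)).card ≤ (Finset.range (D + 1)).card := by
      refine Finset.card_le_card fun p hp => ?_
      rw [Finset.mem_filter] at hp
      rw [Finset.mem_range]
      exact Nat.lt_succ_of_le (Nat.le_of_dvd (Nat.pos_of_ne_zero hD0) hp.2)
    rw [Finset.card_range] at this
    exact_mod_cast this
  refine h2.trans ?_
  gcongr
  have hGpos : (0:ℝ) < Nat.card Gal(K/ℚ) := by exact_mod_cast Nat.card_pos
  rw [div_mul_eq_mul_div, le_div_iff₀ hGpos]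
  have h3 : ((Nat.card Gal(K/ℚ) * S1.card : ℕ) : ℝ) ≤ _ := Nat.cast_le.2 h1
  push_cast at h3
  rw [mul_comm]
  refine h3.trans ?_
  have h4 := Finset.sum_le_sum (s := Finset.univ.filter (fun τ : Gal(K/ℚ) => ∃ β ∈ R, τ • β = β))
    (fun τ _ => hN τ)
  rw [Finset.sum_const, nsmul_eq_mul] at h4
  calc _ ≤ 2 * _ := mul_le_mul_of_nonneg_left h4 (by norm_num)
    _ = _ := by ring

end FrobCount

section FAbs
open Finset
open scoped Classical Pointwise symmDiff

theorem zmod2_symmDiff_sum {Ω : Type*} (R A B : Finset Ω) (hA : A ⊆ R) (hB : B ⊆ R) (v : Ω → ZMod 2) :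
    ∑ α ∈ A ∆ B, v α = ∑ α ∈ A, v α + ∑ α ∈ B, v α := by
  have e : ∀ C : Finset Ω, C ⊆ R → ∑ α ∈ C, v α = ∑ α ∈ R, if α ∈ C then v α else 0 := by
    intro C hC
    rw [← Finset.sum_filter]
    congr 1
    ext x
    simp only [mem_filter]
    exact ⟨fun h => ⟨hC h, h⟩, fun h => h.2⟩
  rw [e A hA, e B hB, e _ (by
    intro x hx
    rw [Finset.mem_symmDiff] at hx
    rcases hx with h | h
    · exact hA h.1
    · exact hB h.1), ← Finset.sum_add_distrib]
  refine Finset.sum_congr rfl fun x _ => ?_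
  have h2 : v x + v x = 0 := by
    have : (2 : ZMod 2) = 0 := rfl
    rw [← two_mul, this, zero_mul]
  by_cases h1 : x ∈ A <;> by_cases h3 : x ∈ B <;> simp [h1, h3, Finset.mem_symmDiff, h2]

theorem good_or_even {G Ω : Type*} [Group G] [Finite G] [MulAction G Ω] (hG : IsPGroup 2 G)
    (f ι : Ω → Ω) (hf : ∀ (g : G) x, f (g • x) = g • f x) (hιe : ∀ (g : G) x, ι (g • x) = g • ι x)
    (hι : ∀ x x', f x = f x' → x' = x ∨ x' = ι x) (hιι : ∀ x, ι (ι x) = x)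
    (R R' : Finset Ω) (hR : ∀ (g : G), ∀ x ∈ R, g • x ∈ R)
    (htr : ∀ x ∈ R, ∀ y ∈ R, ∃ g : G, g • x = y)
    (hmap : ∀ x ∈ R', f x ∈ R) (hne : ∀ x ∈ R', ι x ≠ x)
    (s : Ω → Ω) (hs : ∀ α ∈ R, s α ∈ R' ∧ f (s α) = α) :
    (∀ A ⊆ R, ∃ t : G, (∀ y ∈ R, t • y = y) ∧ ∀ x ∈ R', (t • x = x ↔ f x ∉ A)) ∨
    (∀ h : G, (∀ y ∈ R, h • y = y) → Even (R.filter fun α => h • s α ≠ s α).card) := by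
  set H : Subgroup G := 
    { carrier := {h | ∀ y ∈ R, h • y = y}
      mul_mem' := fun {a b} ha hb y hy => by rw [mul_smul, hb y hy, ha y hy]
      one_mem' := fun y _ => one_smul G y
      inv_mem' := fun {a} ha y hy => by rw [inv_smul_eq_iff, ha y hy] } with hH
  have hHm : ∀ h, h ∈ H ↔ ∀ y ∈ R, h • y = y := fun h => Iff.rfl
  set v : G → Ω → ZMod 2 := fun h α => if h • s α = s α then 0 else 1 with hv
  -- dichotomy
  have hdich : ∀ h ∈ H, ∀ x, f x ∈ R → h • x = x ∨ h • x = ι x := by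
    intro h hh x hx
    refine hι x (h • x) ?_
    rw [hf, hh _ hx]
  have hnes : ∀ α ∈ R, ι (s α) ≠ s α := fun α hα => hne _ (hs α hα).1
  have hfib : ∀ h ∈ H, ∀ x, f x ∈ R → (h • x = x ↔ h • s (f x) = s (f x)) := by
    intro h hh x hx
    have h1 := hs _ hx
    have hn := hnes _ hx
    rcases hι (s (f x)) x h1.2 with e | e
    · rw [← e]
    · constructor
      · intro h2
        rw [e, ← hιe] at h2
        have := congrArg ι h2
        rwa [hιι, hιι] at this
      · intro h2
        rw [e, ← hιe, h2]
  have hvmul : ∀ h ∈ H, ∀ h' ∈ H, ∀ α ∈ R, v (h * h') α = v h α + v h' α := by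
    intro h hh h' hh' α hα
    have hn := hnes α hα
    have hfa : f (s α) ∈ R := by rw [(hs α hα).2]; exact hα
    have h2 : (1 : ZMod 2) + 1 = 0 := rfl
    simp only [hv, mul_smul]
    rcases hdich h' hh' _ hfa with e' | e' <;> rcases hdich h hh _ hfa with e | e
    · simp [e, e']
    · simp [e, e', hn]
    · rw [e', ← hιe, e]; simp [hn]
    · rw [e', ← hιe, e, hιι]; simp [hn, h2]
  -- image submodule
  set S : AddSubgroup (R → ZMod 2) :=
    { carrier := {w | ∃ h ∈ H, ∀ α : R, w α = v h α}
      add_mem' := by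
        rintro a b ⟨h, hh, ha⟩ ⟨h', hh', hb⟩
        refine ⟨h * h', H.mul_mem hh hh', fun α => ?_⟩
        rw [Pi.add_apply, ha, hb, hvmul h hh h' hh' α α.2]
      zero_mem' := ⟨1, H.one_mem, fun α => by simp [hv]⟩
      neg_mem' := by
        rintro a ⟨h, hh, ha⟩
        refine ⟨h, hh, fun α => ?_⟩
        rw [Pi.neg_apply, ZMod.neg_eq_self_mod_two, ha] } with hS
  set Sm := AddSubgroup.toZModSubmodule 2 S with hSm
  by_cases htop : Sm = ⊤
  · left
    intro A hA
    have h1 : (fun α : R => if (α : Ω) ∈ A then (1 : ZMod 2) else 0) ∈ Sm := by rw [htop]; trivial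
    obtain ⟨t, ht, h2⟩ := h1
    refine ⟨t, ht, fun x hx => ?_⟩
    have hfx := hmap x hx
    rw [hfib t ht x hfx]
    have h3 := h2 ⟨f x, hfx⟩
    simp only [hv] at h3
    by_cases hA' : f x ∈ A
    · simp only [hA', if_true, not_true, iff_false] at h3 ⊢
      intro h4
      rw [if_pos h4] at h3
      exact one_ne_zero h3
    · simp only [hA', if_false, not_false_iff, iff_true] at h3 ⊢
      by_contra h4
      rw [if_neg h4] at h3
      exact zero_ne_one h3
  · right
    obtain ⟨φ, hφ, hker⟩ := Submodule.exists_le_ker_of_lt_top Sm (lt_top_iff_ne_top.2 htop)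
    -- W as sub-action on finsets
    let W : SubMulAction G (Finset Ω) :=
      { carrier := {A | A ⊆ R ∧ ∀ h ∈ H, ∑ α ∈ A, v h α = 0}
        smul_mem' := by
          rintro g A ⟨hA, hA2⟩
          have hgA : g • A ⊆ R := by
            intro x hx
            obtain ⟨y, hy, rfl⟩ := Finset.mem_smul_finset.1 hx
            exact hR g y (hA hy)
          refine ⟨hgA, fun h hh => ?_⟩
          have hc : g⁻¹ * h * g ∈ H := by
            rw [hHm]
            intro y hy
            rw [mul_smul, mul_smul, hh _ (hR g y hy), inv_smul_smul]
          rw [← hA2 _ hc, ← Finset.image_smul, Finset.sum_image (fun x _ y _ hxy => smul_left_cancel g hxy)]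
          refine Finset.sum_congr rfl fun α hα => ?_
          have hαR := hA hα
          have hgα := hR g α hαR
          have h1 := hs α hαR
          have h2 := hfib h hh (g • s α) (by rw [hf, h1.2]; exact hgα)
          rw [hf, h1.2] at h2
          simp only [hv, mul_smul]
          rw [if_congr h2.symm rfl rfl]
          refine if_congr ?_ rfl rfl
          rw [inv_smul_eq_iff] }
    have hWm : ∀ A, A ∈ W ↔ A ⊆ R ∧ ∀ h ∈ H, ∑ α ∈ A, v h α = 0 := fun A => Iff.rfl
    -- a nonzero element
    obtain ⟨A0, hA0, hA0n⟩ : ∃ A ∈ W, A.Nonempty := by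
      set A : Finset Ω := (Finset.univ.filter fun α : R => φ (Pi.single α 1) = 1).image (fun α : R => (α : Ω)) with hA
      refine ⟨A, (hWm A).2 ⟨?_, ?_⟩, ?_⟩
      · intro x hx
        obtain ⟨y, _, rfl⟩ := Finset.mem_image.1 hx
        exact y.2
      · intro h hh
        have h1 : (fun α : R => v h α) ∈ Sm := ⟨h, hh, fun _ => rfl⟩
        have h2 : φ (fun α : R => v h α) = 0 := LinearMap.mem_ker.1 (hker h1)
        rw [LinearMap.pi_apply_eq_sum_univ] at h2
        rw [hA, Finset.sum_image (fun x _ y _ hxy => Subtype.ext hxy), Finset.sum_filter]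
        refine Eq.trans ?_ h2
        refine Finset.sum_congr rfl fun α _ => ?_
        have hpi : (fun j => if α = j then (1 : ZMod 2) else 0) = Pi.single α 1 := by
          ext j
          by_cases hj : α = j
          · subst hj; simp
          · simp [hj, Pi.single_apply, Ne.symm hj]
        rw [hpi, smul_eq_mul]
        have : ∀ a : ZMod 2, (if a = 1 then (v h α) else 0) = v h α * a := by
          intro a
          have h01 : ∀ a : ZMod 2, a = 0 ∨ a = 1 := by decide
          rcases h01 a with rfl | rfl
          · rw [if_neg zero_ne_one, mul_zero]
          · rw [if_pos rfl, mul_one]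
        exact this _
      · by_contra hemp
        rw [Finset.not_nonempty_iff_eq_empty, hA, Finset.image_eq_empty, Finset.filter_eq_empty_iff] at hemp
        apply hφ
        refine LinearMap.pi_ext' fun α => ?_
        ext
        have h3 := hemp (Finset.mem_univ α)
        have : ∀ a : ZMod 2, a ≠ 1 → a = 0 := by decide
        simpa using this _ h3
    haveI : Finite W := by
      have : Set.Finite (W : Set (Finset Ω)) := by
        refine (Finset.finite_toSet R.powerset).subset ?_
        intro A hA
        rw [Finset.mem_coe, Finset.mem_powerset]
        exact ((hWm A).1 hA).1
      exact this
    have hempty : (∅ : Finset Ω) ∈ W := (hWm _).2 ⟨Finset.empty_subset _, fun h _ => by simp⟩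
    have hdvd : 2 ∣ Nat.card W := by
      let _ : Fintype W := Fintype.ofFinite W
      rw [Nat.card_eq_fintype_card, ← ZMod.natCast_eq_zero_iff, Fintype.card_eq_sum_ones]
      push_cast
      refine Finset.sum_involution (fun A _ => (⟨A.1 ∆ A0, ?_⟩ : W)) ?_ ?_ ?_ ?_
      · have hA1 := (hWm _).1 A.2
        have hA2 := (hWm _).1 hA0
        refine (hWm _).2 ⟨?_, fun h hh => ?_⟩
        · intro x hx
          rw [Finset.mem_symmDiff] at hx
          rcases hx with h | h
          · exact hA1.1 h.1
          · exact hA2.1 h.1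
        · rw [zmod2_symmDiff_sum R _ _ hA1.1 hA2.1, hA1.2 h hh, hA2.2 h hh, add_zero]
      · intro _ _; rfl
      · intro A _ _ h
        have := congrArg Subtype.val h
        simp only at this
        rw [symmDiff_eq_left] at this
        rw [this] at hA0n
        simp at hA0n
      · intro _ _; exact Finset.mem_univ _
      · intro A _
        apply Subtype.ext
        simp
    obtain ⟨⟨B, hB⟩, hfix, hBne⟩ := hG.exists_fixed_point_of_prime_dvd_card_of_fixed_point W hdvd
      (a := ⟨∅, hempty⟩) (by
        intro g
        apply Subtype.ext
        exact Finset.smul_finset_empty g)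
    have hBn : B.Nonempty := by
      by_contra hb
      rw [Finset.not_nonempty_iff_eq_empty] at hb
      subst hb
      exact hBne rfl
    have hBR := (hWm B).1 hB
    have hBeq : B = R := by
      refine Finset.Subset.antisymm hBR.1 ?_
      intro y hy
      obtain ⟨x, hx⟩ := hBn
      obtain ⟨g, rfl⟩ := htr x (hBR.1 hx) y hy
      have h1 : g • B = B := congrArg Subtype.val (hfix g)
      rw [← h1]
      exact Finset.smul_mem_smul_finset hx
    subst hBeq
    intro h hh
    have h1 := hBR.2 h hh
    simp only [hv] at h1
    have h2 : ((B.filter fun α => h • s α ≠ s α).card : ZMod 2) = 0 := by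
      rw [← h1, Finset.card_filter]
      push_cast
      refine Finset.sum_congr rfl fun x _ => ?_
      by_cases h3 : h • s x = s x <;> simp [h3]
    rwa [ZMod.natCast_eq_zero_iff, ← even_iff_two_dvd] at h2

end FAbs

section FSmall
open Finset
open scoped Classical

/-- number of group elements with a fixed point in `R` -/
noncomputable def fixN (G : Type*) {Ω : Type*} [Group G] [Fintype G] [MulAction G Ω] (R : Finset Ω) : ℕ :=
  (univ.filter fun g : G => ∃ x ∈ R, g • x = x).card

theorem burnside_markov {G Ω : Type*} [Group G] [Fintype G] [MulAction G Ω] (R : Finset Ω)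
    (hR : ∀ (g : G), ∀ x ∈ R, g • x ∈ R) (htr : ∀ x ∈ R, ∀ y ∈ R, ∃ g : G, g • x = y) (M : ℕ) :
    M * (univ.filter fun g : G => M ≤ (R.filter fun x => g • x = x).card).card ≤ Fintype.card G := by
  have h1 : ∑ g : G, (R.filter fun x => g • x = x).card ≤ Fintype.card G := by
    simp only [Finset.card_filter]
    rw [Finset.sum_comm]
    simp only [← Finset.card_filter]
    rcases R.eq_empty_or_nonempty with rfl | hne
    · simp
    have h2 : ∀ x ∈ R, R.card * (univ.filter fun g : G => g • x = x).card = Fintype.card G := by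
      intro x hx
      have := Finset.card_eq_sum_card_fiberwise (f := fun g : G => g • x) (s := univ) (t := R)
        (fun g _ => hR g x hx)
      rw [← Finset.card_univ, this, Finset.sum_const_nat (m := (univ.filter fun g : G => g • x = x).card)]
      intro y hy
      obtain ⟨g0, hg0⟩ := htr x hx y hy
      refine Finset.card_bij (fun g _ => g0⁻¹ * g) ?_ ?_ ?_
      · intro g hg
        simp only [mem_filter, mem_univ, true_and] at hg ⊢
        rw [mul_smul, hg, ← hg0, inv_smul_smul]
      · intro a _ b _ h
        exact mul_left_cancel h
      · intro b hb
        simp only [mem_filter, mem_univ, true_and] at hb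
        refine ⟨g0 * b, ?_, by group⟩
        simp only [mem_filter, mem_univ, true_and]
        rw [mul_smul, hb, hg0]
    have h3 : R.card * ∑ x ∈ R, (univ.filter fun g : G => g • x = x).card = R.card * Fintype.card G := by
      rw [Finset.mul_sum, Finset.sum_congr rfl h2, Finset.sum_const, smul_eq_mul]
    exact (Nat.eq_of_mul_eq_mul_left hne.card_pos h3).le
  refine le_trans ?_ h1
  calc _ = ∑ g ∈ univ.filter (fun g : G => M ≤ (R.filter fun x => g • x = x).card), M := by
        rw [Finset.sum_const, smul_eq_mul, mul_comm]
    _ ≤ ∑ g ∈ univ.filter (fun g : G => M ≤ (R.filter fun x => g • x = x).card),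
          (R.filter fun x => g • x = x).card := by
        refine Finset.sum_le_sum fun g hg => ?_
        exact (mem_filter.1 hg).2
    _ ≤ _ := Finset.sum_le_sum_of_subset (Finset.filter_subset _ _)

theorem fixN_step {G Ω : Type*} [Group G] [Fintype G] [MulAction G Ω]
    (f ι : Ω → Ω) (hf : ∀ (g : G) x, f (g • x) = g • f x) (hιe : ∀ (g : G) x, ι (g • x) = g • ι x)
    (hι : ∀ x x', f x = f x' → x' = x ∨ x' = ι x)
    (R R' : Finset Ω) (hR' : ∀ (g : G), ∀ x ∈ R', g • x ∈ R')
    (hmap : ∀ x ∈ R', f x ∈ R)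
    (hgood : ∀ A ⊆ R, ∃ t : G, (∀ y ∈ R, t • y = y) ∧ ∀ x ∈ R', (t • x = x ↔ f x ∉ A)) (M : ℕ) :
    fixN G R ≤ 2 ^ M * (fixN G R - fixN G R') +
      (univ.filter fun g : G => M ≤ (R.filter fun x => g • x = x).card).card := by
  set N : G → Finset Ω := fun g => R.filter fun x => g • x = x with hN
  set B := univ.filter fun g : G => (∃ x ∈ R, g • x = x) ∧ ¬ M ≤ (N g).card with hB
  set Cc := univ.filter fun g : G => ((∃ x ∈ R, g • x = x) ∧ ¬ M ≤ (N g).card) ∧ ¬ ∃ x ∈ R', g • x = x with hC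
  have h1 : fixN G R ≤ B.card + (univ.filter fun g : G => M ≤ (N g).card).card := by
    refine le_trans (Finset.card_le_card ?_) (Finset.card_union_le _ _)
    intro g hg
    simp only [mem_filter, mem_univ, true_and, mem_union, hB] at hg ⊢
    by_cases h : M ≤ (N g).card
    · exact Or.inr h
    · exact Or.inl ⟨hg, h⟩
  have h2 : Cc.card ≤ fixN G R - fixN G R' := by
    rw [Nat.le_sub_iff_add_le]
    · unfold fixN
      rw [← Finset.card_union_of_disjoint]
      · refine Finset.card_le_card ?_
        intro g hg
        simp only [mem_filter, mem_univ, true_and, mem_union, hC] at hg ⊢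
        rcases hg with hg | ⟨x, hx, hgx⟩
        · exact hg.1.1
        · exact ⟨f x, hmap x hx, by rw [← hf, hgx]⟩
      · rw [Finset.disjoint_left]
        intro g hg hg'
        simp only [mem_filter, mem_univ, true_and, hC] at hg hg'
        exact hg.2 hg'
    · unfold fixN
      refine Finset.card_le_card ?_
      intro g hg
      simp only [mem_filter, mem_univ, true_and] at hg ⊢
      obtain ⟨x, hx, hgx⟩ := hg
      exact ⟨f x, hmap x hx, by rw [← hf, hgx]⟩
  choose! t ht1 ht2 using hgood
  set Fg : G → Finset Ω := fun g => R.filter fun y => ∃ x ∈ R', f x = y ∧ g • x = x with hFg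
  have hFR : ∀ g, Fg g ⊆ R := fun g => Finset.filter_subset _ _
  have hNeq : ∀ g, N (g * t (Fg g)) = N g := by
    intro g
    simp only [hN]
    refine Finset.filter_congr fun x hx => ?_
    rw [mul_smul, ht1 _ (hFR g) x hx]
  have h3 : B.card ≤ 2 ^ M * Cc.card := by
    refine Finset.card_le_mul_card_image_of_maps_to (f := fun g => g * t (Fg g)) ?_ _ ?_
    · intro g hg
      simp only [hB, hC, mem_filter, mem_univ, true_and] at hg ⊢
      refine ⟨⟨?_, ?_⟩, ?_⟩
      · obtain ⟨x, hx, hgx⟩ := hg.1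
        exact ⟨x, hx, by rw [mul_smul, ht1 _ (hFR g) x hx, hgx]⟩
      · rw [hNeq]; exact hg.2
      · rintro ⟨x, hx, hgx⟩
        rw [mul_smul] at hgx
        have hfx := hmap x hx
        set T := t (Fg g) with hT
        have hTy : T • f x = f x := ht1 _ (hFR g) _ hfx
        have htx := ht2 _ (hFR g) x hx
        rw [← hT] at htx
        by_cases hF : f x ∈ Fg g
        · have hmem := hF
          simp only [hFg, mem_filter] at hmem
          obtain ⟨_, z, hz, hfz, hgz⟩ := hmem
          -- T x in fibre of z
          have h5 : f z = f (T • x) := by rw [hf, hTy, hfz]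
          have h6 : g • (T • x) = T • x := by
            rcases hι z _ h5 with e | e
            · rw [e, hgz]
            · rw [e, ← hιe, hgz]
          rw [h6] at hgx
          exact (htx.1 hgx) hF
        · rw [htx.2 hF] at hgx
          apply hF
          simp only [hFg, mem_filter]
          exact ⟨hfx, x, hx, rfl, hgx⟩
    · intro b hb
      simp only [hC, mem_filter, mem_univ, true_and] at hb
      have h7 : (B.filter fun g => g * t (Fg g) = b).card ≤ (N b).powerset.card := by
        refine Finset.card_le_card_of_injOn Fg ?_ ?_
        · intro g hg
          simp only [coe_filter, Set.mem_ofPred_eq] at hg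
          rw [Finset.mem_coe, Finset.mem_powerset, ← hg.2, hNeq]
          intro y hy
          simp only [hFg, hN, mem_filter] at hy ⊢
          obtain ⟨hyR, x, hx, hfx, hgx⟩ := hy
          exact ⟨hyR, by rw [← hfx, ← hf, hgx]⟩
        · intro g hg g' hg' h
          simp only [coe_filter, Set.mem_ofPred_eq] at hg hg'
          have := hg.2.trans hg'.2.symm
          rw [h] at this
          exact mul_right_cancel this
      refine h7.trans ?_
      rw [Finset.card_powerset]
      exact Nat.pow_le_pow_right (by norm_num) (by omega)
  calc _ ≤ _ := h1
    _ ≤ _ := by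
      gcongr
      exact h3.trans (Nat.mul_le_mul_left _ h2)

theorem fix_small (ε : ℝ) (hε : 0 < ε) : ∃ k : ℕ, ∀ (G Ω : Type) [Group G] [Fintype G] [MulAction G Ω]
    (f ι : Ω → Ω) (_ : ∀ (g : G) x, f (g • x) = g • f x) (_ : ∀ (g : G) x, ι (g • x) = g • ι x)
    (_ : ∀ x x', f x = f x' → x' = x ∨ x' = ι x)
    (R : ℕ → Finset Ω) (M0 : ℕ) (_ : ∀ m ≤ M0, ∀ (g : G), ∀ x ∈ R m, g • x ∈ R m)
    (_ : ∀ m ≤ M0, ∀ x ∈ R m, ∀ y ∈ R m, ∃ g : G, g • x = y)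
    (_ : ∀ m < M0, ∀ x ∈ R (m + 1), f x ∈ R m)
    (T : Finset ℕ) (_ : ∀ m ∈ T, m < M0) (_ : k ≤ T.card)
    (_ : ∀ m ∈ T, ∀ A ⊆ R m, ∃ t : G, (∀ y ∈ R m, t • y = y) ∧ ∀ x ∈ R (m + 1), (t • x = x ↔ f x ∉ A)),
    (fixN G (R M0) : ℝ) ≤ ε * Fintype.card G := by
  obtain ⟨M, hM⟩ := exists_nat_gt (2 / ε)
  have hM0 : (0:ℝ) < M := lt_trans (by positivity) hM
  obtain ⟨k, hk⟩ := exists_nat_gt (2 ^ M * 2 / ε)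
  refine ⟨k, ?_⟩
  intro G Ω _ _ _ f ι hf hιe hι R M0 hR htr hmap T hT hTk hgood
  by_contra hcon
  push Not at hcon
  have hGpos : (0:ℝ) < Fintype.card G := by exact_mod_cast Fintype.card_pos
  have hmono : ∀ m < M0, fixN G (R (m+1)) ≤ fixN G (R m) := by
    intro m hm
    refine Finset.card_le_card ?_
    intro g hg
    simp only [mem_filter, mem_univ, true_and] at hg ⊢
    obtain ⟨x, hx, hgx⟩ := hg
    exact ⟨f x, hmap m hm x hx, by rw [← hf, hgx]⟩
  have hmono2 : ∀ m ≤ M0, fixN G (R M0) ≤ fixN G (R m) := by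
    intro m hm
    have hd : ∀ d, ∀ m, m + d = M0 → fixN G (R M0) ≤ fixN G (R m) := by
      intro d
      induction d with
      | zero =>
        intro m hm
        rw [← hm, Nat.add_zero]
      | succ d ih =>
        intro m hm
        exact (ih (m + 1) (by omega)).trans (hmono m (by omega))
    exact hd (M0 - m) m (by omega)
  have hdrop : ∀ m ∈ T, ε / 2 * Fintype.card G / 2 ^ M ≤ (fixN G (R m) : ℝ) - fixN G (R (m + 1)) := by
    intro m hm
    have hmM := hT m hm
    have h1 := fixN_step f ι hf hιe hι (R m) (R (m+1)) (hR _ hmM) (hmap m hmM) (hgood m hm) M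
    have h2 := burnside_markov (G := G) (R m) (hR m hmM.le) (htr m hmM.le) M
    have h3 := hmono m hmM
    have h4 := hmono2 m hmM.le
    set b := (univ.filter fun g : G => M ≤ ((R m).filter fun x => g • x = x).card).card
    have h1' : (fixN G (R m) : ℝ) ≤ 2 ^ M * ((fixN G (R m) : ℝ) - fixN G (R (m+1))) + b := by
      rw [← Nat.cast_sub h3]; exact_mod_cast h1
    have h2' : (M : ℝ) * b ≤ Fintype.card G := by exact_mod_cast h2
    have h4' : (fixN G (R M0) : ℝ) ≤ fixN G (R m) := by exact_mod_cast h4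
    have h5 : (b : ℝ) ≤ ε / 2 * Fintype.card G := by
      rw [div_lt_iff₀ hε] at hM
      have hb : (0:ℝ) ≤ b := Nat.cast_nonneg _
      have : M * b ≤ M * (ε / 2 * Fintype.card G) := by nlinarith
      exact le_of_mul_le_mul_left this hM0
    rw [div_le_iff₀ (by positivity)]
    linarith
  have htel : ∑ m ∈ range M0, ((fixN G (R m) : ℝ) - fixN G (R (m + 1))) ≤ Fintype.card G := by
    rw [Finset.sum_range_sub']
    have h1 : (fixN G (R 0) : ℝ) ≤ Fintype.card G := by
      exact_mod_cast Finset.card_le_univ _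
    have h2 : (0:ℝ) ≤ fixN G (R M0) := Nat.cast_nonneg _
    linarith
  have hsub : ∑ m ∈ T, ((fixN G (R m) : ℝ) - fixN G (R (m + 1))) ≤
      ∑ m ∈ range M0, ((fixN G (R m) : ℝ) - fixN G (R (m + 1))) := by
    refine Finset.sum_le_sum_of_subset_of_nonneg (fun m hm => mem_range.2 (hT m hm)) ?_
    intro m hm _
    have : (fixN G (R (m+1)) : ℝ) ≤ fixN G (R m) := by exact_mod_cast hmono m (mem_range.1 hm)
    linarith
  have hlow := Finset.sum_le_sum hdrop
  rw [Finset.sum_const, nsmul_eq_mul] at hlow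
  have hTk' : (k : ℝ) ≤ T.card := by exact_mod_cast hTk
  have h6 : (k : ℝ) * (ε / 2 * Fintype.card G / 2 ^ M) ≤ Fintype.card G := by
    refine le_trans ?_ (hlow.trans (hsub.trans htel))
    gcongr
  rw [div_lt_iff₀ hε] at hk
  rw [← mul_div_assoc, div_le_iff₀ (by positivity)] at h6
  nlinarith

end FSmall

section FRoot
open NumberField
open scoped Classical

/-- integral roots of `F` in the number field `K` -/
noncomputable def rootO (K : Type*) [Field K] [NumberField K] (F : ℤ[X]) : Finset (𝓞 K) :=
  (F.map (algebraMap ℤ (𝓞 K))).roots.toFinset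

variable {K : Type*} [Field K] [NumberField K]

theorem mem_rootO {F : ℤ[X]} (hF : F.Monic) (x : 𝓞 K) : x ∈ rootO K F ↔ aeval x F = 0 := by
  unfold rootO
  rw [Multiset.mem_toFinset, mem_roots (hF.map _).ne_zero, IsRoot.def, eval_map_algebraMap]

theorem smul_aeval_int (σ : Gal(K/ℚ)) (x : 𝓞 K) (F : ℤ[X]) : aeval (σ • x) F = σ • aeval x F := by
  rw [aeval_smul]

theorem smul_mem_rootO {F : ℤ[X]} (hF : F.Monic) (σ : Gal(K/ℚ)) (x : 𝓞 K) (hx : x ∈ rootO K F) :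
    σ • x ∈ rootO K F := by
  rw [mem_rootO hF] at hx ⊢
  rw [aeval_smul, hx, smul_zero]

theorem coe_aeval_O (x : 𝓞 K) (F : ℤ[X]) :
    ((aeval x F : 𝓞 K) : K) = aeval (x : K) (F.map (Int.castRingHom ℚ)) := by
  rw [show (Int.castRingHom ℚ) = algebraMap ℤ ℚ from rfl, aeval_map_algebraMap]
  exact (aeval_algebraMap_apply K x F).symm

theorem minpoly_rootO {F : ℤ[X]} (hF : F.Monic) (hirr : Irreducible (F.map (Int.castRingHom ℚ)))
    (x : 𝓞 K) (hx : x ∈ rootO K F) : minpoly ℚ (x : K) = F.map (Int.castRingHom ℚ) := by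
  rw [mem_rootO hF] at hx
  refine (minpoly.eq_of_irreducible_of_monic hirr ?_ (hF.map _)).symm
  rw [← coe_aeval_O, hx]; rfl

theorem rootO_trans [IsGalois ℚ K] {F : ℤ[X]} (hF : F.Monic)
    (hirr : Irreducible (F.map (Int.castRingHom ℚ)))
    (x : 𝓞 K) (hx : x ∈ rootO K F) (y : 𝓞 K) (hy : y ∈ rootO K F) : ∃ σ : Gal(K/ℚ), σ • x = y := by
  have h : minpoly ℚ (y : K) = minpoly ℚ (x : K) := by
    rw [minpoly_rootO hF hirr x hx, minpoly_rootO hF hirr y hy]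
  rw [Normal.minpoly_eq_iff_mem_orbit] at h
  obtain ⟨σ, hσ⟩ := h
  exact ⟨σ, RingOfIntegers.ext hσ⟩

theorem rootO_lift {F : ℤ[X]} (hF : F.Monic) (z : K) (hz : aeval z (F.map (Int.castRingHom ℚ)) = 0) :
    ∃ x ∈ rootO K F, (x : K) = z := by
  have h1 : aeval z F = 0 := by
    rwa [show (Int.castRingHom ℚ) = algebraMap ℤ ℚ from rfl, aeval_map_algebraMap] at hz
  have h2 : IsIntegral ℤ z := ⟨F, hF, by rwa [← aeval_def]⟩
  let w : 𝓞 K := (⟨z, h2⟩ : integralClosure ℤ K)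
  refine ⟨w, ?_, rfl⟩
  rw [mem_rootO hF]
  apply RingOfIntegers.ext
  rw [coe_aeval_O]
  exact hz

theorem rootO_prod_of_splits {F : ℤ[X]} (hF : F.Monic)
    (hirr : Irreducible (F.map (Int.castRingHom ℚ)))
    (hs : ((F.map (Int.castRingHom ℚ)).map (algebraMap ℚ K)).Splits) :
    F.map (algebraMap ℤ (𝓞 K)) = ∏ β ∈ rootO K F, (X - C β) := by
  set Fq := F.map (Int.castRingHom ℚ) with hFq
  have hsep : Fq.Separable := hirr.separable
  have hcard : Fintype.card (Fq.rootSet K) = F.natDegree := by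
    rw [card_rootSet_eq_natDegree hsep hs, hFq, (hF.natDegree_map _)]
  have h1 : Fintype.card (Fq.rootSet K) ≤ (rootO K F).card := by
    rw [← Set.toFinset_card]
    refine (Finset.card_le_card (t := (rootO K F).image (fun x : 𝓞 K => (x : K))) ?_).trans Finset.card_image_le
    intro z hz
    rw [Set.mem_toFinset, mem_rootSet] at hz
    obtain ⟨x, hx, rfl⟩ := rootO_lift hF z hz.2
    exact Finset.mem_image_of_mem _ hx
  have hm : (F.map (algebraMap ℤ (𝓞 K))).Monic := hF.map _
  have hd : (F.map (algebraMap ℤ (𝓞 K))).natDegree = F.natDegree := hF.natDegree_map _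
  have h2 : (rootO K F).card ≤ Multiset.card (F.map (algebraMap ℤ (𝓞 K))).roots :=
    Multiset.toFinset_card_le _
  have h3 := card_roots' (F.map (algebraMap ℤ (𝓞 K)))
  have h4 : Multiset.card (F.map (algebraMap ℤ (𝓞 K))).roots = (F.map (algebraMap ℤ (𝓞 K))).natDegree := by
    omega
  have hnd : (F.map (algebraMap ℤ (𝓞 K))).roots.Nodup := by
    rw [← Multiset.toFinset_card_eq_card_iff_nodup]
    change (rootO K F).card = _
    omega
  rw [← prod_multiset_X_sub_C_of_monic_of_roots_card_eq hm h4]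
  rw [Finset.prod, rootO, Multiset.toFinset_val, hnd.dedup]

theorem rootO_prod [IsGalois ℚ K] {F : ℤ[X]} (hF : F.Monic)
    (hirr : Irreducible (F.map (Int.castRingHom ℚ)))
    (x : 𝓞 K) (hx : x ∈ rootO K F) :
    F.map (algebraMap ℤ (𝓞 K)) = ∏ β ∈ rootO K F, (X - C β) := by
  refine rootO_prod_of_splits hF hirr ?_
  rw [← minpoly_rootO hF hirr x hx]
  exact Normal.splits inferInstance _

/-- splitting field of an integer polynomial -/
def spl (F : ℤ[X]) : Type := (F.map (Int.castRingHom ℚ)).SplittingField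

noncomputable instance (F : ℤ[X]) : Field (spl F) :=
  inferInstanceAs (Field (F.map (Int.castRingHom ℚ)).SplittingField)

instance (F : ℤ[X]) : CharZero (spl F) :=
  inferInstanceAs (CharZero (F.map (Int.castRingHom ℚ)).SplittingField)

instance spl_isSplittingField (F : ℤ[X]) : IsSplittingField ℚ (spl F) (F.map (Int.castRingHom ℚ)) := by
  have h := Polynomial.IsSplittingField.splittingField (F.map (Int.castRingHom ℚ))
  have key : ∀ (A B : Algebra ℚ (F.map (Int.castRingHom ℚ)).SplittingField),
      @IsSplittingField ℚ (F.map (Int.castRingHom ℚ)).SplittingField _ _ A (F.map (Int.castRingHom ℚ)) →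
      @IsSplittingField ℚ (F.map (Int.castRingHom ℚ)).SplittingField _ _ B (F.map (Int.castRingHom ℚ)) := by
    intro A B hA
    rwa [Subsingleton.elim B A]
  exact key _ _ h

instance (F : ℤ[X]) : NumberField (spl F) where
  to_charZero := inferInstance
  to_finiteDimensional :=
    Polynomial.IsSplittingField.finiteDimensional (spl F) (F.map (Int.castRingHom ℚ))

theorem spl_galois (F : ℤ[X]) (hirr : Irreducible (F.map (Int.castRingHom ℚ))) : IsGalois ℚ (spl F) :=
  IsGalois.of_separable_splitting_field (p := F.map (Int.castRingHom ℚ)) hirr.separable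

theorem spl_gen {F : ℤ[X]} (hF : F.Monic)
    (σ : Gal(spl F/ℚ)) (h : ∀ β ∈ rootO (spl F) F, σ • β = β) : σ = 1 := by
  have h1 := IsSplittingField.adjoin_rootSet (spl F) (F.map (Int.castRingHom ℚ))
  have h2 : (σ : spl F →ₐ[ℚ] spl F) = AlgHom.id ℚ (spl F) := by
    refine AlgHom.ext_of_adjoin_eq_top h1 ?_
    intro z hz
    rw [mem_rootSet] at hz
    obtain ⟨x, hx, rfl⟩ := rootO_lift hF z hz.2
    exact congrArg (fun y : 𝓞 (spl F) => (y : spl F)) (h x hx)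
  ext z
  exact DFunLike.congr_fun h2 z

theorem spl_nonempty {F : ℤ[X]} (hF : F.Monic) (hirr : Irreducible (F.map (Int.castRingHom ℚ))) :
    (rootO (spl F) F).Nonempty := by
  have h1 := IsSplittingField.splits (spl F) (F.map (Int.castRingHom ℚ))
  obtain ⟨z, hz⟩ := h1.exists_eval_eq_zero (by
    rw [degree_map]; exact hirr.degree_pos.ne')
  obtain ⟨x, hx, -⟩ := rootO_lift hF z (by rwa [aeval_def, ← eval_map])
  exact ⟨x, hx⟩

/-- An integer that becomes a square in a Galois field `K`, with root fixed by everything fixing the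
roots of `F`, is a square in the splitting field of `F`. -/
theorem square_descend [IsGalois ℚ K] {F : ℤ[X]} (hF : F.Monic)
    (hirr : Irreducible (F.map (Int.castRingHom ℚ))) (x : 𝓞 K) (hx : x ∈ rootO K F)
    (θ : 𝓞 K) (hθ : ∀ σ : Gal(K/ℚ), (∀ β ∈ rootO K F, σ • β = β) → σ • θ = θ)
    (N : ℤ) (hN : θ ^ 2 = (N : 𝓞 K)) : ∃ η : 𝓞 (spl F), η ^ 2 = (N : 𝓞 (spl F)) := by
  set Fq := F.map (Int.castRingHom ℚ) with hFq
  have hsp : (Fq.map (algebraMap ℚ K)).Splits := by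
    rw [hFq, ← minpoly_rootO hF hirr x hx]
    exact Normal.splits inferInstance _
  set L := IntermediateField.adjoin ℚ (Fq.rootSet K) with hL
  have hLs : IsSplittingField ℚ L Fq := IntermediateField.adjoin_rootSet_isSplittingField hsp
  have hmem : (θ : K) ∈ L := by
    rw [← IsGalois.fixedField_fixingSubgroup L]
    rw [IntermediateField.mem_fixedField_iff]
    intro σ hσ
    have := hθ σ ?_
    · exact congrArg (fun y : 𝓞 K => (y : K)) this
    · intro β hβ
      rw [IntermediateField.mem_fixingSubgroup_iff] at hσ
      refine RingOfIntegers.ext (hσ β ?_)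
      apply IntermediateField.subset_adjoin
      rw [mem_rootSet]
      refine ⟨hirr.ne_zero, ?_⟩
      rw [← coe_aeval_O, (mem_rootO hF β).1 hβ]; rfl
  let e1 := IsSplittingField.algEquiv L Fq
  let e2 := IsSplittingField.algEquiv (spl F) Fq
  let w : spl F := e2.symm (e1 ⟨θ, hmem⟩)
  have hw : w ^ 2 = (N : spl F) := by
    have h1 : (⟨θ, hmem⟩ : L) ^ 2 = (N : L) := by
      apply Subtype.ext
      have := congrArg (fun y : 𝓞 K => (y : K)) hN
      simpa using this
    simp only [w]
    rw [← map_pow, ← map_pow, h1]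
    simp
  have hi : IsIntegral ℤ w := by
    refine IsIntegral.of_pow (n := 2) (by norm_num) ?_
    rw [hw]
    exact isIntegral_algebraMap (R := ℤ) (A := spl F) (x := N)
  refine ⟨(⟨w, hi⟩ : integralClosure ℤ (spl F)), ?_⟩
  apply RingOfIntegers.ext
  have : ((N : 𝓞 (spl F)) : spl F) = (N : spl F) := by simp
  rw [this, ← hw]
  rfl

end FRoot

section FGal
open NumberField
open scoped Classical

/-- standing hypotheses -/
structure DynHyp (f g : ℤ[X]) (r : ℕ) : Prop where
  hf : f.Monic
  hfdeg : f.natDegree = 2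
  hg : g.Monic
  hirr : ∀ n : ℕ, Irreducible ((g.comp (polyIter f n)).map (Int.castRingHom ℚ))
  hdvd : g ∣ polyIter f r

/-- `F_m = g ∘ f^m` -/
noncomputable def FF (f g : ℤ[X]) (m : ℕ) : ℤ[X] := g.comp (polyIter f m)

/-- discriminant of `f` -/
noncomputable def DD (f : ℤ[X]) : ℤ := f.coeff 1 ^ 2 - 4 * f.coeff 0

/-- the scaled value of `F_m` at the critical value -/
noncomputable def NN (f g : ℤ[X]) (m : ℕ) : ℤ := ((FF f g m).scaleRoots 4).eval (-(DD f))

theorem polyIter_succ' (f : ℤ[X]) (n : ℕ) : polyIter f (n + 1) = (polyIter f n).comp f := by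
  induction n with
  | zero => simp [polyIter]
  | succ n ih =>
    have h : polyIter f (n + 1 + 1) = f.comp (polyIter f (n + 1)) := rfl
    have h' : polyIter f (n + 1) = f.comp (polyIter f n) := rfl
    rw [h, ih, ← comp_assoc, ← h', ih]

theorem FF_succ (f g : ℤ[X]) (m : ℕ) : FF f g (m + 1) = (FF f g m).comp f := by
  rw [FF, FF, polyIter_succ', comp_assoc]

theorem polyIter_monic {f : ℤ[X]} (hf : f.Monic) (h2 : f.natDegree = 2) (n : ℕ) :
    (polyIter f n).Monic ∧ (polyIter f n).natDegree = 2 ^ n := by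
  induction n with
  | zero => exact ⟨monic_X, by simp [polyIter]⟩
  | succ n ih =>
    rw [polyIter]
    refine ⟨hf.comp ih.1 (by rw [ih.2]; positivity), ?_⟩
    rw [natDegree_comp, ih.2, h2, pow_succ, mul_comm]

theorem aeval_polyIter {A : Type*} [CommRing A] (f : ℤ[X]) (n : ℕ) (x : A) :
    aeval x (polyIter f n) = (fun y => aeval y f)^[n] x := by
  induction n with
  | zero => simp [polyIter]
  | succ n ih =>
    rw [polyIter, aeval_comp, ih, Function.iterate_succ_apply']

variable {f g : ℤ[X]} {r : ℕ}

namespace DynHyp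

theorem f_eq (H : DynHyp f g r) : f = X ^ 2 + C (f.coeff 1) * X + C (f.coeff 0) := by
  conv_lhs => rw [f.as_sum_range_C_mul_X_pow, H.hfdeg]
  have h2 : f.coeff 2 = 1 := by
    have := H.hf.coeff_natDegree
    rwa [H.hfdeg] at this
  simp [Finset.sum_range_succ, h2]
  ring

theorem aeval_f (H : DynHyp f g r) {A : Type*} [CommRing A] (x : A) :
    aeval x f = x ^ 2 + (f.coeff 1 : A) * x + (f.coeff 0 : A) := by
  conv_lhs => rw [H.f_eq]
  simp

theorem fiber (H : DynHyp f g r) {A : Type*} [CommRing A] [IsDomain A] (x x' : A) (h : aeval x f = aeval x' f) :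
    x' = x ∨ x' = -(f.coeff 1 : A) - x := by
  rw [H.aeval_f, H.aeval_f] at h
  have : (x' - x) * (x' - (-(f.coeff 1 : A) - x)) = 0 := by linear_combination -h
  rcases mul_eq_zero.1 this with h | h
  · exact Or.inl (sub_eq_zero.1 h)
  · exact Or.inr (sub_eq_zero.1 h)

theorem four_f (H : DynHyp f g r) {A : Type*} [CommRing A] (x : A) :
    4 * aeval x f + (DD f : A) = (2 * x + (f.coeff 1 : A)) ^ 2 := by
  rw [H.aeval_f, DD]; push_cast; ring

theorem FF_monic (H : DynHyp f g r) (m : ℕ) : (FF f g m).Monic := by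
  have := polyIter_monic H.hf H.hfdeg m
  exact H.hg.comp this.1 (by rw [this.2]; positivity)

theorem FF_natDegree (H : DynHyp f g r) (m : ℕ) : (FF f g m).natDegree = g.natDegree * 2 ^ m := by
  rw [FF, natDegree_comp, (polyIter_monic H.hf H.hfdeg m).2]

theorem FF_irr (H : DynHyp f g r) (m : ℕ) : Irreducible ((FF f g m).map (Int.castRingHom ℚ)) := H.hirr m

theorem g_pos (H : DynHyp f g r) : 0 < g.natDegree := by
  have := (H.FF_irr 0).natDegree_pos
  rwa [(H.FF_monic 0).natDegree_map, H.FF_natDegree, pow_zero, mul_one] at this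

theorem aeval_FF_succ (H : DynHyp f g r) {A : Type*} [CommRing A] (m : ℕ) (x : A) :
    aeval x (FF f g (m + 1)) = aeval (aeval x f) (FF f g m) := by
  rw [FF_succ, aeval_comp]

theorem not_crit (H : DynHyp f g r) {A : Type*} [Field A] [CharZero A] (m : ℕ) (x : A)
    (h : 2 * x + (f.coeff 1 : A) = 0) : aeval x (FF f g (m + 1)) ≠ 0 := by
  intro h0
  set q : ℚ := -(f.coeff 1 : ℚ) / 2 with hq
  have hx : x = ((q : ℚ) : A) := by
    rw [hq]; push_cast
    field_simp
    linear_combination h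
  have h1 : aeval q (FF f g (m + 1)) = 0 := by
    have h3 : aeval x (FF f g (m+1)) = algebraMap ℚ A (aeval q (FF f g (m+1))) := by
      rw [hx, ← aeval_algebraMap_apply]
      rfl
    rw [h0] at h3
    exact ((map_eq_zero _).1 h3.symm)
  have hroot : IsRoot ((FF f g (m + 1)).map (Int.castRingHom ℚ)) q := by
    rw [IsRoot.def, eval_map, ← h1]; rfl
  have := natDegree_eq_of_degree_eq_some (degree_eq_one_of_irreducible_of_root (H.FF_irr (m+1)) hroot)
  rw [(H.FF_monic _).natDegree_map, H.FF_natDegree, pow_succ] at this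
  have h4 := H.g_pos
  have h5 : 0 < 2 ^ m := by positivity
  have this' : g.natDegree * (2 ^ m * 2) = 1 := this
  have : 2 ∣ 1 := ⟨g.natDegree * 2 ^ m, by rw [← this']; ring⟩
  omega

/-- NN at a critical value. -/
theorem NN_cast (H : DynHyp f g r) {A : Type*} [CommRing A] (m : ℕ) (y : A) (hy : 4 * y = -(DD f : A)) :
    (NN f g m : A) = 4 ^ (g.natDegree * 2 ^ m) * aeval y (FF f g m) := by
  have h := scaleRoots_eval₂_mul (p := FF f g m) (Int.castRingHom A) y 4
  rw [H.FF_natDegree] at h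
  rw [aeval_def, show algebraMap ℤ A = Int.castRingHom A from rfl]
  have h4 : (Int.castRingHom A) 4 = 4 := by simp
  rw [h4, hy] at h
  rw [← h, NN]
  have h5 := eval₂_at_apply (p := (FF f g m).scaleRoots 4) (Int.castRingHom A) (-(DD f))
  rw [show (Int.castRingHom A) (-(DD f)) = -(DD f : A) by simp] at h5
  rw [h5]; rfl

section
variable {K : Type} [Field K] [NumberField K]

theorem root_map (H : DynHyp f g r) (m : ℕ) (x : 𝓞 K) (hx : x ∈ rootO K (FF f g (m + 1))) :
    aeval x f ∈ rootO K (FF f g m) := by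
  rw [mem_rootO (H.FF_monic _)] at hx ⊢
  rwa [H.aeval_FF_succ] at hx

theorem root_nonempty (H : DynHyp f g r) (d m : ℕ) (h : (rootO K (FF f g (m + d))).Nonempty) :
    (rootO K (FF f g m)).Nonempty := by
  induction d with
  | zero => exact h
  | succ d ih =>
    obtain ⟨x, hx⟩ := h
    exact ih ⟨_, H.root_map _ x hx⟩

theorem root_ne (H : DynHyp f g r) (m : ℕ) (x : 𝓞 K) (hx : x ∈ rootO K (FF f g (m + 1))) :
    -(f.coeff 1 : 𝓞 K) - x ≠ x := by
  intro h
  rw [mem_rootO (H.FF_monic _)] at hx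
  refine H.not_crit (A := K) m (x : K) ?_ ?_
  · have h1 : 2 * x + (f.coeff 1 : 𝓞 K) = 0 := by linear_combination -h
    have := congrArg (algebraMap (𝓞 K) K) h1
    rwa [map_add, map_mul, map_ofNat, map_intCast, map_zero] at this
  · have : ((aeval x (FF f g (m + 1)) : 𝓞 K) : K) = ((0 : 𝓞 K) : K) := by rw [hx]
    rw [coe_aeval_O, show (Int.castRingHom ℚ) = algebraMap ℤ ℚ from rfl, aeval_map_algebraMap] at this
    simpa using this

theorem pow_fix (H : DynHyp f g r) (n : ℕ) : ∀ (σ : Gal(K/ℚ)) (x : 𝓞 K),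
    σ • aeval x (polyIter f n) = aeval x (polyIter f n) → (σ ^ (2 ^ n)) • x = x := by
  induction n with
  | zero => intro σ x h; simpa [polyIter] using h
  | succ n ih =>
    intro σ x h
    rw [polyIter_succ', aeval_comp] at h
    have h1 := ih σ _ h
    set τ := σ ^ (2 ^ n) with hτ
    have h2 : aeval (τ • x) f = aeval x f := by rw [aeval_smul, h1]
    have h3 : (σ ^ 2 ^ (n + 1)) = τ * τ := by rw [hτ, pow_succ, ← pow_add]; ring_nf
    rw [h3, mul_smul]
    rcases H.fiber _ _ h2.symm with h4 | h4
    · rw [h4, h4]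
    · have h5 : τ • (f.coeff 1 : 𝓞 K) = (f.coeff 1 : 𝓞 K) := by
        have := smul_algebraMap (A := 𝓞 K) τ (f.coeff 1 : ℤ)
        simpa using this
      rw [h4, smul_sub, smul_neg, h5, h4]
      ring

theorem _root_.smul_b (σ : Gal(K/ℚ)) (n : ℤ) : σ • (n : 𝓞 K) = (n : 𝓞 K) := by
  have := smul_algebraMap (A := 𝓞 K) σ (n : ℤ)
  simpa using this

theorem root_zero (H : DynHyp f g r) (m : ℕ) (x : 𝓞 K) (hx : x ∈ rootO K (FF f g m)) :
    aeval x (polyIter f (r + m)) = 0 := by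
  rw [mem_rootO (H.FF_monic _), FF, aeval_comp] at hx
  obtain ⟨q, hq⟩ := H.hdvd
  rw [aeval_polyIter, Function.iterate_add_apply, ← aeval_polyIter, ← aeval_polyIter, hq, map_mul, hx, zero_mul]

theorem prod_NN [IsGalois ℚ K] (H : DynHyp f g r) (m : ℕ) (hm : 1 ≤ m) (h : (rootO K (FF f g m)).Nonempty) :
    ∏ α ∈ rootO K (FF f g m), (4 * α + (DD f : 𝓞 K)) = (NN f g m : 𝓞 K) := by
  obtain ⟨x, hx⟩ := h
  have hp := rootO_prod (H.FF_monic m) (H.FF_irr m) x hx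
  have hcard : (rootO K (FF f g m)).card = g.natDegree * 2 ^ m := by
    have := congrArg natDegree hp
    rw [(H.FF_monic m).natDegree_map, H.FF_natDegree, natDegree_prod_of_monic _ _ (fun i _ => monic_X_sub_C i)] at this
    simpa using this.symm
  have heven : Even (rootO K (FF f g m)).card := by
    rw [hcard, even_iff_two_dvd]
    exact Dvd.dvd.mul_left (dvd_pow_self 2 (by omega)) _
  apply RingOfIntegers.ext
  have h1 := H.NN_cast (A := K) m (-(DD f : K) / 4) (by field_simp)
  have h2 : ((NN f g m : 𝓞 K) : K) = (NN f g m : K) := by simp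
  rw [h2, h1]
  have h3 : aeval (-(DD f : K) / 4) (FF f g m) = ∏ α ∈ rootO K (FF f g m), (-(DD f : K) / 4 - α) := by
    have := congrArg (fun p => aeval (-(DD f : K) / 4) p) hp
    simp only [aeval_map_algebraMap] at this
    rw [this, map_prod]
    refine Finset.prod_congr rfl fun α _ => ?_
    simp
  rw [h3, ← hcard, ← Finset.prod_const, ← Finset.prod_mul_distrib]
  rw [show ((∏ α ∈ rootO K (FF f g m), (4 * α + (DD f : 𝓞 K)) : 𝓞 K) : K) =
    algebraMap (𝓞 K) K (∏ α ∈ rootO K (FF f g m), (4 * α + (DD f : 𝓞 K))) from rfl, map_prod]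
  rw [← one_mul (∏ α ∈ rootO K (FF f g m), _), ← heven.neg_one_pow, ← Finset.prod_const, ← Finset.prod_mul_distrib]
  refine Finset.prod_congr rfl fun α _ => ?_
  rw [map_add, map_mul, map_ofNat, map_intCast]
  ring

/-- the goodness condition at level `m` inside `K` -/
def Good (K : Type) [Field K] [NumberField K] (f g : ℤ[X]) (m : ℕ) : Prop :=
  ∀ A ⊆ rootO K (FF f g m), ∃ t : Gal(K/ℚ), (∀ y ∈ rootO K (FF f g m), t • y = y) ∧
    ∀ x ∈ rootO K (FF f g (m + 1)), (t • x = x ↔ aeval x f ∉ A)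

theorem good_or_square [IsGalois ℚ K] (H : DynHyp f g r) (hG : IsPGroup 2 Gal(K/ℚ)) (m : ℕ) (hm : 1 ≤ m)
    (h : (rootO K (FF f g (m + 1))).Nonempty) :
    Good K f g m ∨ ∃ η : 𝓞 (spl (FF f g m)), η ^ 2 = (NN f g m : 𝓞 (spl (FF f g m))) := by
  obtain ⟨x0, hx0⟩ := h
  have hy0 := H.root_map m x0 hx0
  have hsec : ∀ α ∈ rootO K (FF f g m), ∃ x ∈ rootO K (FF f g (m + 1)), aeval x f = α := by
    intro α hα
    obtain ⟨σ, hσ⟩ := rootO_trans (H.FF_monic m) (H.FF_irr m) _ hy0 α hα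
    exact ⟨σ • x0, smul_mem_rootO (H.FF_monic _) σ x0 hx0, by rw [aeval_smul, hσ]⟩
  choose! s hs using hsec
  rcases good_or_even hG (fun x : 𝓞 K => aeval x f) (fun x => -(f.coeff 1 : 𝓞 K) - x)
    (fun σ x => aeval_smul f σ x) (fun σ x => by rw [smul_sub, smul_neg, smul_b])
    (fun x x' h => H.fiber x x' h) (fun x => by ring) (rootO K (FF f g m)) (rootO K (FF f g (m + 1)))
    (fun σ x hx => smul_mem_rootO (H.FF_monic _) σ x hx)
    (fun x hx y hy => rootO_trans (H.FF_monic m) (H.FF_irr m) x hx y hy)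
    (fun x hx => H.root_map m x hx) (fun x hx => H.root_ne m x hx) s hs with hgood | heven
  · exact Or.inl hgood
  right
  refine square_descend (K := K) (H.FF_monic m) (H.FF_irr m) _ hy0
    (∏ α ∈ rootO K (FF f g m), (2 * s α + (f.coeff 1 : 𝓞 K))) ?_ _ ?_
  · intro σ hσ
    have h1 : ∀ α ∈ rootO K (FF f g m), σ • (2 * s α + (f.coeff 1 : 𝓞 K)) =
        (if σ • s α ≠ s α then -1 else 1) * (2 * s α + (f.coeff 1 : 𝓞 K)) := by
      intro α hα
      have h2 : aeval (σ • s α) f = aeval (s α) f := by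
        rw [aeval_smul, (hs α hα).2, hσ α hα]
      rw [smul_add, smul_mul', smul_b]
      have h3 : σ • (2 : 𝓞 K) = 2 := by
        have := smul_b σ 2
        simpa using this
      rw [h3]
      split_ifs with h4
      · rcases H.fiber _ _ h2.symm with h5 | h5
        · exact absurd h5 h4
        · rw [h5]; ring
      · push Not at h4
        rw [h4]; ring
    rw [Finset.smul_prod', Finset.prod_congr rfl h1, Finset.prod_mul_distrib, Finset.prod_ite]
    rw [Finset.prod_const, Finset.prod_const_one, (heven σ hσ).neg_one_pow]
    ring
  · rw [← H.prod_NN m hm ⟨_, hy0⟩, ← Finset.prod_pow]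
    refine Finset.prod_congr rfl fun α hα => ?_
    rw [← H.four_f, (hs α hα).2]

end

theorem pgroup (H : DynHyp f g r) (m : ℕ) : IsPGroup 2 Gal(spl (FF f g m)/ℚ) := by
  intro σ
  refine ⟨r + m, ?_⟩
  refine spl_gen (H.FF_monic m) _ ?_
  intro β hβ
  refine H.pow_fix (r + m) σ β ?_
  rw [H.root_zero m β hβ, smul_zero]

/-- if infinitely many levels have non-square `NN`, the proportion of elements with a fixed root
tends to zero -/
theorem fix_to_zero (H : DynHyp f g r)
    (hinf : ∀ k : ℕ, ∃ m ≥ k, ¬ ∃ η : 𝓞 (spl (FF f g m)), η ^ 2 = (NN f g m : 𝓞 (spl (FF f g m))))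
    (ε : ℝ) (hε : 0 < ε) : ∃ M0 : ℕ, (fixN Gal(spl (FF f g M0)/ℚ) (rootO (spl (FF f g M0)) (FF f g M0)) : ℝ) ≤
      ε * Fintype.card Gal(spl (FF f g M0)/ℚ) := by
  obtain ⟨k, hk⟩ := fix_small ε hε
  set S := {m : ℕ | 1 ≤ m ∧ ¬ ∃ η : 𝓞 (spl (FF f g m)), η ^ 2 = (NN f g m : 𝓞 (spl (FF f g m)))} with hS
  have hSinf : S.Infinite := by
    rw [Set.infinite_iff_exists_gt]
    intro a
    obtain ⟨m, hm, h⟩ := hinf (a + 1)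
    exact ⟨m, ⟨by omega, h⟩, by omega⟩
  obtain ⟨T, hTS, hTc⟩ := hSinf.exists_subset_card_eq k
  set M0 := T.sup id + 1 with hM0
  have hT : ∀ m ∈ T, m < M0 := fun m hm => Nat.lt_succ_of_le (Finset.le_sup (f := id) hm)
  refine ⟨M0, ?_⟩
  have : IsGalois ℚ (spl (FF f g M0)) := spl_galois _ (H.FF_irr M0)
  have hne : ∀ m ≤ M0, (rootO (spl (FF f g M0)) (FF f g m)).Nonempty := by
    intro m hm
    refine H.root_nonempty (M0 - m) m ?_
    rw [Nat.add_sub_cancel' hm]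
    exact spl_nonempty (H.FF_monic _) (H.FF_irr _)
  refine hk Gal(spl (FF f g M0)/ℚ) (𝓞 (spl (FF f g M0))) (fun x => aeval x f)
    (fun x => -(f.coeff 1 : 𝓞 (spl (FF f g M0))) - x)
    (fun σ x => aeval_smul f σ x) (fun σ x => by rw [smul_sub, smul_neg, smul_b])
    (fun x x' h => H.fiber x x' h) (fun m => rootO (spl (FF f g M0)) (FF f g m)) M0
    (fun m _ σ x hx => smul_mem_rootO (H.FF_monic _) σ x hx)
    (fun m _ x hx y hy => rootO_trans (H.FF_monic m) (H.FF_irr m) x hx y hy)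
    (fun m _ x hx => H.root_map m x hx) T hT hTc.ge ?_
  intro m hm
  have h1 : m ∈ S := hTS hm
  rcases H.good_or_square (H.pgroup M0) m h1.1 (hne (m + 1) (hT m hm)) with h | h
  · exact h
  · exact absurd h h1.2

end DynHyp

end FGal

section GRam
open NumberField Ideal
open scoped Classical

variable {K : Type*} [Field K] [NumberField K] [IsGalois ℚ K]

theorem unram_sq (R : Finset (𝓞 K)) (hR : ∀ σ : Gal(K/ℚ), ∀ β ∈ R, σ • β ∈ R)
    (hgen : ∀ σ : Gal(K/ℚ), (∀ β ∈ R, σ • β = β) → σ = 1) (p : ℕ) (hp : p.Prime)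
    (hdist : ∀ P : Ideal (𝓞 K), P.IsPrime → (p : 𝓞 K) ∈ P → ∀ β ∈ R, ∀ β' ∈ R, β - β' ∈ P → β = β')
    (a : ℤ) (θ : 𝓞 K) (hθ : θ ^ 2 = (a : 𝓞 K)) (hpa : (p : ℤ) ∣ a) : (p : ℤ) ^ 2 ∣ a := by
  by_contra hpa2
  obtain ⟨P, hPab⟩ := above_nonempty (K := K) hp
  have hun := above_under hp hPab
  obtain ⟨hP, hpP⟩ := (mem_above hp).1 hPab
  have : P.LiesOver (span {(p : ℤ)}) := ⟨hun.symm⟩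
  have hm : (span {(p : ℤ)}).IsMaximal :=
    PrincipalIdealRing.isMaximal_of_irreducible (Nat.prime_iff_prime_int.1 hp).irreducible
  have hpr : (span {(p : ℤ)}).IsPrime := hm.isPrime
  have hne : span {(p : ℤ)} ≠ ⊥ := by
    rw [Ne, span_singleton_eq_bot, Nat.cast_eq_zero]; exact hp.ne_zero
  have hin : P.inertia Gal(K/ℚ) = ⊥ := by
    rw [eq_bot_iff]
    intro σ hσ
    refine hgen σ fun β hβ => hdist P hP hpP _ (hR σ β hβ) _ hβ ?_
    exact hσ β
  have hfq : Finite (ℤ ⧸ span {(p : ℤ)}) := Ideal.finiteQuotientOfFreeOfNeBot _ hne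
  have hfin : Finite (span {(p : ℤ)}).ResidueField := inferInstance
  have hcard := card_inertia_eq_ramificationIdxIn (G := Gal(K/ℚ)) (span {(p : ℤ)}) P
  rw [hin, Subgroup.card_bot, ramificationIdxIn_eq_ramificationIdx (span {(p : ℤ)}) P Gal(K/ℚ),
    ← ramificationIdx'_eq_ramificationIdx (span {(p : ℤ)}) P hne] at hcard
  refine (ramificationIdx'_ne_one_iff (p := span {(p : ℤ)}) (P := P) ?_).2 ?_ hcard.symm
  · rw [map_span, Set.image_singleton, span_singleton_le_iff_mem]; simpa using hpP
  rw [map_span, Set.image_singleton, span_singleton_le_iff_mem]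
  obtain ⟨u, rfl⟩ := hpa
  have hu : IsCoprime (p : ℤ) u := by
    rw [(Nat.prime_iff_prime_int.1 hp).irreducible.coprime_iff_not_dvd]
    rintro ⟨v, rfl⟩
    exact hpa2 ⟨v, by ring⟩
  obtain ⟨s, t, hst⟩ := hu
  have hpp : (p : 𝓞 K) ^ 2 ∈ P ^ 2 := Ideal.pow_mem_pow hpP 2
  have hθP : θ ∈ P := by
    refine hP.mem_of_pow_mem 2 ?_
    rw [hθ]; push_cast
    exact P.mul_mem_right _ hpP
  have hθ2 : θ ^ 2 ∈ P ^ 2 := Ideal.pow_mem_pow hθP 2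
  have e : algebraMap ℤ (𝓞 K) (p : ℤ) = s * (p : 𝓞 K) ^ 2 + t * θ ^ 2 := by
    have := congrArg (Int.cast : ℤ → 𝓞 K) hst
    push_cast at this
    rw [hθ]; push_cast
    linear_combination (-(p : 𝓞 K)) * this
  rw [e]
  exact (P ^ 2).add_mem ((P ^ 2).mul_mem_left _ hpp) ((P ^ 2).mul_mem_left _ hθ2)

theorem int_mem_prime {K : Type*} [Field K] [NumberField K] (p : ℕ) (hp : p.Prime) (P : Ideal (𝓞 K))
    (hP : P.IsPrime) (hpP : (p : 𝓞 K) ∈ P) (n : ℤ) (hn : (n : 𝓞 K) ∈ P) : (p : ℤ) ∣ n := by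
  by_contra h
  obtain ⟨s, t, hst⟩ := ((Nat.prime_iff_prime_int.1 hp).irreducible.coprime_iff_not_dvd).2 h
  refine hP.ne_top ((Ideal.eq_top_iff_one P).2 ?_)
  have := congrArg (Int.cast : ℤ → 𝓞 K) hst
  push_cast at this
  rw [← this]
  exact P.add_mem (P.mul_mem_left _ hpP) (P.mul_mem_left _ hn)

theorem bezout_int (g : ℤ[X]) (hirr : Irreducible (g.map (Int.castRingHom ℚ))) :
    ∃ n : ℤ, n ≠ 0 ∧ ∃ a b : ℤ[X], a * g + b * derivative g = C n := by
  obtain ⟨a, b, hab⟩ := hirr.separable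
  obtain ⟨⟨s, hs⟩, hsa⟩ := IsLocalization.integerNormalization_map_to_map (nonZeroDivisors ℤ) a
  obtain ⟨⟨t, ht⟩, htb⟩ := IsLocalization.integerNormalization_map_to_map (nonZeroDivisors ℤ) b
  set A := IsLocalization.integerNormalization (nonZeroDivisors ℤ) a
  set B := IsLocalization.integerNormalization (nonZeroDivisors ℤ) b
  have hs0 := nonZeroDivisors.ne_zero hs
  have ht0 := nonZeroDivisors.ne_zero ht
  refine ⟨s * t, mul_ne_zero hs0 ht0, C t * A, C s * B, ?_⟩
  apply Polynomial.map_injective (Int.castRingHom ℚ) Int.cast_injective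
  rw [derivative_map] at hab
  simp only [algebraMap_int_eq, zsmul_eq_mul] at hsa htb
  simp only [Polynomial.map_add, Polynomial.map_mul, map_C, hsa, htb]
  simp only [eq_intCast, map_intCast, Int.cast_mul]
  have hC : (C ((s : ℚ) * (t : ℚ)) : ℚ[X]) = (s : ℚ[X]) * (t : ℚ[X]) := by simp
  rw [hC]
  linear_combination ((s : ℚ[X]) * (t : ℚ[X])) * hab

theorem g_distinct {K : Type*} [Field K] [NumberField K] (g : ℤ[X]) (n : ℤ) (a b : ℤ[X])
    (hab : a * g + b * derivative g = C n) (P : Ideal (𝓞 K)) (x x' : 𝓞 K)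
    (hx : aeval x g = 0) (hx' : aeval x' g = 0) (hxx : x - x' ∈ P) (hne : x ≠ x') : (n : 𝓞 K) ∈ P := by
  set G := g.map (algebraMap ℤ (𝓞 K)) with hG
  have e1 : G.eval x = 0 := by rw [hG, eval_map_algebraMap, hx]
  have e2 : G.eval x' = 0 := by rw [hG, eval_map_algebraMap, hx']
  obtain ⟨h, hh⟩ := dvd_iff_isRoot.2 e1
  have e3 : h.eval x' = 0 := by
    rw [hh, eval_mul, eval_sub, eval_X, eval_C] at e2
    rcases mul_eq_zero.1 e2 with h1 | h1
    · exact absurd (sub_eq_zero.1 h1).symm hne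
    · exact h1
  have e4 : (derivative G).eval x = h.eval x := by
    rw [hh, derivative_mul]; simp
  have e5 : h.eval x ∈ P := by
    have := sub_dvd_eval_sub x x' h
    rw [e3, sub_zero] at this
    exact P.mem_of_dvd this hxx
  have e6 := congrArg (fun q => aeval x q) hab
  simp only [map_add, map_mul, hx, mul_zero, zero_add, aeval_C] at e6
  have e7 : aeval x (derivative g) = (derivative G).eval x := by
    rw [hG, derivative_map, eval_map_algebraMap]
  rw [e7, e4] at e6
  have : (n : 𝓞 K) = algebraMap ℤ (𝓞 K) n := by simp
  rw [this, ← e6]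
  exact P.mul_mem_left _ e5

variable {f g : ℤ[X]} {r : ℕ}

theorem DynHyp.level_distinct {K : Type} [Field K] [NumberField K] (H : DynHyp f g r) (n : ℤ) (a b : ℤ[X])
    (hab : a * g + b * derivative g = C n) (p : ℕ) (hp : p.Prime) (hpn : ¬ (p : ℤ) ∣ n)
    (P : Ideal (𝓞 K)) (hP : P.IsPrime) (hpP : (p : 𝓞 K) ∈ P) (m : ℕ)
    (hm : ∀ j < m, ¬ (p : ℤ) ∣ NN f g j) :
    ∀ x ∈ rootO K (FF f g m), ∀ x' ∈ rootO K (FF f g m), x - x' ∈ P → x = x' := by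
  induction m with
  | zero =>
    intro x hx x' hx' hxx
    by_contra hne
    rw [mem_rootO (H.FF_monic _)] at hx hx'
    have e : FF f g 0 = g := by simp [FF, polyIter]
    rw [e] at hx hx'
    exact hpn (int_mem_prime p hp P hP hpP n (g_distinct g n a b hab P x x' hx hx' hxx hne))
  | succ m ih =>
    intro x hx x' hx' hxx
    have h1 := ih (fun j hj => hm j (by omega)) _ (H.root_map m x hx) _ (H.root_map m x' hx') ?_
    · rcases H.fiber _ _ h1 with h2 | h2
      · exact h2.symm
      exfalso
      refine hm m (by omega) (int_mem_prime p hp P hP hpP _ ?_)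
      have h3 : 4 * aeval x f + (DD f : 𝓞 K) ∈ P := by
        rw [H.four_f]
        refine Ideal.pow_mem_of_mem _ ?_ 2 (by norm_num)
        have : 2 * x + (f.coeff 1 : 𝓞 K) = x - x' := by rw [h2]; ring
        rwa [this]
      have hy := H.root_map m x hx
      rw [mem_rootO (H.FF_monic _)] at hy
      have h4 : aeval (algebraMap ℤ (𝓞 K) 4 * aeval x f) ((FF f g m).scaleRoots 4) = 0 :=
        scaleRoots_aeval_eq_zero hy
      have h5 := sub_dvd_eval_sub (-(DD f : 𝓞 K)) (algebraMap ℤ (𝓞 K) 4 * aeval x f)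
        (((FF f g m).scaleRoots 4).map (algebraMap ℤ (𝓞 K)))
      rw [eval_map_algebraMap, eval_map_algebraMap, h4, sub_zero] at h5
      have h6 : aeval (-(DD f : 𝓞 K)) ((FF f g m).scaleRoots 4) = (NN f g m : 𝓞 K) := by
        have := aeval_algebraMap_apply (𝓞 K) (-(DD f)) ((FF f g m).scaleRoots 4)
        simpa [NN] using this
      rw [h6] at h5
      refine P.mem_of_dvd h5 ?_
      have h7 : algebraMap ℤ (𝓞 K) 4 = 4 := by simp
      rw [h7]
      have := P.neg_mem h3
      convert this using 1
      ring
    · have := sub_dvd_eval_sub x x' (f.map (algebraMap ℤ (𝓞 K)))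
      rw [eval_map_algebraMap, eval_map_algebraMap] at this
      exact P.mem_of_dvd this hxx

theorem DynHyp.orbit_dvd (H : DynHyp f g r) (p : ℕ) (hp : p.Prime) (hp2 : p ≠ 2) (j m : ℕ) (hjm : j < m)
    (hj : (p : ℤ) ∣ NN f g j) (hm : (p : ℤ) ∣ NN f g m) :
    (p : ℤ) ∣ (fun y => Polynomial.eval y f)^[m - j] 0 := by
  haveI := Fact.mk hp
  have h2 : (2 : ZMod p) ≠ 0 := by
    intro h
    have : ((2 : ℕ) : ZMod p) = 0 := by exact_mod_cast h
    rw [ZMod.natCast_eq_zero_iff] at this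
    exact hp2 ((Nat.prime_dvd_prime_iff_eq hp Nat.prime_two).1 this)
  have h4 : (4 : ZMod p) ≠ 0 := by
    have : (4 : ZMod p) = 2 * 2 := by norm_num
    rw [this]; exact mul_ne_zero h2 h2
  set y : ZMod p := -(DD f : ZMod p) / 4 with hy
  have key : ∀ i, (p : ℤ) ∣ NN f g i → (fun z : ZMod p => aeval z f)^[r + i] y = 0 := by
    intro i hi
    rw [← ZMod.intCast_zmod_eq_zero_iff_dvd, H.NN_cast i y (by rw [hy]; field_simp)] at hi
    have h5 : aeval y (FF f g i) = 0 := by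
      rcases mul_eq_zero.1 hi with h | h
      · exact absurd h (pow_ne_zero _ h4)
      · exact h
    rw [FF, aeval_comp] at h5
    obtain ⟨q, hq⟩ := H.hdvd
    rw [Function.iterate_add_apply, ← aeval_polyIter, ← aeval_polyIter, hq, map_mul, h5, zero_mul]
  have k1 := key j hj
  have k2 := key m hm
  rw [show r + m = (m - j) + (r + j) by omega, Function.iterate_add_apply, k1, ← aeval_polyIter] at k2
  rw [← ZMod.intCast_zmod_eq_zero_iff_dvd]
  have h6 : (fun y : ℤ => Polynomial.eval y f)^[m - j] 0 = aeval (0 : ℤ) (polyIter f (m - j)) := by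
    rw [aeval_polyIter]
    rfl
  rw [h6]
  have := aeval_algebraMap_apply (ZMod p) (0 : ℤ) (polyIter f (m - j))
  rw [map_zero, k2] at this
  simpa using this.symm

/-- if `NN m` is a square in the splitting field, its squarefree part is bounded -/
theorem DynHyp.square_bound (H : DynHyp f g r)
    (horb : {x : ℤ | ∃ n : ℕ, 1 ≤ n ∧ (fun y => Polynomial.eval y f)^[n] 0 = x}.Finite)
    (h0 : ∀ n : ℕ, 1 ≤ n → (fun y => Polynomial.eval y f)^[n] 0 ≠ 0) :
    ∃ A : ℕ, ∀ m, 1 ≤ m → (∃ η : 𝓞 (spl (FF f g m)), η ^ 2 = (NN f g m : 𝓞 (spl (FF f g m)))) →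
      NN f g m ≠ 0 → ∃ a z : ℤ, |a| ≤ A ∧ 0 < z ∧ NN f g m = a * z ^ 2 := by
  have hg0 : Irreducible (g.map (Int.castRingHom ℚ)) := by
    have := H.hirr 0
    simpa [polyIter] using this
  obtain ⟨n, hn0, ca, cb, hab⟩ := bezout_int g hg0
  set Z : ℤ := 2 * n * ∏ x ∈ horb.toFinset, x with hZ
  have hZ0 : Z ≠ 0 := by
    rw [hZ]
    refine mul_ne_zero (mul_ne_zero (by norm_num) hn0) (Finset.prod_ne_zero_iff.2 ?_)
    intro x hx
    rw [Set.Finite.mem_toFinset] at hx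
    obtain ⟨k, hk, rfl⟩ := hx
    exact h0 k hk
  refine ⟨Z.natAbs, ?_⟩
  rintro m hm ⟨η, hη⟩ hNN
  have : IsGalois ℚ (spl (FF f g m)) := spl_galois _ (H.FF_irr m)
  obtain ⟨a, b, hbpos, hba, hsqf⟩ : ∃ a b : ℕ, 0 < b ∧ b ^ 2 * a = (NN f g m).natAbs ∧ Squarefree a := by
    obtain ⟨a, b, ha, hb, hba, hsq⟩ := Nat.sq_mul_squarefree_of_pos (Int.natAbs_pos.2 hNN)
    exact ⟨a, b, hb, hba, hsq⟩
  have hform : NN f g m = ((NN f g m).sign * a) * (b : ℤ) ^ 2 := by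
    conv_lhs => rw [← Int.sign_mul_natAbs (NN f g m), ← hba]
    push_cast; ring
  refine ⟨(NN f g m).sign * a, b, ?_, by exact_mod_cast hbpos, hform⟩
  have hadvd : a ∣ Z.natAbs := by
    rw [← Nat.prod_primeFactors_of_squarefree hsqf]
    refine Finset.prod_primes_dvd _ (fun p hp => (Nat.prime_of_mem_primeFactors hp).prime) ?_
    intro p hp
    have hpp := Nat.prime_of_mem_primeFactors hp
    have hpa := Nat.dvd_of_mem_primeFactors hp
    by_contra hpZ
    have hpZ' : ¬ (p : ℤ) ∣ Z := by rwa [Int.natCast_dvd]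
    have hp2 : p ≠ 2 := by
      rintro rfl
      exact hpZ' ⟨n * ∏ x ∈ horb.toFinset, x, by rw [hZ]; push_cast; ring⟩
    have hpn : ¬ (p : ℤ) ∣ n := by
      intro h
      exact hpZ' (by rw [hZ]; exact (h.mul_left 2).mul_right _)
    have hporb : ∀ k, 1 ≤ k → ¬ (p : ℤ) ∣ (fun y => Polynomial.eval y f)^[k] 0 := by
      intro k hk h
      refine hpZ' ?_
      rw [hZ]
      refine Dvd.dvd.mul_left (h.trans (Finset.dvd_prod_of_mem (fun x : ℤ => x) ?_)) _
      rw [Set.Finite.mem_toFinset]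
      exact ⟨k, hk, rfl⟩
    have hpNN : (p : ℤ) ∣ NN f g m := by
      rw [hform]
      exact Dvd.dvd.mul_right (Dvd.dvd.mul_left (by exact_mod_cast hpa) _) _
    have hlow : ∀ j < m, ¬ (p : ℤ) ∣ NN f g j := fun j hj h =>
      hporb (m - j) (by omega) (H.orbit_dvd p hpp hp2 j m hj h hpNN)
    -- the squarefree part is a square too
    have hbK : (b : spl (FF f g m)) ≠ 0 := Nat.cast_ne_zero.2 hbpos.ne'
    set w : spl (FF f g m) := (η : spl (FF f g m)) / b with hw
    have hw2 : w ^ 2 = (((NN f g m).sign * a : ℤ) : spl (FF f g m)) := by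
      rw [hw, div_pow, div_eq_iff (pow_ne_zero _ hbK)]
      have e := congrArg (algebraMap (𝓞 (spl (FF f g m))) (spl (FF f g m))) hη
      rw [map_pow, map_intCast] at e
      rw [show (η : spl (FF f g m)) = algebraMap _ _ η from rfl, e, hform]
      push_cast
      have hs : ((NN f g m).sign * a * (b:ℤ)^2).sign = (NN f g m).sign := by rw [← hform]
      rw [hs]
    have hi : IsIntegral ℤ w := by
      refine IsIntegral.of_pow (n := 2) (by norm_num) ?_
      rw [hw2]
      exact isIntegral_algebraMap (R := ℤ) (A := spl (FF f g m)) (x := (NN f g m).sign * a)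
    obtain ⟨θ, hθ⟩ : ∃ θ : 𝓞 (spl (FF f g m)), (θ : spl (FF f g m)) = w :=
      ⟨(⟨w, hi⟩ : integralClosure ℤ (spl (FF f g m))), rfl⟩
    have hθ2 : θ ^ 2 = (((NN f g m).sign * a : ℤ) : 𝓞 (spl (FF f g m))) := by
      apply RingOfIntegers.ext
      rw [show ((((NN f g m).sign * a : ℤ) : 𝓞 (spl (FF f g m))) : spl (FF f g m)) =
        (((NN f g m).sign * a : ℤ) : spl (FF f g m)) by simp, ← hw2, ← hθ]
      rfl
    have hfin := unram_sq (rootO (spl (FF f g m)) (FF f g m))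
      (fun σ β hβ => smul_mem_rootO (H.FF_monic m) σ β hβ)
      (fun σ h => spl_gen (H.FF_monic m) σ h) p hpp
      (fun P hP hpP => H.level_distinct n ca cb hab p hpp hpn P hP hpP m hlow)
      _ θ hθ2 (Dvd.dvd.mul_left (by exact_mod_cast hpa) _)
    have hfin2 : p ^ 2 ∣ a := by
      have := Int.natAbs_dvd_natAbs.2 hfin
      rw [Int.natAbs_mul, Int.natAbs_sign_of_ne_zero hNN, one_mul] at this
      simpa [Int.natAbs_pow] using this
    rw [pow_two] at hfin2
    exact hpp.not_isUnit (hsqf p hfin2)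
  rw [abs_mul, Int.abs_sign_of_ne_zero hNN, one_mul]
  have := Nat.le_of_dvd (Int.natAbs_pos.2 hZ0) hadvd
  rw [Nat.abs_cast]
  exact_mod_cast this

end GRam

section GRunge

theorem sqrt_poly_aux (Q : ℤ[X]) (hQ : Q.Monic) (e : ℕ) (hd : Q.natDegree = 2 * e) (k : ℕ) (hk : k ≤ e) :
    ∃ (l : ℕ) (ρ : ℤ[X]), ρ.coeff e = 2 ^ l ∧ ρ.natDegree ≤ e ∧
      ∀ j, 2 * e ≤ j + k → (C ((4 : ℤ) ^ l) * Q - ρ ^ 2).coeff j = 0 := by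
  induction k with
  | zero =>
    refine ⟨0, X ^ e, by simp, by simp, fun j hj => ?_⟩
    rw [← pow_mul]
    simp only [pow_zero, map_one, one_mul, coeff_sub, coeff_X_pow]
    rcases eq_or_lt_of_le (show 2 * e ≤ j by omega) with h | h
    · rw [if_pos (by omega), ← h, ← hd, hQ.coeff_natDegree, sub_self]
    · rw [if_neg (by omega), coeff_eq_zero_of_natDegree_lt (by omega), sub_self]
  | succ k ih =>
    obtain ⟨l, ρ, h1, h2, h3⟩ := ih (by omega)
    obtain ⟨s, hs⟩ : ∃ s, e = s + k + 1 := ⟨e - k - 1, by omega⟩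
    set T := C ((4 : ℤ) ^ l) * Q - ρ ^ 2 with hT
    set t := T.coeff (s + e) with ht
    refine ⟨2 * l + 1, C (2 ^ (l + 1)) * ρ + C t * X ^ s, ?_, ?_, ?_⟩
    · rw [coeff_add, coeff_C_mul, coeff_C_mul, h1, coeff_X_pow, if_neg (by omega)]
      ring
    · refine (natDegree_add_le _ _).trans (max_le ?_ ?_)
      · exact (natDegree_C_mul_le _ _).trans h2
      · exact (natDegree_C_mul_X_pow_le _ _).trans (by omega)
    · intro j hj
      have e1 : C ((4 : ℤ) ^ (2 * l + 1)) * Q - (C (2 ^ (l + 1)) * ρ + C t * X ^ s) ^ 2 =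
          C (4 ^ (l + 1)) * T - C (2 ^ (l + 2) * t) * (ρ * X ^ s) - C (t ^ 2) * X ^ (2 * s) := by
        rw [hT]
        have a1 : (C ((4 : ℤ) ^ (2 * l + 1)) : ℤ[X]) = C 4 ^ (2 * l + 1) := by rw [C_pow]
        have a2 : (C ((4 : ℤ) ^ (l + 1)) : ℤ[X]) = C 4 ^ (l + 1) := by rw [C_pow]
        have a3 : (C ((4 : ℤ) ^ (l)) : ℤ[X]) = C 4 ^ (l) := by rw [C_pow]
        have a4 : (C (4 : ℤ) : ℤ[X]) = C 2 ^ 2 := by rw [← C_pow]; norm_num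
        rw [a1, a2, a3, a4]
        simp only [C_mul, C_pow]
        have a5 : (C (2 : ℤ) : ℤ[X]) = 2 := rfl
        linear_combination (C (2 : ℤ) ^ (l + 1) * ρ * C t * X ^ s) * a5
      rw [e1, coeff_sub, coeff_sub, coeff_C_mul, coeff_C_mul, coeff_C_mul, coeff_mul_X_pow',
        coeff_X_pow, if_neg (show j ≠ 2 * s by omega), if_pos (by omega)]
      rcases eq_or_lt_of_le (show s + e ≤ j by omega) with h | h
      · rw [← h, ← ht, show s + e - s = e by omega, h1]
        rw [show (4 : ℤ) = 2 ^ 2 by norm_num, ← pow_mul]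
        ring
      · rw [h3 j (by omega), coeff_eq_zero_of_natDegree_lt (show ρ.natDegree < j - s by omega)]
        ring

theorem sqrt_poly (Q : ℤ[X]) (hQ : Q.Monic) (e : ℕ) (he : 0 < e) (hd : Q.natDegree = 2 * e) :
    ∃ (l : ℕ) (ρ : ℤ[X]), ρ.leadingCoeff = 2 ^ l ∧ ρ.natDegree = e ∧
      (C ((4 : ℤ) ^ l) * Q - ρ ^ 2).natDegree < e := by
  obtain ⟨l, ρ, h1, h2, h3⟩ := sqrt_poly_aux Q hQ e hd e le_rfl
  have h4 : ρ.natDegree = e := by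
    refine le_antisymm h2 (le_natDegree_of_ne_zero ?_)
    rw [h1]; positivity
  refine ⟨l, ρ, by rw [leadingCoeff, h4, h1], h4, ?_⟩
  have h5 : (C ((4 : ℤ) ^ l) * Q - ρ ^ 2).natDegree ≤ e - 1 :=
    natDegree_le_iff_coeff_eq_zero.2 fun j hj => h3 j (by omega)
  omega

theorem even_pos (p : ℤ[X]) (he : Even p.natDegree) (h0 : 0 < p.natDegree) (hl : 0 < p.leadingCoeff) :
    ∃ B : ℝ, 0 < B ∧ ∀ x : ℝ, B ≤ |x| → 0 < aeval x p := by
  have key : ∀ p : ℤ[X], 0 < p.natDegree → 0 < p.leadingCoeff → ∃ B : ℝ, ∀ x : ℝ, B ≤ x → 0 < aeval x p := by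
    intro p h0 hl
    have hinj : Function.Injective (algebraMap ℤ ℝ) := Int.cast_injective
    have := (p.map (algebraMap ℤ ℝ)).tendsto_atTop_of_leadingCoeff_nonneg
      (by rw [degree_map_eq_of_injective hinj]; exact natDegree_pos_iff_degree_pos.1 h0)
      (by rw [leadingCoeff_map_of_injective hinj]; simp; exact_mod_cast hl.le)
    obtain ⟨B, hB⟩ := eventually_atTop.1 (this.eventually_gt_atTop 0)
    refine ⟨B, fun x hx => ?_⟩
    have := hB x hx
    rwa [eval_map_algebraMap] at this
  obtain ⟨B1, h1⟩ := key p h0 hl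
  obtain ⟨B2, h2⟩ := key (p.comp (-X)) (by rw [natDegree_comp]; simpa using h0) (by
    rw [leadingCoeff_comp (by simp)]
    simpa [he.neg_one_pow] using hl)
  refine ⟨max 1 (max B1 B2), by positivity, fun x hx => ?_⟩
  have hx1 : B1 ≤ |x| := le_trans (by simp) hx
  have hx2 : B2 ≤ |x| := le_trans (by simp) hx
  rcases abs_cases x with ⟨h, _⟩ | ⟨h, _⟩
  · exact h1 x (h ▸ hx1)
  · have := h2 (-x) (h ▸ hx2)
    rw [aeval_comp] at this
    simpa using this

/-- archimedean comparison -/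
theorem arch_cmp (ρ S : ℤ[X]) (e : ℕ) (he : Even e) (he0 : 0 < e) (hρ : ρ.natDegree = e)
    (hl : 0 < ρ.leadingCoeff) (hS : S.natDegree < e) :
    ∃ B : ℝ, 0 < B ∧ ∀ x : ℝ, B ≤ |x| → 0 < aeval x ρ ∧ |aeval x S| < aeval x ρ := by
  have hd : S.degree < ρ.degree := degree_lt_degree (by omega)
  obtain ⟨B0, hB0, h0⟩ := even_pos ρ (hρ ▸ he) (hρ ▸ he0) hl
  have n1 : (ρ + S).natDegree = e := by rw [natDegree_add_eq_left_of_natDegree_lt (by omega), hρ]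
  have n2 : (ρ - S).natDegree = e := by rw [natDegree_sub_eq_left_of_natDegree_lt (by omega), hρ]
  obtain ⟨B1, hB1, h1⟩ := even_pos (ρ + S) (n1 ▸ he) (n1 ▸ he0)
    (by rw [leadingCoeff_add_of_degree_lt' hd]; exact hl)
  obtain ⟨B2, hB2, h2⟩ := even_pos (ρ - S) (n2 ▸ he) (n2 ▸ he0)
    (by rw [leadingCoeff_sub_of_degree_lt hd]; exact hl)
  refine ⟨max B0 (max B1 B2), by positivity, fun x hx => ⟨h0 x (le_trans (by simp) hx), ?_⟩⟩
  have a1 := h1 x (le_trans (by simp) hx)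
  have a2 := h2 x (le_trans (by simp) hx)
  rw [map_add] at a1
  rw [map_sub] at a2
  rw [abs_lt]; constructor <;> linarith

theorem arch_sqrt (Y ρ S : ℝ) (hY : 0 ≤ Y) (hρ : 0 < ρ) (hS : |S| < ρ) (h : Y ^ 2 - ρ ^ 2 = S) : |Y - ρ| < 1 := by
  have h1 : |Y - ρ| * (Y + ρ) = |S| := by
    rw [← abs_of_pos (show 0 < Y + ρ by linarith), ← abs_mul, ← h]
    congr 1; ring
  by_contra hc
  have : Y + ρ ≤ |Y - ρ| * (Y + ρ) := le_mul_of_one_le_left (by linarith) (by linarith)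
  linarith

theorem runge_even (Q ρ : ℤ[X]) (l e : ℕ) (he : Even e) (he0 : 0 < e) (hρ : ρ.natDegree = e)
    (hl : ρ.leadingCoeff = 2 ^ l) (hS : (C ((4 : ℤ) ^ l) * Q - ρ ^ 2).natDegree < e) :
    ∃ B : ℝ, ∀ x : ℤ, B ≤ |(x : ℝ)| → IsSquare ((Q.eval x : ℤ) : ℚ) →
      (C ((4 : ℤ) ^ l) * Q - ρ ^ 2).eval x = 0 := by
  obtain ⟨B, hB, h⟩ := arch_cmp ρ _ e he he0 hρ (by rw [hl]; positivity) hS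
  refine ⟨B, fun x hx hsq => ?_⟩
  obtain ⟨a1, a2⟩ := h x hx
  rw [Rat.isSquare_intCast_iff] at hsq
  obtain ⟨y, hy⟩ := hsq
  have c1 : ∀ p : ℤ[X], aeval (x : ℝ) p = ((p.eval x : ℤ) : ℝ) := fun p => by
    have := aeval_algebraMap_apply (A := ℤ) (B := ℝ) x p
    simpa using this
  rw [c1] at a1 a2
  rw [c1] at a2
  have hSe : (C ((4 : ℤ) ^ l) * Q - ρ ^ 2).eval x = (2 ^ l * |y|) ^ 2 - (ρ.eval x) ^ 2 := by
    rw [eval_sub, eval_mul, eval_C, eval_pow, hy, mul_pow, sq_abs, ← pow_mul, mul_comm l 2, pow_mul]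
    norm_num
    ring
  have := arch_sqrt ((2 ^ l * |y| : ℤ) : ℝ) (ρ.eval x : ℤ) _ (by positivity) a1 a2 (by
    rw [hSe]; push_cast; ring)
  have h5 : 2 ^ l * |y| - ρ.eval x = 0 := by
    rw [← Int.abs_lt_one_iff]
    exact_mod_cast this
  rw [hSe]
  linear_combination (2 ^ l * |y| + ρ.eval x) * h5

theorem scale_mod (p : ℤ[X]) (s t : ℤ) :
    s ∣ (p.scaleRoots s).eval t - p.leadingCoeff * t ^ p.natDegree := by
  rw [eval_eq_sum_range, natDegree_scaleRoots, Finset.sum_range_succ, coeff_scaleRoots, Nat.sub_self, pow_zero,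
    mul_one, leadingCoeff, add_sub_cancel_right]
  refine Finset.dvd_sum fun i hi => ?_
  rw [coeff_scaleRoots]
  have := Finset.mem_range.1 hi
  exact Dvd.dvd.mul_right (Dvd.dvd.mul_left (dvd_pow_self s (by omega)) _) _

theorem scale_val (p : ℤ[X]) (q u : ℤ) (hq : q ≠ 0) :
    (((p.scaleRoots q).eval u : ℤ) : ℝ) = (q : ℝ) ^ p.natDegree * aeval ((u : ℝ) / q) p := by
  have h := scaleRoots_eval₂_mul (p := p) (Int.castRingHom ℝ) ((u : ℝ) / q) q
  have hq' : (q : ℝ) ≠ 0 := by exact_mod_cast hq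
  have h4 : (Int.castRingHom ℝ) q = q := by simp
  rw [h4, mul_div_cancel₀ _ hq'] at h
  rw [aeval_def, show algebraMap ℤ ℝ = Int.castRingHom ℝ from rfl, ← h]
  have h5 := eval₂_at_apply (p := p.scaleRoots q) (Int.castRingHom ℝ) u
  rw [show (Int.castRingHom ℝ) u = (u : ℝ) by simp] at h5
  rw [h5]; rfl

end GRunge

section GRunge2

theorem poly_bdd (p : ℤ[X]) (B : ℝ) : ∃ D : ℝ, ∀ x : ℝ, |x| ≤ B → |aeval x p| ≤ D := by
  obtain ⟨D, hD⟩ := (isCompact_Icc (a := -B) (b := B)).exists_bound_of_continuousOn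
    (f := fun x : ℝ => aeval x p) (Polynomial.continuous_aeval p).continuousOn
  exact ⟨D, fun x hx => hD x (abs_le.1 hx)⟩

theorem odd_pow_mod (u : ℤ) (hu : Odd u) (e : ℕ) (he : Even e) : ∃ k, u ^ e = 1 + 4 * k := by
  obtain ⟨j, rfl⟩ := he
  obtain ⟨v, hv⟩ := hu.pow (n := j)
  exact ⟨v ^ 2 + v, by rw [pow_add, hv]; ring⟩

theorem runge_odd (P Q ρ : ℤ[X]) (l e : ℕ) (he : Even e) (he0 : 0 < e) (hρ : ρ.natDegree = e)
    (hl : ρ.leadingCoeff = 2 ^ l) (hS : (C ((4 : ℤ) ^ l) * Q - ρ ^ 2).natDegree < e)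
    (hP : Even P.natDegree) (hP0 : 0 < P.natDegree) (hPl : 0 < P.leadingCoeff) :
    ∃ N0 : ℕ, ∀ N ≥ N0, ∀ u w : ℤ, Odd u → (∃ k, w = 1 + 4 * k) →
      (w : ℝ) ^ 2 = (((2 : ℤ) ^ N : ℤ) : ℝ) ^ (2 * e) * aeval ((u : ℝ) / ((2 ^ N : ℤ) : ℝ)) Q →
      (0 < aeval ((u : ℝ) / ((2 ^ N : ℤ) : ℝ)) P → 0 < w) →
      aeval ((u : ℝ) / ((2 ^ N : ℤ) : ℝ)) (C ((4 : ℤ) ^ l) * Q - ρ ^ 2) = 0 := by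
  obtain ⟨B1, hB1, h1⟩ := arch_cmp ρ _ e he he0 hρ (by rw [hl]; positivity) hS
  obtain ⟨B2, hB2, h2⟩ := even_pos P hP hP0 hPl
  obtain ⟨D1, hD1⟩ := poly_bdd (C ((4 : ℤ) ^ l) * Q) (max B1 B2)
  obtain ⟨D2, hD2⟩ := poly_bdd ρ (max B1 B2)
  set S := C ((4 : ℤ) ^ l) * Q - ρ ^ 2 with hSdef
  set D : ℝ := |D1| + |D2| + 1 with hD
  have hDpos : 0 < D := by positivity
  obtain ⟨N1, hN1⟩ := pow_unbounded_of_one_lt (2 * 2 ^ l * D) (one_lt_two (α := ℝ))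
  refine ⟨max N1 (l + 2), fun N hN u w hu hw hwQ hwP => ?_⟩
  have hNl : l + 2 ≤ N := le_trans (le_max_right _ _) hN
  have hNN : N1 ≤ N := le_trans (le_max_left _ _) hN
  set q : ℤ := 2 ^ N with hq
  have hq0 : q ≠ 0 := by positivity
  have hqR : (0 : ℝ) < q := by rw [hq]; push_cast; positivity
  have hqD : 2 * 2 ^ l * D < (q : ℝ) := by
    refine hN1.trans_le ?_
    rw [hq]; push_cast
    exact pow_le_pow_right₀ one_le_two hNN
  set x : ℝ := (u : ℝ) / q with hx
  set Y : ℝ := 2 ^ l * w / q ^ e with hY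
  have hY2 : Y ^ 2 = aeval x (C ((4 : ℤ) ^ l) * Q) := by
    rw [hY, div_pow, mul_pow, hwQ, map_mul, aeval_C]
    rw [← pow_mul, ← pow_mul, mul_comm e 2, mul_comm l 2, pow_mul 2 2 l]
    simp only [algebraMap_int_eq, eq_intCast]
    push_cast
    field_simp
    norm_num [mul_comm]
  have hYS : Y ^ 2 - (aeval x ρ) ^ 2 = aeval x S := by rw [hSdef, map_sub, hY2, map_pow (aeval x) ρ]
  have hbound : |Y - aeval x ρ| ≤ D := by
    by_cases hxB : |x| ≤ max B1 B2
    · have a1 := hD1 x hxB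
      have a2 := hD2 x hxB
      rw [← hY2] at a1
      have a3 : |Y| ≤ |Y ^ 2| + 1 := by
        rw [abs_pow]; nlinarith [sq_nonneg (|Y| - 1)]
      have a4 := abs_sub Y (aeval x ρ)
      have := le_abs_self D1
      have := le_abs_self D2
      rw [hD]; linarith
    · push Not at hxB
      have a1 := h1 x (le_trans (le_max_left _ _) hxB.le)
      have a2 := hwP (h2 x (le_trans (le_max_right _ _) hxB.le))
      have a2' : (0 : ℝ) < w := by exact_mod_cast a2
      have := arch_sqrt Y _ _ (by rw [hY]; positivity) a1.1 a1.2 hYS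
      rw [hD]
      have := abs_nonneg D1
      have := abs_nonneg D2
      linarith
  -- integrality
  have hρh := scale_val ρ q u hq0
  have hσ := scale_val S q u hq0
  have hmod := scale_mod ρ q u
  rw [hρ, hl] at hmod
  rw [hρ] at hρh
  set ρh := (ρ.scaleRoots q).eval u with hρhd
  set σ := (S.scaleRoots q).eval u with hσd
  obtain ⟨k, hk⟩ := hmod
  obtain ⟨k1, hk1⟩ := odd_pow_mod u hu e he
  obtain ⟨k2, hk2⟩ := hw
  obtain ⟨N', hN'⟩ : ∃ N', N = l + 2 + N' := ⟨N - (l + 2), by omega⟩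
  set ρ' : ℤ := 1 + 4 * (k1 + 2 ^ N' * k) with hρ'
  have hρρ : ρh = 2 ^ l * ρ' := by
    have : q = 2 ^ l * 4 * 2 ^ N' := by rw [hq, hN', pow_add, pow_add]; norm_num
    rw [this, hk1] at hk
    rw [hρ']
    linear_combination hk
  have hmain : 4 ^ l * ((w - ρ') * (w + ρ')) = σ * q ^ (2 * e - S.natDegree) := by
    have : ((4 ^ l * ((w - ρ') * (w + ρ')) : ℤ) : ℝ) = ((σ * q ^ (2 * e - S.natDegree) : ℤ) : ℝ) := by
      have b1 : ((σ * q ^ (2 * e - S.natDegree) : ℤ) : ℝ) = (q : ℝ) ^ (2 * e) * aeval x S := by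
        push_cast
        rw [hσ, show 2 * e = S.natDegree + (2 * e - S.natDegree) by omega, pow_add]
        rw [Nat.add_sub_cancel_left]; ring
      have b2 : (q : ℝ) ^ e * Y = 2 ^ l * w := by rw [hY]; field_simp
      have b3 : (q : ℝ) ^ e * aeval x ρ = 2 ^ l * ρ' := by
        rw [← hρh, hρρ]; push_cast; ring
      rw [b1, ← hYS, two_mul, pow_add]
      have : (4 : ℝ) ^ l = 2 ^ l * 2 ^ l := by rw [← mul_pow]; norm_num
      push_cast
      rw [this]
      linear_combination (-(q : ℝ) ^ e * Y - 2 ^ l * w) * b2 + ((q : ℝ) ^ e * aeval x ρ + 2 ^ l * ρ') * b3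
    exact_mod_cast this
  have hdvd : q ^ (e + 1) ∣ 4 ^ l * 2 * (w - ρ') := by
    have c1 : q ^ (e + 1) ∣ 4 ^ l * ((w - ρ') * (w + ρ')) := by
      rw [hmain]
      exact Dvd.dvd.mul_left (pow_dvd_pow q (by omega)) _
    have c2 : w + ρ' = 2 * (1 + 2 * (k2 + k1 + 2 ^ N' * k)) := by rw [hk2, hρ']; ring
    rw [c2, show 4 ^ l * ((w - ρ') * (2 * (1 + 2 * (k2 + k1 + 2 ^ N' * k)))) =
      (4 ^ l * 2 * (w - ρ')) * (1 + 2 * (k2 + k1 + 2 ^ N' * k)) by ring] at c1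
    refine IsCoprime.dvd_of_dvd_mul_right ?_ c1
    rw [hq]
    refine IsCoprime.pow_left (IsCoprime.pow_left ?_)
    exact ⟨-(k2 + k1 + 2 ^ N' * k), 1, by ring⟩
  have hwρ : w = ρ' := by
    by_contra hne
    have d1 : q ^ (e + 1) ≤ |4 ^ l * 2 * (w - ρ')| := by
      refine Int.le_of_dvd (abs_pos.2 ?_) ((dvd_abs _ _).2 hdvd)
      exact mul_ne_zero (by positivity) (sub_ne_zero.2 hne)
    have d2 : ((q ^ (e + 1) : ℤ) : ℝ) ≤ ((|4 ^ l * 2 * (w - ρ')| : ℤ) : ℝ) := by exact_mod_cast d1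
    have d3 : ((|4 ^ l * 2 * (w - ρ')| : ℤ) : ℝ) = 2 * 2 ^ l * (q : ℝ) ^ e * |Y - aeval x ρ| := by
      have b2 : (q : ℝ) ^ e * Y = 2 ^ l * w := by rw [hY]; field_simp
      have b3 : (q : ℝ) ^ e * aeval x ρ = 2 ^ l * ρ' := by
        rw [← hρh, hρρ]; push_cast; ring
      have hqe : (0 : ℝ) < 2 * 2 ^ l * (q : ℝ) ^ e := by positivity
      rw [← abs_of_pos hqe, ← abs_mul]
      push_cast
      congr 1
      have : (4 : ℝ) ^ l = 2 ^ l * 2 ^ l := by rw [← mul_pow]; norm_num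
      rw [this]
      linear_combination (-2 * 2 ^ l) * b2 + 2 * 2 ^ l * b3
    rw [d3] at d2
    push_cast at d2
    have d4 : 2 * 2 ^ l * (q : ℝ) ^ e * |Y - aeval x ρ| ≤ (q : ℝ) ^ e * (2 * 2 ^ l * D) := by
      have : (0 : ℝ) ≤ 2 * 2 ^ l * (q : ℝ) ^ e := by positivity
      nlinarith [mul_le_mul_of_nonneg_left hbound this]
    have d5 : (q : ℝ) ^ e * (2 * 2 ^ l * D) < (q : ℝ) ^ e * q := mul_lt_mul_of_pos_left hqD (by positivity)
    rw [pow_succ] at d2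
    linarith
  rw [hwρ, sub_self, zero_mul, mul_zero] at hmain
  have hσ0 : σ = 0 := by
    rcases mul_eq_zero.1 hmain.symm with h | h
    · exact h
    · exact absurd h (pow_ne_zero _ hq0)
  rw [hσ0, Int.cast_zero] at hσ
  rcases mul_eq_zero.1 hσ.symm with h | h
  · exact absurd h (by positivity)
  · exact h

end GRunge2

section GRunge3
open NumberField
variable {f g : ℤ[X]} {r : ℕ}

theorem window_pigeon {α : Type*} [Finite α] (c : ℕ → α) : ∃ i, 1 ≤ i ∧ ∀ M, ∃ m ≥ M, c m = c (m + i) := by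
  have key : ∀ M : ℕ, ∃ ji : ℕ × Fin (Nat.card α + 1), 1 ≤ (ji.2 : ℕ) ∧ M ≤ ji.1 ∧ c ji.1 = c (ji.1 + ji.2) := by
    intro M
    haveI := Fintype.ofFinite α
    obtain ⟨s, t, hst, hc⟩ := Fintype.exists_ne_map_eq_of_card_lt
      (fun s : Fin (Nat.card α + 1) => c (M + s)) (by simp [Nat.card_eq_fintype_card])
    rcases lt_or_gt_of_ne hst with h | h
    · refine ⟨⟨M + s, ⟨t - s, by omega⟩⟩, ?_, ?_, ?_⟩
      · have : (s : ℕ) < t := h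
        simp only; omega
      · simp
      · have : (s : ℕ) < t := h
        simp only at hc ⊢
        rw [hc]; congr 1; omega
    · refine ⟨⟨M + t, ⟨s - t, by omega⟩⟩, ?_, ?_, ?_⟩
      · have : (t : ℕ) < s := h
        simp only; omega
      · simp
      · have : (t : ℕ) < s := h
        simp only at hc ⊢
        rw [← hc]; congr 1; omega
  choose J hJ using key
  obtain ⟨i, hi⟩ := Finite.exists_infinite_fiber (fun M => (J M).2)
  have hi' : ((fun M => (J M).2) ⁻¹' {i}).Infinite := Set.infinite_coe_iff.1 hi
  obtain ⟨M1, hM1⟩ := hi'.nonempty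
  refine ⟨i, ?_, fun M => ?_⟩
  · have := (hJ M1).1
    rw [show (J M1).2 = i from hM1] at this
    exact this
  · obtain ⟨M', hM', hlt⟩ := hi'.exists_gt M
    have := hJ M'
    rw [show (J M').2 = i from hM'] at this
    exact ⟨(J M').1, by omega, this.2.2⟩

/-- critical orbit -/
noncomputable def xs (f : ℤ[X]) (γ : ℚ) (n : ℕ) : ℚ := (fun x : ℚ => aeval x f)^[n] γ

theorem xs_succ (f : ℤ[X]) (γ : ℚ) (n : ℕ) : xs f γ (n + 1) = aeval (xs f γ n) f := by
  rw [xs, xs, Function.iterate_succ_apply']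

theorem xs_FF (f g : ℤ[X]) (γ : ℚ) (n k : ℕ) : aeval (xs f γ n) (FF f g k) = aeval (xs f γ (n + k)) g := by
  rw [FF, aeval_comp, aeval_polyIter, xs, xs, ← Function.iterate_add_apply, add_comm]

theorem DynHyp.NN_xs (H : DynHyp f g r) (γ : ℚ) (hγ : γ = -(f.coeff 1 : ℚ) / 2) (m : ℕ) :
    (NN f g m : ℚ) = 4 ^ (g.natDegree * 2 ^ m) * aeval (xs f γ (1 + m)) g := by
  rw [H.NN_cast m (xs f γ 1), xs_FF]
  rw [xs_succ, H.aeval_f, xs, Function.iterate_zero, id, hγ, DD]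
  push_cast
  ring

theorem DynHyp.NN_ne (H : DynHyp f g r) (m : ℕ) : NN f g m ≠ 0 := by
  intro h
  have h1 := H.NN_xs _ rfl m
  rw [h, add_comm, ← Nat.zero_add (m + 1), ← xs_FF] at h1
  have := H.not_crit (A := ℚ) m (xs f (-(f.coeff 1 : ℚ) / 2) 0) (by
    rw [xs, Function.iterate_zero, id]; ring)
  simp [this] at h1

theorem xs_inj (f g : ℤ[X]) (γ : ℚ)
    (hinf : {q : ℚ | ∃ n : ℕ, 1 ≤ n ∧ aeval ((fun x : ℚ => aeval x f)^[n] γ) g = q}.Infinite) :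
    Function.Injective (xs f γ) := by
  have key : ∀ a b, a < b → xs f γ a ≠ xs f γ b := by
    intro a b hab heq
    apply hinf
    have h : ∀ n, ∃ m < b, xs f γ n = xs f γ m := by
      intro n
      induction n using Nat.strong_induction_on with
      | _ n ih =>
        rcases lt_or_ge n b with h | h
        · exact ⟨n, h, rfl⟩
        · obtain ⟨m, hm, h2⟩ := ih (n - b + a) (by omega)
          refine ⟨m, hm, ?_⟩
          rw [← h2]
          have e1 : xs f γ n = (fun x : ℚ => aeval x f)^[n - b] (xs f γ b) := by
            rw [xs, xs, ← Function.iterate_add_apply]; congr 2; omega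
          rw [e1, ← heq, xs, xs, ← Function.iterate_add_apply]
    refine ((Finset.range b).image (fun m => aeval (xs f γ m) g)).finite_toSet.subset ?_
    rintro q ⟨n, -, hn⟩
    obtain ⟨m, hm, h2⟩ := h n
    simp only [Finset.coe_image, Set.mem_image, Finset.mem_coe, Finset.mem_range]
    refine ⟨m, hm, ?_⟩
    rw [← h2, ← hn]; rfl
  intro a b h
  by_contra hne
  rcases lt_or_gt_of_ne hne with h1 | h1
  · exact key a b h1 h
  · exact key b a h1 h.symm

theorem DynHyp.S_ne (H : DynHyp f g r) (i : ℕ) (hi : 1 ≤ i) (l : ℕ) (ρ : ℤ[X]) :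
    C ((4 : ℤ) ^ l) * (FF f g 2 * FF f g (2 + i)) - ρ ^ 2 ≠ 0 := by
  intro h
  set φ := Int.castRingHom ℚ
  have h1 := congrArg (Polynomial.map φ) h
  rw [Polynomial.map_sub, Polynomial.map_mul, Polynomial.map_mul, map_C, Polynomial.map_pow, Polynomial.map_zero,
    sub_eq_zero] at h1
  set P := (FF f g 2).map φ with hP
  set P' := (FF f g (2 + i)).map φ with hP'
  have p1 : Prime P := (H.FF_irr 2).prime
  have hu : IsUnit (C (φ (4 ^ l)) : ℚ[X]) := by
    rw [isUnit_C]
    exact isUnit_iff_ne_zero.2 (by simp [φ])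
  have hd : P ∣ ρ.map φ := by
    refine p1.dvd_of_dvd_pow (n := 2) ?_
    rw [← h1]; exact ⟨C (φ (4 ^ l)) * P', by ring⟩
  obtain ⟨T, hT⟩ := hd
  have h2 : C (φ (4 ^ l)) * P' = P * T ^ 2 := by
    apply mul_left_cancel₀ p1.ne_zero
    rw [hT] at h1
    linear_combination h1
  have h3 : P ∣ P' := by
    rw [← hu.dvd_mul_left, h2]
    exact dvd_mul_right _ _
  have h4 := (p1.irreducible.associated_of_dvd (H.FF_irr (2 + i)) h3)
  have h5 := natDegree_eq_of_degree_eq (degree_eq_degree_of_associated h4)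
  rw [(H.FF_monic _).natDegree_map, (H.FF_monic _).natDegree_map, H.FF_natDegree, H.FF_natDegree] at h5
  have h6 := Nat.eq_of_mul_eq_mul_left H.g_pos h5
  have := Nat.pow_right_injective le_rfl h6
  omega

theorem roots_fin (S : ℤ[X]) (hS : S ≠ 0) : {x : ℚ | aeval x S = 0}.Finite := by
  refine (S.rootSet_finite ℚ).subset fun x hx => ?_
  rw [mem_rootSet]
  exact ⟨hS, hx⟩

theorem DynHyp.xs_odd (H : DynHyp f g r) (γ : ℚ) (hγ : γ = -(f.coeff 1 : ℚ) / 2) (hb : Odd (f.coeff 1)) (n : ℕ) :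
    ∃ u : ℤ, Odd u ∧ xs f γ n = (u : ℚ) / ((2 ^ (2 ^ n) : ℤ) : ℚ) := by
  induction n with
  | zero => exact ⟨-f.coeff 1, hb.neg, by rw [xs, Function.iterate_zero, id, hγ]; norm_num⟩
  | succ n ih =>
    obtain ⟨u, hu, h⟩ := ih
    refine ⟨u ^ 2 + f.coeff 1 * u * 2 ^ (2 ^ n) + f.coeff 0 * (2 ^ (2 ^ n)) ^ 2, ?_, ?_⟩
    · have h2 : Even ((2 : ℤ) ^ (2 ^ n)) := even_two.pow_of_ne_zero (by positivity)
      exact ((hu.pow).add_even (h2.mul_left _)).add_even ((h2.pow_of_ne_zero two_ne_zero).mul_left _)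
    · rw [xs_succ, H.aeval_f, h, pow_succ 2 n, pow_mul]
      push_cast
      field_simp

theorem DynHyp.runge_fin (H : DynHyp f g r) (γ : ℚ) (hγ : γ = -(f.coeff 1 : ℚ) / 2)
    (hinj : Function.Injective (xs f γ)) (i : ℕ) (hi : 1 ≤ i) :
    {n : ℕ | ∃ a z z' : ℤ, 0 < z ∧ 0 < z' ∧ (4 : ℤ) ∣ z - z' ∧ NN f g (n + 1) = a * z ^ 2 ∧
      NN f g (n + 1 + i) = a * z' ^ 2}.Finite := by
  set d := g.natDegree with hd
  have hd0 : 0 < d := H.g_pos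
  set P := FF f g 2 with hP
  set P' := FF f g (2 + i) with hP'
  set e := 2 * (d * (1 + 2 ^ i)) with he
  have hee : Even e := ⟨d * (1 + 2 ^ i), by rw [he]; ring⟩
  have he0 : 0 < e := by positivity
  have hQm : (P * P').Monic := (H.FF_monic 2).mul (H.FF_monic (2 + i))
  have hQd : (P * P').natDegree = 2 * e := by
    rw [(H.FF_monic 2).natDegree_mul (H.FF_monic (2 + i)), H.FF_natDegree, H.FF_natDegree, he, ← hd, pow_add]
    ring
  obtain ⟨l, ρ, hl, hρ, hS⟩ := sqrt_poly (P * P') hQm e he0 hQd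
  have hS0 := H.S_ne i hi l ρ
  rw [← hP, ← hP'] at hS0
  have hroots := roots_fin _ hS0
  have hval : ∀ n, (NN f g (n + 1) : ℚ) * NN f g (n + 1 + i) =
      ((2 : ℚ) ^ (2 ^ n)) ^ (2 * e) * aeval (xs f γ n) (P * P') := by
    intro n
    rw [H.NN_xs γ hγ, H.NN_xs γ hγ, map_mul, hP, hP', xs_FF, xs_FF, ← hd]
    rw [show 1 + (n + 1) = n + 2 by ring, show 1 + (n + 1 + i) = n + (2 + i) by ring]
    rw [show (4 : ℚ) = 2 ^ 2 by norm_num, he]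
    simp only [← pow_mul]
    have : 2 ^ n * (2 * (2 * (d * (1 + 2 ^ i)))) = 2 * (d * 2 ^ (n + 1)) + 2 * (d * 2 ^ (n + 1 + i)) := by
      rw [pow_add, pow_add, pow_add]; ring
    rw [this, pow_add]
    ring
  rcases Int.even_or_odd (f.coeff 1) with hb | hb
  · -- integral critical point
    obtain ⟨b', hb'⟩ := hb
    set X0 : ℕ → ℤ := fun n => (fun y => eval y f)^[n] (-b') with hX0
    have hX : ∀ n, xs f γ n = (X0 n : ℚ) := by
      intro n
      induction n with
      | zero => rw [xs, hX0]; simp only [Function.iterate_zero, id]; rw [hγ, hb']; push_cast; ring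
      | succ n ih =>
        rw [xs_succ, ih, hX0]
        simp only [Function.iterate_succ_apply']
        have := aeval_algebraMap_apply (A := ℤ) (B := ℚ) (X0 n) f
        simpa using this
    have hXinj : Function.Injective X0 := fun a b h => hinj (by rw [hX, hX, h])
    obtain ⟨B, hB⟩ := runge_even (P * P') ρ l e hee he0 hρ hl hS
    have hE : ({x : ℤ | |(x : ℝ)| < B} ∪ {x : ℤ | ((x : ℚ)) ∈ {x : ℚ | aeval x (C ((4 : ℤ) ^ l) * (P * P') - ρ ^ 2) = 0}}).Finite := by
      refine Set.Finite.union ?_ (hroots.preimage Int.cast_injective.injOn)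
      refine (Set.finite_Icc (-⌈B⌉) ⌈B⌉).subset fun x hx => ?_
      have hx' : |(x : ℝ)| < B := hx
      rw [abs_lt] at hx'
      have := Int.le_ceil B
      constructor
      · have h1 : (-(⌈B⌉ : ℝ)) ≤ x := by linarith
        exact_mod_cast h1
      · have h1 : (x : ℝ) ≤ ⌈B⌉ := by linarith
        exact_mod_cast h1
    refine (hE.preimage hXinj.injOn).subset ?_
    rintro n ⟨a, z, z', hz, hz', -, h1, h2⟩
    have cQ : ∀ p : ℤ[X], aeval (X0 n : ℚ) p = ((p.eval (X0 n) : ℤ) : ℚ) := fun p => by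
      have := aeval_algebraMap_apply (A := ℤ) (B := ℚ) (X0 n) p
      simpa using this
    by_cases hx : |((X0 n : ℤ) : ℝ)| < B
    · exact Or.inl hx
    · right
      have := hB (X0 n) (not_lt.1 hx) (by
        have := hval n
        rw [hX, cQ, h1, h2] at this
        refine ⟨(a * z * z') / ((2 : ℚ) ^ (2 ^ n)) ^ e, ?_⟩
        rw [two_mul, pow_add] at this
        push_cast at this
        field_simp
        linear_combination -this)
      change aeval ((X0 n : ℤ) : ℚ) _ = 0
      rw [cQ, this, Int.cast_zero]
  · have hPd : P.natDegree = d * 2 ^ 2 := H.FF_natDegree 2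
    obtain ⟨N0, hN0⟩ := runge_odd P (P * P') ρ l e hee he0 hρ hl hS
      (by rw [hPd]; exact ⟨d * 2, by ring⟩) (by rw [hPd]; positivity) (by rw [H.FF_monic 2]; exact one_pos)
    refine ((Set.finite_Iio N0).union (hroots.preimage hinj.injOn)).subset ?_
    rintro n ⟨a, z, z', hz, hz', hzz, h1, h2⟩
    by_cases hn : n < N0
    · exact Or.inl hn
    right
    obtain ⟨u, hu, hux⟩ := H.xs_odd γ hγ hb n
    have hcast : ∀ p : ℤ[X], aeval ((u : ℝ) / ((2 ^ (2 ^ n) : ℤ) : ℝ)) p = ((aeval (xs f γ n) p : ℚ) : ℝ) := by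
      intro p
      have := aeval_algebraMap_apply (A := ℚ) (B := ℝ) (xs f γ n) p
      rw [show algebraMap ℚ ℝ (xs f γ n) = (u : ℝ) / ((2 ^ (2 ^ n) : ℤ) : ℝ) by rw [hux]; simp] at this
      rw [this]; rfl
    have hmod : ∃ k, NN f g (n + 1) = 1 + 4 * k := by
      obtain ⟨k, hk⟩ := scale_mod (FF f g (n + 1)) 4 (-(DD f))
      rw [(H.FF_monic _), H.FF_natDegree, one_mul] at hk
      have hDD : Odd (-(DD f)) := by
        rw [DD]
        refine Odd.neg (Odd.sub_even hb.pow ?_)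
        exact ⟨2 * f.coeff 0, by ring⟩
      obtain ⟨k1, hk1⟩ := odd_pow_mod _ hDD (g.natDegree * 2 ^ (n + 1)) ⟨g.natDegree * 2 ^ n, by ring⟩
      rw [hk1] at hk
      exact ⟨k + k1, by rw [NN]; linarith⟩
    obtain ⟨k, hk⟩ := hmod
    obtain ⟨t, ht⟩ := hzz
    have := hN0 (2 ^ n) (le_trans (not_lt.1 hn) (Nat.lt_two_pow_self).le) u (a * z * z') hu
      ⟨k - a * t * z, by linear_combination hk - h1 - a * z * ht⟩ (by
        rw [hcast]
        have := hval n
        rw [h1, h2] at this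
        have := congrArg (Rat.cast : ℚ → ℝ) this
        push_cast at this ⊢
        linear_combination this) (by
        rw [hcast]
        intro hpos
        have hpos' : 0 < aeval (xs f γ n) P := by exact_mod_cast hpos
        have h3 := H.NN_xs γ hγ (n + 1)
        rw [show 1 + (n + 1) = n + 2 by ring, ← xs_FF] at h3
        have h4 : (0 : ℚ) < NN f g (n + 1) := by rw [h3]; positivity
        have h5 : 0 < NN f g (n + 1) := by exact_mod_cast h4
        rw [h1] at h5
        have ha : 0 < a := pos_of_mul_pos_left h5 (by positivity)
        positivity)
    rw [hcast] at this
    have h6 : aeval (xs f γ n) (C ((4 : ℤ) ^ l) * (P * P') - ρ ^ 2) = 0 := by exact_mod_cast this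
    exact h6

theorem DynHyp.not_square_frequent (H : DynHyp f g r)
    (horb : {x : ℤ | ∃ n : ℕ, 1 ≤ n ∧ (fun y => Polynomial.eval y f)^[n] 0 = x}.Finite)
    (h0 : ∀ n : ℕ, 1 ≤ n → (fun y => Polynomial.eval y f)^[n] 0 ≠ 0)
    (γ : ℚ) (hγ : γ = -(f.coeff 1 : ℚ) / 2)
    (hinf : {q : ℚ | ∃ n : ℕ, 1 ≤ n ∧ aeval ((fun x : ℚ => aeval x f)^[n] γ) g = q}.Infinite) :
    ∀ k, ∃ m ≥ k, ¬ ∃ η : 𝓞 (spl (FF f g m)), η ^ 2 = (NN f g m : 𝓞 (spl (FF f g m))) := by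
  obtain ⟨A, hA⟩ := H.square_bound horb h0
  intro k
  by_contra hc
  push Not at hc
  have hdata : ∀ m : ℕ, ∃ a z : ℤ, |a| ≤ A ∧ 0 < z ∧ NN f g (m + k + 1) = a * z ^ 2 := by
    intro m
    exact hA (m + k + 1) (by omega) (hc _ (by omega)) (H.NN_ne _)
  choose a z ha hz hN using hdata
  obtain ⟨i, hi, hfreq⟩ := window_pigeon
    (fun m => ((⟨a m, abs_le.1 (ha m)⟩ : Set.Icc (-(A : ℤ)) A), (z m : ZMod 4)))
  have hfin := H.runge_fin γ hγ (xs_inj f g γ hinf) i hi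
  obtain ⟨B, hB⟩ := hfin.bddAbove
  obtain ⟨m, hm, hmc⟩ := hfreq (B + 1)
  simp only [Prod.mk.injEq, Subtype.mk.injEq] at hmc
  have := hB (show m + k ∈ _ from ⟨a m, z m, z (m + i), hz _, hz _, ?_, hN m, ?_⟩)
  · omega
  · have h2 := ((ZMod.intCast_eq_intCast_iff_dvd_sub _ _ _).1 hmc.2.symm)
    exact_mod_cast h2
  · have h3 : a m = a (m + i) := congrArg Subtype.val hmc.1
    rw [h3, ← hN (m + i)]
    congr 1; omega

end GRunge3

section HFinal
open NumberField
variable {f g : ℤ[X]} {r : ℕ}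

theorem pi_lower : ∀ᶠ N : ℕ in atTop, (N : ℝ) / Real.log N ≤ 2 * (primeCount {p | p.Prime} N : ℝ) := by
  have h1 : ∀ᶠ x : ℝ in atTop, ‖Real.log x‖ ≤ (1 / 10 : ℝ) * ‖(id x : ℝ)‖ :=
    Real.isLittleO_log_id_atTop.def (by norm_num)
  have h2 : Tendsto (fun N : ℕ => (N : ℝ) + 1) atTop atTop :=
    tendsto_atTop_add_const_right _ _ tendsto_natCast_atTop_atTop
  filter_upwards [h2.eventually h1, eventually_ge_atTop 3] with N hN h3
  have h3' : (3 : ℝ) ≤ N := by exact_mod_cast h3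
  have hlog : 0 < Real.log N := Real.log_pos (by linarith)
  have hpi := Chebyshev.pi_ge N
  have hcount : primeCount {p | p.Prime} N = Nat.primeCounting N := by
    rw [primeCount, Nat.primeCounting, Nat.primeCounting', Nat.count_eq_card_filter_range]
    congr 1
    ext p
    simp
  rw [hcount]
  rw [div_le_iff₀ hlog] at hpi ⊢
  have h4 : Real.log (N + 1) ≤ 1 / 10 * (N + 1) := by
    have := (le_abs_self (Real.log ((N : ℝ) + 1))).trans hN
    rwa [id, Real.norm_of_nonneg (by positivity)] at this
  have := Real.log_two_gt_d9
  nlinarith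

theorem div_log_tendsto : Tendsto (fun N : ℕ => (N : ℝ) / Real.log N) atTop atTop := by
  have h1 : Tendsto (fun x : ℝ => x / Real.log x) atTop atTop := by
    have h := Real.isLittleO_log_id_atTop.tendsto_div_nhds_zero
    have h' : Tendsto (fun x : ℝ => Real.log x / x) atTop (nhdsWithin 0 (Set.Ioi 0)) := by
      refine tendsto_nhdsWithin_iff.2 ⟨h, ?_⟩
      filter_upwards [eventually_gt_atTop 1] with x hx
      exact div_pos (Real.log_pos hx) (by linarith)
    refine h'.inv_tendsto_nhdsGT_zero.congr fun x => ?_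
    simp
  exact h1.comp tendsto_natCast_atTop_atTop

theorem early_fin (f g : ℤ[X]) (a₀ : ℤ) (M : ℕ) : {p : ℕ | ∃ n < M,
    Polynomial.eval ((fun x => Polynomial.eval x f)^[n] a₀) g ≠ 0 ∧
    (p : ℤ) ∣ Polynomial.eval ((fun x => Polynomial.eval x f)^[n] a₀) g}.Finite := by
  have : {p : ℕ | ∃ n < M, Polynomial.eval ((fun x => Polynomial.eval x f)^[n] a₀) g ≠ 0 ∧
      (p : ℤ) ∣ Polynomial.eval ((fun x => Polynomial.eval x f)^[n] a₀) g} ⊆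
      ⋃ n ∈ Set.Iio M, Set.Iic (Polynomial.eval ((fun x => Polynomial.eval x f)^[n] a₀) g).natAbs := by
    rintro p ⟨n, hn, h0, hp⟩
    simp only [Set.mem_iUnion]
    refine ⟨n, hn, ?_⟩
    exact Nat.le_of_dvd (Int.natAbs_pos.2 h0) (Int.natCast_dvd.1 hp)
  refine Set.Finite.subset ?_ this
  exact (Set.finite_Iio M).biUnion fun n _ => Set.finite_Iic _

theorem FF_eval (f g : ℤ[X]) (M k : ℕ) (a : ℤ) :
    (FF f g M).eval ((fun x => Polynomial.eval x f)^[k] a) =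
      Polynomial.eval ((fun x => Polynomial.eval x f)^[M + k] a) g := by
  have h := aeval_polyIter (A := ℤ) f M ((fun x => Polynomial.eval x f)^[k] a)
  simp only [coe_aeval_eq_eval] at h
  rw [FF, eval_comp, h, ← Function.iterate_add_apply]

open scoped Classical in
theorem DynHyp.count_bound (H : DynHyp f g r) (a₀ : ℤ)
    (hinf : ∀ k : ℕ, ∃ m ≥ k, ¬ ∃ η : 𝓞 (spl (FF f g m)), η ^ 2 = (NN f g m : 𝓞 (spl (FF f g m))))
    (δ : ℝ) (hδ : 0 < δ) : ∃ B : ℕ, ∀ᶠ N : ℕ in atTop,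
      (primeCount (transOrbitPrimes g f a₀) N : ℝ) ≤ B + 14 * δ * (N / Real.log N) := by
  obtain ⟨M, hM⟩ := H.fix_to_zero hinf δ hδ
  haveI := spl_galois (FF f g M) (H.FF_irr M)
  obtain ⟨x, hx⟩ := spl_nonempty (H.FF_monic M) (H.FF_irr M)
  obtain ⟨B, hB⟩ := frob_density (rootO (spl (FF f g M)) (FF f g M))
    (fun σ β hβ => smul_mem_rootO (H.FF_monic M) σ β hβ)
    (fun σ h => spl_gen (H.FF_monic M) σ h) (H.pgroup M) (FF f g M)
    (rootO_prod (H.FF_monic M) (H.FF_irr M) x hx)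
  have hE := early_fin f g a₀ M
  refine ⟨B + hE.toFinset.card, ?_⟩
  filter_upwards [hB, eventually_ge_atTop 2] with N hN hN2
  have hcardpos : (0 : ℝ) < Nat.card Gal(spl (FF f g M)/ℚ) := by exact_mod_cast Nat.card_pos
  have hfix : ((Finset.univ.filter (fun τ : Gal(spl (FF f g M)/ℚ) =>
      ∃ β ∈ rootO (spl (FF f g M)) (FF f g M), τ • β = β)).card : ℝ) / Nat.card Gal(spl (FF f g M)/ℚ) ≤ δ := by
    rw [div_le_iff₀ hcardpos, Nat.card_eq_fintype_card]
    refine le_trans (le_of_eq ?_) hM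
    rw [fixN]
  have hNN : (0 : ℝ) ≤ N / Real.log N := div_nonneg (by positivity) (Real.log_natCast_nonneg N)
  set S1 := (Finset.range (N + 1)).filter (fun p : ℕ => p.Prime ∧ ∃ n : ℤ, (p : ℤ) ∣ (FF f g M).eval n) with hS1
  have h1 := hN S1 (fun p hp => by
    rw [hS1, Finset.mem_filter, Finset.mem_range] at hp
    exact ⟨hp.2.1, by omega, hp.2.2⟩)
  have h2 : primeCount (transOrbitPrimes g f a₀) N ≤ S1.card + hE.toFinset.card := by
    rw [primeCount]
    refine le_trans (Finset.card_le_card ?_) (Finset.card_union_le _ _)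
    intro p hp
    rw [Finset.mem_filter] at hp
    obtain ⟨hpN, hpp, n, hn0, hn⟩ := hp
    rw [Finset.mem_union]
    rcases lt_or_ge n M with h | h
    · right
      rw [Set.Finite.mem_toFinset]
      exact ⟨n, h, hn0, hn⟩
    · left
      rw [hS1, Finset.mem_filter]
      refine ⟨hpN, hpp, (fun x => Polynomial.eval x f)^[n - M] a₀, ?_⟩
      rw [FF_eval, show M + (n - M) = n by omega]
      exact hn
  have h2' : (primeCount (transOrbitPrimes g f a₀) N : ℝ) ≤ S1.card + hE.toFinset.card := by exact_mod_cast h2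
  push_cast
  rw [mul_div_assoc] at h1
  have := mul_le_mul_of_nonneg_right (mul_le_mul_of_nonneg_left hfix (by norm_num : (0 : ℝ) ≤ 14)) hNN
  linarith

theorem DynHyp.final (H : DynHyp f g r) (a₀ : ℤ)
    (hinf : ∀ k : ℕ, ∃ m ≥ k, ¬ ∃ η : 𝓞 (spl (FF f g m)), η ^ 2 = (NN f g m : 𝓞 (spl (FF f g m)))) :
    HasPrimeDensityZero (transOrbitPrimes g f a₀) := by
  rw [HasPrimeDensityZero, Metric.tendsto_atTop']
  intro ε hε
  obtain ⟨B, hB⟩ := H.count_bound a₀ hinf (ε / 60) (by positivity)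
  have h3 := div_log_tendsto.eventually_ge_atTop ((B + 1) / (ε / 60))
  obtain ⟨N0, hN0⟩ := eventually_atTop.1 ((hB.and pi_lower).and h3)
  refine ⟨N0, fun N hN => ?_⟩
  obtain ⟨⟨h1, h2⟩, h3⟩ := hN0 N hN.le
  rw [Real.dist_eq, sub_zero, abs_of_nonneg (by positivity)]
  rw [div_le_iff₀ (by positivity)] at h3
  set y := (N : ℝ) / Real.log N
  have hB0 : (0 : ℝ) ≤ B := by positivity
  have hy : 0 < y := by
    by_contra hc
    push Not at hc
    nlinarith
  have hpi : (0 : ℝ) < primeCount {p | p.Prime} N := by linarith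
  rw [div_lt_iff₀ hpi]
  have h5 := mul_le_mul_of_nonneg_left h2 hε.le
  have h6 : 0 < ε * primeCount {p | p.Prime} N := by positivity
  nlinarith

end HFinal

theorem density_zero_of_finite_critical_orbit
    (f g : Polynomial ℤ) (hf : f.Monic) (hfdeg : f.natDegree = 2) (hg : g.Monic)
    (γ : ℚ) (hγ : γ = -(f.coeff 1 : ℚ) / 2)
    (hirr : ∀ n : ℕ, Irreducible ((g.comp (polyIter f n)).map (Int.castRingHom ℚ)))
    (hinf : {q : ℚ | ∃ n : ℕ, 1 ≤ n ∧
        Polynomial.aeval ((fun x : ℚ => Polynomial.aeval x f)^[n] γ) g = q}.Infinite)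
    (r : ℕ) (hdvd : g ∣ polyIter f r)
    (horb : {x : ℤ | ∃ n : ℕ, 1 ≤ n ∧ (fun y => Polynomial.eval y f)^[n] 0 = x}.Finite)
    (h0 : ∀ n : ℕ, 1 ≤ n → (fun y => Polynomial.eval y f)^[n] 0 ≠ 0)
    (a₀ : ℤ) :
    HasPrimeDensityZero (transOrbitPrimes g f a₀) := by
  have H : DynHyp f g r := ⟨hf, hfdeg, hg, hirr, hdvd⟩
  exact H.final a₀ (H.not_square_frequent horb h0 γ hγ hinf)
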